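/- Let 0 < a ≤ 1, 0 < λ < 1 and 1/2 < σ < 1. Then, as T → ∞, ∫_1^T t^{2σ−1} |ζ_L(σ+it, a, λ)|² dt = (1/(2σ)) · ζ_H(2σ, a) · T^{2σ} + (2π)^{2σ−1} · ζ_H(2−2σ, λ) · T + O(T^{σ} log T). -/

import Mathlib

open Complex Filter Finset MeasureTheory

/-- The Hurwitz zeta function `ζ_H(s,a)` (meromorphic continuation of
`∑ m, (m+a)^{-s}`). -/
noncomputable def hzeta (a : ℝ) (s : ℂ) : ℂ := HurwitzZeta.hurwitzZeta (a : UnitAddCircle) s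

/-- The Lerch zeta function `ζ_L(s,a,λ)`, defined as the limit of the partial sums
`∑_{m<N} e^{2πimλ} (m+a)^{-s}` (which converge for `Re s > 0` when `0 < λ < 1`). -/
noncomputable def zetaL (a lam : ℝ) (s : ℂ) : ℂ :=
  limUnder atTop
    (fun N : ℕ => ∑ m ∈ Finset.range N,
      Complex.exp (2 * Real.pi * I * lam * m) * ((m : ℂ) + a) ^ (-s))

theorem sub_mul_rpow_le {β : ℝ} (hβ0 : 0 < β) (hβ1 : β < 1) {x : ℝ} (hx : 0 ≤ x) :
    β * (x + 1) ^ (β - 1) ≤ (x + 1) ^ β - x ^ β := by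
  have hx1 : 0 < x + 1 := by linarith
  have h := _root_.rpow_one_add_le_one_add_mul_self (s := -(1 / (x + 1))) (p := β)
    (by rw [neg_le_neg_iff, div_le_one hx1]; linarith) hβ0.le hβ1.le
  have e : 1 + -(1 / (x + 1)) = x / (x + 1) := by field_simp; ring_nf
  rw [e, Real.div_rpow hx hx1.le, div_le_iff₀ (by positivity)] at h
  rw [Real.rpow_sub_one hx1.ne']
  have : (1 + β * -(1 / (x + 1))) * (x + 1) ^ β = (x + 1) ^ β - β * ((x + 1) ^ β / (x + 1)) := by
    field_simp
    rw [← sub_eq_add_neg]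
  linarith

theorem sum_rpow_neg_le {α x₀ : ℝ} (hα0 : 0 < α) (hα1 : α < 1) (hx : 0 < x₀) (k : ℕ) :
    ∑ j ∈ range k, ((j : ℝ) + x₀) ^ (-α) ≤ (x₀ ^ (-α) + 1 / (1 - α)) * (k : ℝ) ^ (1 - α) := by
  have hb : 0 < 1 - α := by linarith
  have main : ∀ k : ℕ, ∑ j ∈ range (k + 1), ((j : ℝ) + x₀) ^ (-α) ≤
      x₀ ^ (-α) + (k : ℝ) ^ (1 - α) / (1 - α) := by
    intro k
    induction k with
    | zero => simp [Real.zero_rpow hb.ne']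
    | succ k ih =>
      rw [sum_range_succ]
      have h := sub_mul_rpow_le hb (by linarith) (Nat.cast_nonneg (α := ℝ) k)
      have h2 : ((k : ℝ) + 1 + x₀) ^ (-α) ≤ ((k : ℝ) + 1) ^ (-α) :=
        Real.rpow_le_rpow_of_nonpos (by positivity) (by linarith) (by linarith)
      have e : (1 - α - 1) = -α := by ring
      rw [e] at h
      push_cast
      have h3 : ((k : ℝ) + 1) ^ (-α) ≤ (((k : ℝ) + 1) ^ (1 - α) - (k : ℝ) ^ (1 - α)) / (1 - α) := by
        rw [le_div_iff₀ hb]; linarith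
      rw [sub_div] at h3
      linarith
  cases k with
  | zero => simp [Real.zero_rpow hb.ne']
  | succ k =>
    refine (main k).trans ?_
    rw [add_mul]
    have h1 : (1 : ℝ) ≤ ((k + 1 : ℕ) : ℝ) ^ (1 - α) :=
      Real.one_le_rpow (by push_cast; linarith [Nat.cast_nonneg (α := ℝ) k]) hb.le
    have h2 : (k : ℝ) ^ (1 - α) ≤ ((k + 1 : ℕ) : ℝ) ^ (1 - α) :=
      Real.rpow_le_rpow (by positivity) (by push_cast; linarith) hb.le
    have h3 : 0 < x₀ ^ (-α) := by positivity
    have h4 : (k : ℝ) ^ (1 - α) / (1 - α) ≤ 1 / (1 - α) * ((k + 1 : ℕ) : ℝ) ^ (1 - α) := by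
      rw [one_div, inv_mul_eq_div]; gcongr
    nlinarith

theorem sum_inv_sub_le (k : ℕ) :
    ∑ j ∈ range k, (1 : ℝ) / ((k : ℝ) - j) ≤ 1 + Real.log k := by
  have h := harmonic_le_one_add_log k
  rw [harmonic] at h
  push_cast at h
  rw [← sum_range_reflect] at h
  refine le_trans (le_of_eq (sum_congr rfl fun j hj => ?_)) h
  have hj' := mem_range.mp hj
  rw [one_div]
  congr 1
  rw [Nat.cast_sub (by omega), Nat.cast_sub (by omega)]
  push_cast; ring

theorem sum_rpow_div_log_le {α x₀ : ℝ} (hα0 : 0 < α) (hα1 : α < 1) (hx : 0 < x₀) :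
    ∃ C : ℝ, 0 < C ∧ ∀ (k : ℕ) (X : ℝ), x₀ + k - 1 / 2 ≤ X → 1 / 2 ≤ X →
      (∀ j ∈ range k, 0 < Real.log (X / ((j : ℝ) + x₀))) ∧
      ∑ j ∈ range k, ((j : ℝ) + x₀) ^ (-α) / Real.log (X / ((j : ℝ) + x₀)) ≤
        C * X ^ (1 - α) * (3 + Real.log X) := by
  set C0 := x₀ ^ (-α) + 1 / (1 - α) with hC0
  have hb : 0 < 1 - α := by linarith
  have hC0p : 0 < C0 := by positivity
  refine ⟨C0 * 2 + 2, by positivity, fun k X hX hX2 => ?_⟩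
  have hX0 : 0 < X := by linarith
  have hlog : ∀ j ∈ range k, (X - (j + x₀)) / X ≤ Real.log (X / ((j : ℝ) + x₀)) ∧
      ((k : ℝ) - j) / 2 ≤ X - (j + x₀) ∧ 1 ≤ (k : ℝ) - j := by
    intro j hj
    have hj' : (j : ℝ) + 1 ≤ k := by exact_mod_cast mem_range.mp hj
    refine ⟨?_, by linarith, by linarith⟩
    have hp : 0 < (j : ℝ) + x₀ := by positivity
    have := Real.one_sub_inv_le_log_of_pos (div_pos hX0 hp)
    rw [inv_div] at this
    rwa [sub_div, div_self hX0.ne']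
  refine ⟨fun j hj => ?_, ?_⟩
  · obtain ⟨h1, h2, h3⟩ := hlog j hj
    exact lt_of_lt_of_le (div_pos (by linarith) hX0) h1
  have hterm : ∀ j ∈ range k, ((j : ℝ) + x₀) ^ (-α) / Real.log (X / ((j : ℝ) + x₀)) ≤
      ((j : ℝ) + x₀) ^ (-α) + 2 * X ^ (1 - α) * (1 / ((k : ℝ) - j)) := by
    intro j hj
    obtain ⟨h1, h2, h3⟩ := hlog j hj
    have hp : 0 < (j : ℝ) + x₀ := by positivity
    have hd : 0 < X - (j + x₀) := by linarith
    calc ((j : ℝ) + x₀) ^ (-α) / Real.log (X / ((j : ℝ) + x₀))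
        ≤ ((j : ℝ) + x₀) ^ (-α) / ((X - (j + x₀)) / X) := by gcongr
      _ = ((j : ℝ) + x₀) ^ (-α) + ((j : ℝ) + x₀) ^ (1 - α) / (X - (j + x₀)) := by
          have : ((j : ℝ) + x₀) ^ (1 - α) = ((j : ℝ) + x₀) ^ (-α) * ((j : ℝ) + x₀) := by
            rw [← Real.rpow_add_one hp.ne']; congr 1; ring
          rw [this]; field_simp; ring
      _ ≤ ((j : ℝ) + x₀) ^ (-α) + X ^ (1 - α) / (((k : ℝ) - j) / 2) := by
          gcongr
          · linarith
      _ = _ := by field_simp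
  refine (sum_le_sum hterm).trans ?_
  rw [sum_add_distrib, ← mul_sum]
  rcases Nat.eq_zero_or_pos k with rfl | hk
  · simp
    have : Real.log (1 / 2) ≤ Real.log X := Real.log_le_log (by norm_num) hX2
    rw [one_div, Real.log_inv] at this
    have h2 := Real.log_two_lt_d9
    have h3 : 0 ≤ 3 + Real.log X := by linarith
    positivity
  have hk1 : (1 : ℝ) ≤ k := by exact_mod_cast hk
  have hk2 : (k : ℝ) ≤ 2 * X := by linarith
  have hlk : Real.log k ≤ 1 + Real.log X := by
    calc Real.log k ≤ Real.log (2 * X) := Real.log_le_log (by linarith) hk2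
      _ = Real.log 2 + Real.log X := Real.log_mul (by norm_num) hX0.ne'
      _ ≤ _ := by linarith [Real.log_two_lt_d9]
  have hlk0 : 0 ≤ Real.log k := Real.log_nonneg hk1
  have s1 := sum_rpow_neg_le hα0 hα1 hx k
  have s2 := sum_inv_sub_le k
  have s3 : (k : ℝ) ^ (1 - α) ≤ 2 * X ^ (1 - α) := by
    calc (k : ℝ) ^ (1 - α) ≤ (2 * X) ^ (1 - α) := by gcongr
      _ = 2 ^ (1 - α) * X ^ (1 - α) := Real.mul_rpow (by norm_num) hX0.le
      _ ≤ 2 ^ (1 : ℝ) * X ^ (1 - α) := by gcongr <;> linarith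
      _ = _ := by norm_num
  have hXp : 0 < X ^ (1 - α) := by positivity
  calc _ ≤ C0 * (2 * X ^ (1 - α)) + 2 * X ^ (1 - α) * (1 + Real.log k) := by
        gcongr
        exact s1.trans (by gcongr)
    _ ≤ C0 * (2 * X ^ (1 - α)) * (3 + Real.log X) + 2 * X ^ (1 - α) * (3 + Real.log X) := by
        gcongr ?_ + 2 * X ^ (1 - α) * ?_
        · exact le_mul_of_one_le_right (by positivity) (by linarith)
        · linarith
    _ = _ := by ring

/-- The difference between `(n + x) ^ (-s)` and the integral of `u ^ (-s)` over
`[n + x, n + 1 + x]`. -/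
noncomputable def emTerm (x : ℝ) (n : ℕ) (s : ℂ) : ℂ :=
  ((n + x : ℝ) : ℂ) ^ (-s) +
    (((n + 1 + x : ℝ) : ℂ) ^ (1 - s) - ((n + x : ℝ) : ℂ) ^ (1 - s)) / (s - 1)

theorem sum_emTerm (x : ℝ) (s : ℂ) (M : ℕ) :
    ∑ n ∈ range M, emTerm x n s = ∑ n ∈ range M, ((n + x : ℝ) : ℂ) ^ (-s) +
      (((M + x : ℝ) : ℂ) ^ (1 - s) - (x : ℂ) ^ (1 - s)) / (s - 1) := by
  simp only [emTerm, sum_add_distrib, ← sum_div]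
  congr 2
  have := sum_range_sub (fun n : ℕ => ((n + x : ℝ) : ℂ) ^ (1 - s)) M
  simpa using this

theorem hasDerivAt_ofReal_cpow_neg {y : ℝ} (hy : 0 < y) (s : ℂ) :
    HasDerivAt (fun v : ℝ => (v : ℂ) ^ (-s)) (-s * (y : ℂ) ^ (-s - 1)) y := by
  have h := (hasDerivAt_id (y : ℂ)).cpow_const (c := -s) (by left; simpa using hy)
  simpa using h.comp_ofReal

theorem norm_cpow_neg_sub_le {y v : ℝ} (hy : 0 < y) (hv : 0 ≤ v) (hv1 : v ≤ 1) {s : ℂ}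
    (hs : 0 < s.re) :
    ‖(y : ℂ) ^ (-s) - ((y + v : ℝ) : ℂ) ^ (-s)‖ ≤ ‖s‖ * y ^ (-s.re - 1) := by
  have h := (convex_Icc y (y + 1)).norm_image_sub_le_of_norm_hasDerivWithin_le
    (f := fun v : ℝ => (v : ℂ) ^ (-s)) (f' := fun w => -s * (w : ℂ) ^ (-s - 1))
    (C := ‖s‖ * y ^ (-s.re - 1)) (x := y + v) (y := y)
    (fun w hw => (hasDerivAt_ofReal_cpow_neg (by linarith [hw.1]) s).hasDerivWithinAt)
    (fun w hw => by
      rw [norm_mul, norm_neg, norm_cpow_eq_rpow_re_of_pos (by linarith [hw.1])]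
      gcongr
      simp only [sub_re, neg_re, one_re]
      exact Real.rpow_le_rpow_of_nonpos hy hw.1 (by linarith))
    ⟨by linarith, by linarith⟩ ⟨le_rfl, by linarith⟩
  refine h.trans ?_
  have : ‖y - (y + v)‖ ≤ 1 := by
    rw [Real.norm_eq_abs, abs_le]; constructor <;> linarith
  exact mul_le_of_le_one_right (by positivity) this

theorem norm_emTerm_le {x : ℝ} (hx : 0 < x) (n : ℕ) {s : ℂ} (hs : 0 < s.re) (hs1 : s ≠ 1) :
    ‖emTerm x n s‖ ≤ ‖s‖ * (n + x) ^ (-s.re - 1) := by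
  have hy : 0 < n + x := by positivity
  have hs1' : s - 1 ≠ 0 := sub_ne_zero.mpr hs1
  have h := (convex_Icc (0 : ℝ) 1).norm_image_sub_le_of_norm_hasDerivWithin_le
    (f := fun v : ℝ => (v : ℂ) * ((n + x : ℝ) : ℂ) ^ (-s) +
      ((v + (n + x) : ℝ) : ℂ) ^ (-(s - 1)) / (s - 1))
    (f' := fun v : ℝ => ((n + x : ℝ) : ℂ) ^ (-s) - (((n + x) + v : ℝ) : ℂ) ^ (-s))
    (C := ‖s‖ * (n + x) ^ (-s.re - 1)) (x := 0) (y := 1)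
    (fun v hv => by
      have h1 := (hasDerivAt_ofReal_cpow_neg (y := v + (n + x)) (by linarith [hv.1]) (s - 1))
      have h2 := (h1.comp_add_const v (n + x)).div_const (s - 1)
      have h3 := ((hasDerivAt_id (v : ℂ)).comp_ofReal.mul_const (((n + x : ℝ) : ℂ) ^ (-s)))
      refine ((h3.add h2).congr_deriv ?_).hasDerivWithinAt
      have e : -(s - 1) - 1 = -s := by ring
      rw [e, add_comm v (n + x)]
      field_simp
      ring)
    (fun v hv => norm_cpow_neg_sub_le hy hv.1 hv.2 hs)
    ⟨by linarith, by linarith⟩ ⟨by linarith, by linarith⟩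
  simp only [sub_zero, norm_one, mul_one] at h
  refine le_trans (le_of_eq ?_) h
  rw [emTerm]
  congr 1
  push_cast
  have e : -(s - 1) = 1 - s := by ring
  rw [e]
  have e2 : (1 : ℂ) + (n + x) = n + 1 + x := by ring
  rw [e2]
  field_simp
  ring_nf

theorem summable_nat_add_rpow {x : ℝ} (hx : 0 < x) {p : ℝ} (hp : 1 < p) :
    Summable fun n : ℕ => ((n : ℝ) + x) ^ (-p) := by
  have h := (Real.summable_one_div_nat_add_rpow x p).mpr hp
  refine h.congr fun n => ?_
  have : 0 < (n : ℝ) + x := by positivity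
  rw [abs_of_pos this, Real.rpow_neg this.le, one_div]

theorem summable_emTerm {x : ℝ} (hx : 0 < x) {s : ℂ} (hs : 0 < s.re) (hs1 : s ≠ 1) :
    Summable fun n : ℕ => emTerm x n s := by
  refine Summable.of_norm_bounded ((summable_nat_add_rpow hx (p := s.re + 1) (by linarith)).mul_left
    ‖s‖) fun n => ?_
  have e : -(s.re + 1) = -s.re - 1 := by ring
  rw [e]
  exact norm_emTerm_le hx n hs hs1

theorem differentiableOn_tsum_emTerm {x : ℝ} (hx : 0 < x) :
    DifferentiableOn ℂ (fun s => ∑' n : ℕ, emTerm x n s) {s : ℂ | 0 < s.re ∧ s ≠ 1} := by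
  intro s ⟨hs, hs1⟩
  set U : Set ℂ := ({z : ℂ | s.re / 2 < z.re} ∩ Metric.ball 0 (‖s‖ + 1)) ∩ {z | z ≠ 1} with hU
  have hUo : IsOpen U :=
    ((isOpen_lt continuous_const continuous_re).inter Metric.isOpen_ball).inter
      isOpen_compl_singleton
  have hsU : s ∈ U := ⟨⟨by simp; linarith, by simp⟩, hs1⟩
  have hd := differentiableOn_tsum_of_summable_norm (F := fun n s => emTerm x n s)
    (u := fun n : ℕ => (‖s‖ + 1) * (((n + 1 : ℕ) : ℝ) + x) ^ (-(s.re / 2 + 1)) +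
      (‖s‖ + 1) * ((n : ℝ) + x) ^ (-(s.re / 2 + 1)) +
      if n = 0 then (‖s‖ + 1) * (x ^ (-(s.re / 2 + 1)) + x ^ (-(‖s‖ + 1) - 1)) else 0) (U := U)
    (((((summable_nat_add_rpow hx (by linarith)).comp_injective
      (add_left_injective 1)).mul_left _).add
        ((summable_nat_add_rpow hx (by linarith)).mul_left _)).add
        (summable_of_ne_finset_zero (s := {0}) (by simp; intro b hb; simp [hb])))
    (fun n => by
      intro z hz
      have hy : ((n : ℂ) + x) ≠ 0 := by
        have : 0 < (n : ℝ) + x := by positivity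
        exact_mod_cast this.ne'
      have hy2 : ((n : ℂ) + 1 + x) ≠ 0 := by
        have : 0 < (n : ℝ) + 1 + x := by positivity
        exact_mod_cast this.ne'
      have hz1 : z - 1 ≠ 0 := sub_ne_zero.mpr hz.2
      unfold emTerm
      refine DifferentiableAt.differentiableWithinAt ?_
      refine DifferentiableAt.add ?_ (DifferentiableAt.div (DifferentiableAt.sub ?_ ?_) ?_ hz1)
      · exact (differentiableAt_id.neg).const_cpow (by left; push_cast; exact hy)
      · exact (differentiableAt_id.const_sub 1).const_cpow (by left; push_cast; exact hy2)
      · exact (differentiableAt_id.const_sub 1).const_cpow (by left; push_cast; exact hy)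
      · exact differentiableAt_id.sub_const 1)
    hUo
    (fun n z hz => by
      obtain ⟨⟨hz1, hz2⟩, hz3⟩ := hz
      simp only [Set.mem_ofPred_eq] at hz1
      have hz2' : ‖z‖ < ‖s‖ + 1 := by simpa using hz2
      refine (norm_emTerm_le hx n (by linarith) hz3).trans ?_
      have hp1 : 0 ≤ (((n + 1 : ℕ) : ℝ) + x) ^ (-(s.re / 2 + 1)) := by positivity
      have hp2 : 0 ≤ ((n : ℝ) + x) ^ (-(s.re / 2 + 1)) := by positivity
      rcases Nat.eq_zero_or_pos n with rfl | hn
      · simp only [if_true, Nat.cast_zero, zero_add]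
        have hA : x ^ (-z.re - 1) ≤ x ^ (-(s.re / 2 + 1)) + x ^ (-(‖s‖ + 1) - 1) := by
          rcases le_total 1 x with h | h
          · have : x ^ (-z.re - 1) ≤ x ^ (-(s.re / 2 + 1)) :=
              Real.rpow_le_rpow_of_exponent_le h (by linarith)
            have h3 : 0 ≤ x ^ (-(‖s‖ + 1) - 1) := by positivity
            linarith
          · have : x ^ (-z.re - 1) ≤ x ^ (-(‖s‖ + 1) - 1) :=
              Real.rpow_le_rpow_of_exponent_ge hx h
                (by linarith [(Complex.abs_re_le_norm z).trans hz2'.le, le_abs_self z.re])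
            have h3 : 0 ≤ x ^ (-(s.re / 2 + 1)) := by positivity
            linarith
        have : ‖z‖ * x ^ (-z.re - 1) ≤
            (‖s‖ + 1) * (x ^ (-(s.re / 2 + 1)) + x ^ (-(‖s‖ + 1) - 1)) := by gcongr
        have h4 : 0 ≤ (‖s‖ + 1) * (((0 + 1 : ℕ) : ℝ) + x) ^ (-(s.re / 2 + 1)) := by positivity
        have h5 : 0 ≤ (‖s‖ + 1) * x ^ (-(s.re / 2 + 1)) := by positivity
        simp only [zero_add] at h4
        linarith
      · simp only [hn.ne', if_false, add_zero]
        have h1 : 1 ≤ (n : ℝ) + x := by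
          have : (1 : ℝ) ≤ n := by exact_mod_cast hn
          linarith
        have : ‖z‖ * (n + x) ^ (-z.re - 1) ≤ (‖s‖ + 1) * ((n : ℝ) + x) ^ (-(s.re / 2 + 1)) := by
          gcongr
          linarith
        have h4 : 0 ≤ (‖s‖ + 1) * (((n + 1 : ℕ) : ℝ) + x) ^ (-(s.re / 2 + 1)) := by positivity
        linarith)
  exact ((hd s hsU).differentiableAt (hUo.mem_nhds hsU)).differentiableWithinAt

theorem tendsto_nat_add_cpow_zero (x : ℝ) {s : ℂ} (hs : s.re < 0) :
    Tendsto (fun M : ℕ => ((M + x : ℝ) : ℂ) ^ s) atTop (nhds 0) := by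
  rw [tendsto_zero_iff_norm_tendsto_zero]
  have h1 : Tendsto (fun M : ℕ => (M : ℝ) + x) atTop atTop :=
    tendsto_atTop_add_const_right _ _ tendsto_natCast_atTop_atTop
  have h2 := (tendsto_rpow_neg_atTop (y := -s.re) (by linarith)).comp h1
  refine h2.congr' ?_
  filter_upwards [h1.eventually_gt_atTop 0] with M hM
  simp only [Function.comp]
  rw [norm_cpow_eq_rpow_re_of_pos hM, neg_neg]

theorem hzeta_eq_of_one_lt_re {x : ℝ} (hx : 0 < x) (hx1 : x ≤ 1) {s : ℂ} (hs : 1 < s.re) :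
    hzeta x s = (x : ℂ) ^ (1 - s) / (s - 1) + ∑' n : ℕ, emTerm x n s := by
  have h1 := (HurwitzZeta.hasSum_hurwitzZeta_of_one_lt_re (a := x) ⟨hx.le, hx1⟩ hs).tendsto_sum_nat
  have hs1 : s ≠ 1 := by rintro rfl; simp at hs
  have h2 := (summable_emTerm hx (by linarith) hs1).hasSum.tendsto_sum_nat
  have h3 := tendsto_nat_add_cpow_zero x (s := 1 - s) (by simp; linarith)
  refine tendsto_nhds_unique h1 ?_
  have h4 := (tendsto_const_nhds (x := (x : ℂ) ^ (1 - s) / (s - 1))).add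
    (h2.sub (h3.div_const (s - 1)))
  simp only [zero_div, sub_zero] at h4
  refine h4.congr fun M => ?_
  rw [sum_emTerm, sub_div]
  ring_nf
  refine sum_congr rfl fun n _ => ?_
  rw [cpow_neg]
  push_cast
  simp

theorem hzeta_eq_of_re_pos_im_pos {x : ℝ} (hx : 0 < x) (hx1 : x ≤ 1) {s : ℂ} (hs : 0 < s.re)
    (hs' : 0 < s.im) :
    hzeta x s = (x : ℂ) ^ (1 - s) / (s - 1) + ∑' n : ℕ, emTerm x n s := by
  set U : Set ℂ := {z : ℂ | 0 < z.re} ∩ {z : ℂ | 0 < z.im} with hU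
  have hUo : IsOpen U :=
    (isOpen_lt continuous_const continuous_re).inter (isOpen_lt continuous_const continuous_im)
  have hne : ∀ z ∈ U, z ≠ 1 := by
    rintro z hz rfl
    simpa using hz.2
  have hUc : IsPreconnected U :=
    ((convex_halfSpace_re_gt 0).inter (convex_halfSpace_im_gt 0)).isPreconnected
  have hf : AnalyticOnNhd ℂ (hzeta x) U := by
    refine DifferentiableOn.analyticOnNhd (fun z hz => ?_) hUo
    exact (HurwitzZeta.differentiableAt_hurwitzZeta _ (hne z hz)).differentiableWithinAt
  have hg : AnalyticOnNhd ℂ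
      (fun s => (x : ℂ) ^ (1 - s) / (s - 1) + ∑' n : ℕ, emTerm x n s) U := by
    refine DifferentiableOn.analyticOnNhd ?_ hUo
    refine DifferentiableOn.add (fun z hz => ?_)
      ((differentiableOn_tsum_emTerm hx).mono fun z hz => ⟨hz.1, hne z hz⟩)
    refine DifferentiableAt.differentiableWithinAt (DifferentiableAt.div ?_ ?_
      (sub_ne_zero.mpr (hne z hz)))
    · exact (differentiableAt_id.const_sub 1).const_cpow (by left; exact_mod_cast hx.ne')
    · exact differentiableAt_id.sub_const 1
  refine hf.eqOn_of_preconnected_of_eventuallyEq hg hUc (z₀ := 2 + I) ⟨by simp, by simp⟩ ?_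
    ⟨hs, hs'⟩
  have : {z : ℂ | 1 < z.re} ∈ nhds (2 + I) :=
    (isOpen_lt continuous_const continuous_re).mem_nhds (by simp)
  filter_upwards [this] with z hz using hzeta_eq_of_one_lt_re hx hx1 hz

theorem hzeta_eq_of_pos {x : ℝ} (hx : 0 < x) (hx1 : x ≤ 1) {s : ℝ} (hs : 0 < s) (hs1 : s ≠ 1) :
    hzeta x s = (x : ℂ) ^ (1 - s : ℂ) / (s - 1) + ∑' n : ℕ, emTerm x n s := by
  have hs1' : (s : ℂ) ≠ 1 := by exact_mod_cast hs1
  have hpath : Tendsto (fun ε : ℝ => (s : ℂ) + ε * I) (nhdsWithin 0 (Set.Ioi 0)) (nhds (s : ℂ)) := by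
    have : Continuous fun ε : ℝ => (s : ℂ) + ε * I := by fun_prop
    simpa using (this.tendsto 0).mono_left nhdsWithin_le_nhds
  have h1 : Tendsto (fun ε : ℝ => hzeta x (s + ε * I)) (nhdsWithin 0 (Set.Ioi 0))
      (nhds (hzeta x s)) :=
    (HurwitzZeta.differentiableAt_hurwitzZeta (x : UnitAddCircle) hs1').continuousAt.tendsto.comp
      hpath
  have hUo : IsOpen {s : ℂ | 0 < s.re ∧ s ≠ 1} :=
    (isOpen_lt continuous_const continuous_re).inter isOpen_compl_singleton
  have hmem : (s : ℂ) ∈ {s : ℂ | 0 < s.re ∧ s ≠ 1} := ⟨by simpa using hs, hs1'⟩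
  have hd : ContinuousAt (fun s : ℂ => (x : ℂ) ^ (1 - s) / (s - 1) + ∑' n : ℕ, emTerm x n s) s := by
    refine ContinuousAt.add ?_ (((differentiableOn_tsum_emTerm hx) _ hmem).differentiableAt
      (hUo.mem_nhds hmem)).continuousAt
    refine DifferentiableAt.continuousAt (𝕜 := ℂ) (DifferentiableAt.div ?_ ?_
      (sub_ne_zero.mpr hs1'))
    · exact (differentiableAt_id.const_sub 1).const_cpow (by left; exact_mod_cast hx.ne')
    · exact differentiableAt_id.sub_const 1
  refine tendsto_nhds_unique h1 ((hd.tendsto.comp hpath).congr' ?_)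
  filter_upwards [self_mem_nhdsWithin] with ε hε
  have hε' : 0 < ε := hε
  exact (hzeta_eq_of_re_pos_im_pos hx hx1 (by simpa using hs) (by simpa using hε')).symm

theorem emTerm_ofReal {x : ℝ} (hx : 0 < x) (n : ℕ) (s : ℝ) :
    emTerm x n s = (((n + x) ^ (-s) + ((n + 1 + x) ^ (1 - s) - (n + x) ^ (1 - s)) / (s - 1) : ℝ) : ℂ) := by
  have h1 : 0 ≤ (n : ℝ) + x := by positivity
  have h2 : 0 ≤ (n : ℝ) + 1 + x := by positivity
  rw [emTerm]
  push_cast [ofReal_cpow h1, ofReal_cpow h2]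
  rfl

theorem rpow_neg_bounds {y s : ℝ} (hy : 0 < y) (hs : 0 < s) (hs1 : s ≠ 1) :
    (y + 1) ^ (-s) ≤ ((y + 1) ^ (1 - s) - y ^ (1 - s)) / (1 - s) ∧
    ((y + 1) ^ (1 - s) - y ^ (1 - s)) / (1 - s) ≤ y ^ (-s) := by
  have hs1' : 1 - s ≠ 0 := sub_ne_zero.mpr hs1.symm
  obtain ⟨c, hc, h⟩ := exists_hasDerivAt_eq_slope (fun v : ℝ => v ^ (1 - s) / (1 - s))
    (fun v => v ^ (-s)) (a := y) (b := y + 1) (by linarith)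
    (fun v hv => by
      have : v ≠ 0 := by have := hv.1; linarith
      exact ((Real.continuousAt_rpow_const v _ (Or.inl this)).div_const _).continuousWithinAt)
    (fun v hv => by
      have : v ≠ 0 := by have := hv.1; linarith
      refine ((Real.hasDerivAt_rpow_const (p := 1 - s) (Or.inl this)).div_const (1 - s)).congr_deriv ?_
      field_simp
      congr 1; ring)
  have e : ((y + 1) ^ (1 - s) - y ^ (1 - s)) / (1 - s) = c ^ (-s) := by
    rw [h]; simp [sub_div]
  rw [e]
  have := hc.1
  exact ⟨Real.rpow_le_rpow_of_nonpos (by linarith) hc.2.le (by linarith),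
    Real.rpow_le_rpow_of_nonpos hy hc.1.le (by linarith)⟩

theorem hzeta_asymp {x : ℝ} (hx : 0 < x) (hx1 : x ≤ 1) {s : ℝ} (hs : 0 < s) (hs1 : s ≠ 1) :
    ∃ Z : ℝ, hzeta x s = Z ∧ ∀ M : ℕ,
      |∑ n ∈ range M, ((n : ℝ) + x) ^ (-s) - Z - ((M : ℝ) + x) ^ (1 - s) / (1 - s)| ≤
        ((M : ℝ) + x) ^ (-s) := by
  set c : ℕ → ℝ := fun n => (n + x) ^ (-s) + ((n + 1 + x) ^ (1 - s) - (n + x) ^ (1 - s)) / (s - 1)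
    with hc
  have hs1' : s - 1 ≠ 0 := sub_ne_zero.mpr hs1
  have hcs : Summable c := by
    have := summable_emTerm hx (s := s) (by simpa using hs) (by exact_mod_cast hs1)
    simp only [emTerm_ofReal hx] at this
    exact Complex.summable_ofReal.mp this
  have hbound : ∀ n, 0 ≤ c n ∧ c n ≤ ((n : ℝ) + x) ^ (-s) - (((n + 1 : ℕ) : ℝ) + x) ^ (-s) := by
    intro n
    obtain ⟨h1, h2⟩ := rpow_neg_bounds (y := n + x) (by positivity) hs hs1
    have e : c n = (n + x) ^ (-s) - ((n + x + 1) ^ (1 - s) - (n + x) ^ (1 - s)) / (1 - s) := by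
      simp only [hc]
      rw [show (n : ℝ) + 1 + x = n + x + 1 by ring, ← neg_sub 1 s, div_neg]
      ring
    have e2 : (((n + 1 : ℕ) : ℝ) + x) = n + x + 1 := by push_cast; ring
    rw [e, e2]
    constructor <;> linarith
  refine ⟨x ^ (1 - s) / (s - 1) + ∑' n, c n, ?_, fun M => ?_⟩
  · rw [hzeta_eq_of_pos hx hx1 hs hs1]
    simp only [emTerm_ofReal hx]
    rw [ofReal_add, ofReal_tsum]
    push_cast [ofReal_cpow hx.le]
    simp [hc]
  have hsum : ∑ n ∈ range M, c n = ∑ n ∈ range M, ((n : ℝ) + x) ^ (-s) +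
      (((M : ℝ) + x) ^ (1 - s) - x ^ (1 - s)) / (s - 1) := by
    simp only [hc, sum_add_distrib, ← sum_div]
    congr 2
    have := sum_range_sub (fun n : ℕ => ((n : ℝ) + x) ^ (1 - s)) M
    simpa using this
  have htail : ∑' n, c n - ∑ n ∈ range M, c n = ∑' n, c (n + M) := by
    rw [← hcs.sum_add_tsum_nat_add M]; ring
  have e : ∑ n ∈ range M, ((n : ℝ) + x) ^ (-s) - (x ^ (1 - s) / (s - 1) + ∑' n, c n) -
      ((M : ℝ) + x) ^ (1 - s) / (1 - s) = - ∑' n, c (n + M) := by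
    rw [← htail, hsum, ← neg_sub s 1, div_neg, sub_div]
    ring
  rw [e, abs_neg, abs_of_nonneg (tsum_nonneg fun n => (hbound _).1)]
  refine Real.tsum_le_of_sum_range_le (fun n => (hbound _).1) fun K => ?_
  calc ∑ n ∈ range K, c (n + M)
      ≤ ∑ n ∈ range K, ((((n + M : ℕ) : ℝ) + x) ^ (-s) - (((n + 1 + M : ℕ) : ℝ) + x) ^ (-s)) := by
        refine sum_le_sum fun n _ => ?_
        have := (hbound (n + M)).2
        rwa [show n + M + 1 = n + 1 + M by ring] at this
    _ = ((M : ℝ) + x) ^ (-s) - (((K + M : ℕ) : ℝ) + x) ^ (-s) := by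
        have := sum_range_sub' (fun n : ℕ => (((n + M : ℕ) : ℝ) + x) ^ (-s)) K
        simpa using this
    _ ≤ _ := by
        have : 0 ≤ (((K + M : ℕ) : ℝ) + x) ^ (-s) := by positivity
        linarith

theorem exists_log_sq_add_sq_sub {t : ℝ} (ht : 0 < t) (j : ℕ) {x y : ℝ}
    (hx : x ∈ Set.Icc (1 / 2 : ℝ) 2) (hy : y ∈ Set.Icc (1 / 2 : ℝ) 2) :
    ∃ ξ ∈ Set.Icc (1 / 2 : ℝ) 2, Real.log ((x + j) ^ 2 + t ^ 2) - Real.log ((y + j) ^ 2 + t ^ 2) =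
      (x - y) * (2 * (ξ + j) / ((ξ + j) ^ 2 + t ^ 2)) := by
  have hd : ∀ v : ℝ, HasDerivAt (fun v : ℝ => Real.log ((v + j) ^ 2 + t ^ 2))
      (2 * (v + j) / ((v + j) ^ 2 + t ^ 2)) v := by
    intro v
    have h1 : HasDerivAt (fun v : ℝ => (v + j) ^ 2 + t ^ 2) (2 * (v + j)) v := by
      have := (((hasDerivAt_id v).add_const (j : ℝ)).pow 2).add_const (t ^ 2)
      simpa using this
    exact h1.log (by positivity)
  rcases lt_trichotomy x y with h | h | h
  · obtain ⟨ξ, hξ, e⟩ := exists_hasDerivAt_eq_slope _ _ h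
      (fun v _ => (hd v).continuousAt.continuousWithinAt) (fun v _ => hd v)
    refine ⟨ξ, ⟨by linarith [hξ.1, hx.1], by linarith [hξ.2, hy.2]⟩, ?_⟩
    rw [e]
    have : y - x ≠ 0 := by linarith
    field_simp
    ring
  · exact ⟨x, hx, by rw [h]; ring⟩
  · obtain ⟨ξ, hξ, e⟩ := exists_hasDerivAt_eq_slope _ _ h
      (fun v _ => (hd v).continuousAt.continuousWithinAt) (fun v _ => hd v)
    refine ⟨ξ, ⟨by linarith [hξ.1, hy.1], by linarith [hξ.2, hx.2]⟩, ?_⟩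
    rw [e]
    have : x - y ≠ 0 := by linarith
    field_simp

theorem abs_div_sq_add_sq_sub_le {t u v : ℝ} (ht : 0 < t) (hu : 0 < u) (hv : 0 < v) :
    |u / (u ^ 2 + t ^ 2) - v / (v ^ 2 + t ^ 2)| ≤ |u - v| / (t ^ 2 + u * v) := by
  have e : u / (u ^ 2 + t ^ 2) - v / (v ^ 2 + t ^ 2) =
      (u - v) * ((t ^ 2 - u * v) / ((u ^ 2 + t ^ 2) * (v ^ 2 + t ^ 2))) := by
    field_simp; ring
  rw [e, abs_mul, div_eq_mul_inv |u - v|]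
  refine mul_le_mul_of_nonneg_left ?_ (abs_nonneg _)
  rw [abs_div, abs_of_pos (a := (u ^ 2 + t ^ 2) * (v ^ 2 + t ^ 2)) (by positivity),
    div_le_iff₀ (by positivity), inv_mul_eq_div, le_div_iff₀ (by positivity)]
  have h1 : |t ^ 2 - u * v| ≤ t ^ 2 + u * v := by
    have := mul_pos hu hv
    rw [abs_le]; constructor <;> nlinarith [sq_nonneg t]
  calc |t ^ 2 - u * v| * (t ^ 2 + u * v) ≤ (t ^ 2 + u * v) * (t ^ 2 + u * v) := by gcongr
    _ ≤ _ := by nlinarith [sq_nonneg (t * (u - v))]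

theorem abs_log_interpolation_le {t : ℝ} (ht : 1 ≤ t) (j : ℕ) {σ : ℝ}
    (hσ : σ ∈ Set.Icc (1 / 2 : ℝ) 2) :
    |Real.log ((σ + j) ^ 2 + t ^ 2) - (2 - 2 * σ) * Real.log ((1 / 2 + j) ^ 2 + t ^ 2) -
      (2 * σ - 1) * Real.log ((1 + j) ^ 2 + t ^ 2)| ≤ 48 * (1 / (t + j) - 1 / (t + (j + 1 : ℕ))) := by
  have ht0 : 0 < t := by linarith
  obtain ⟨ξ, hξ, e1⟩ := exists_log_sq_add_sq_sub ht0 j hσ (y := 1 / 2) ⟨le_rfl, by norm_num⟩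
  obtain ⟨η, hη, e2⟩ := exists_log_sq_add_sq_sub ht0 j hσ (y := 1) ⟨by norm_num, by norm_num⟩
  have hξj : 0 < ξ + j := by have := hξ.1; positivity
  have hηj : 0 < η + j := by have := hη.1; positivity
  have h := abs_div_sq_add_sq_sub_le ht0 hξj hηj
  have e : Real.log ((σ + j) ^ 2 + t ^ 2) - (2 - 2 * σ) * Real.log ((1 / 2 + j) ^ 2 + t ^ 2) -
      (2 * σ - 1) * Real.log ((1 + j) ^ 2 + t ^ 2) = 4 * ((1 - σ) * (σ - 1 / 2)) *
      ((ξ + j) / ((ξ + j) ^ 2 + t ^ 2) - (η + j) / ((η + j) ^ 2 + t ^ 2)) := by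
    have : Real.log ((σ + j) ^ 2 + t ^ 2) - (2 - 2 * σ) * Real.log ((1 / 2 + j) ^ 2 + t ^ 2) -
      (2 * σ - 1) * Real.log ((1 + j) ^ 2 + t ^ 2) =
      (2 - 2 * σ) * (Real.log ((σ + j) ^ 2 + t ^ 2) - Real.log ((1 / 2 + j) ^ 2 + t ^ 2)) +
      (2 * σ - 1) * (Real.log ((σ + j) ^ 2 + t ^ 2) - Real.log ((1 + j) ^ 2 + t ^ 2)) := by ring
    rw [this, e1, e2]
    ring
  rw [e, abs_mul]
  have hc : |4 * ((1 - σ) * (σ - 1 / 2))| ≤ 6 := by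
    rw [abs_le]; constructor <;> nlinarith [hσ.1, hσ.2]
  have hd : |ξ + j - (η + j)| ≤ 2 := by
    rw [abs_le]; constructor <;> linarith [hξ.1, hξ.2, hη.1, hη.2]
  have hj : (0 : ℝ) ≤ j := Nat.cast_nonneg j
  have hq : (t + j) * (t + (j + 1 : ℕ)) / 4 ≤ t ^ 2 + (ξ + j) * (η + j) := by
    have : (j : ℝ) * j ≤ (ξ + j) * (η + j) := by nlinarith [hξ.1, hη.1]
    push_cast
    nlinarith [sq_nonneg (t - j)]
  have e3 : 1 / (t + j) - 1 / (t + (j + 1 : ℕ)) = 1 / ((t + j) * (t + (j + 1 : ℕ))) := by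
    push_cast; field_simp; ring
  rw [e3]
  calc _ ≤ 6 * (|ξ + j - (η + j)| / (t ^ 2 + (ξ + j) * (η + j))) := by gcongr
    _ ≤ 6 * (2 / ((t + j) * (t + (j + 1 : ℕ)) / 4)) := by gcongr
    _ = _ := by field_simp; norm_num

theorem log_norm_GammaSeq {σ t : ℝ} (hσ : 0 < σ) {n : ℕ} (hn : 0 < n) :
    2 * Real.log ‖GammaSeq (σ + t * I) n‖ = 2 * σ * Real.log n + 2 * Real.log (n.factorial) -
      ∑ j ∈ range (n + 1), Real.log ((σ + j) ^ 2 + t ^ 2) := by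
  have hn' : (0 : ℝ) < n := by exact_mod_cast hn
  have hterm : ∀ j : ℕ, ‖(σ + t * I + j : ℂ)‖ ^ 2 = (σ + j) ^ 2 + t ^ 2 := by
    intro j
    rw [← normSq_eq_norm_sq, normSq_apply]
    simp; ring
  have hpos : ∀ j : ℕ, 0 < (σ + j) ^ 2 + t ^ 2 := fun j => by positivity
  have hne : ∀ j : ℕ, ‖(σ + t * I + j : ℂ)‖ ≠ 0 := by
    intro j h
    have := hterm j
    rw [h] at this
    have := hpos j
    simp_all
  rw [GammaSeq, norm_div, norm_mul, norm_prod, norm_natCast_cpow_of_pos hn, norm_natCast,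
    Real.log_div (by positivity) (prod_ne_zero_iff.mpr fun j _ => hne j),
    Real.log_mul (by positivity) (by positivity), Real.log_rpow hn', Real.log_prod fun j _ => hne j,
    mul_sub, mul_add, mul_sum]
  congr 1
  · simp; ring
  · refine sum_congr rfl fun j _ => ?_
    rw [← hterm, Real.log_pow]; norm_cast

theorem log_norm_Gamma_interpolation {σ t : ℝ} (ht : 1 ≤ t) (hσ : σ ∈ Set.Icc (1 / 2 : ℝ) 2) :
    |2 * Real.log ‖Gamma (σ + t * I)‖ - (2 - 2 * σ) * (2 * Real.log ‖Gamma ((1 / 2 : ℝ) + t * I)‖) -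
      (2 * σ - 1) * (2 * Real.log ‖Gamma ((1 : ℝ) + t * I)‖)| ≤ 48 / t := by
  have hlim : ∀ x : ℝ, 0 < x → Tendsto (fun n => 2 * Real.log ‖GammaSeq (x + t * I) n‖) atTop
      (nhds (2 * Real.log ‖Gamma (x + t * I)‖)) := by
    intro x hx
    have hne : Gamma (x + t * I) ≠ 0 := Gamma_ne_zero_of_re_pos (by simpa using hx)
    exact (((GammaSeq_tendsto_Gamma (x + t * I)).norm).log (norm_ne_zero_iff.mpr hne)).const_mul 2
  have hσ0 : 0 < σ := by linarith [hσ.1]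
  have L := (((hlim σ hσ0).sub ((hlim (1 / 2) (by norm_num)).const_mul (2 - 2 * σ))).sub
    ((hlim 1 one_pos).const_mul (2 * σ - 1))).abs
  refine le_of_tendsto L ?_
  filter_upwards [eventually_gt_atTop 0] with n hn
  rw [log_norm_GammaSeq hσ0 hn, log_norm_GammaSeq (by norm_num) hn, log_norm_GammaSeq one_pos hn]
  have e : 2 * σ * Real.log n + 2 * Real.log n.factorial
      - ∑ j ∈ range (n + 1), Real.log ((σ + j) ^ 2 + t ^ 2) -
      (2 - 2 * σ) * (2 * (1 / 2) * Real.log n + 2 * Real.log n.factorial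
      - ∑ j ∈ range (n + 1), Real.log ((1 / 2 + j) ^ 2 + t ^ 2)) -
      (2 * σ - 1) * (2 * 1 * Real.log n + 2 * Real.log n.factorial
      - ∑ j ∈ range (n + 1), Real.log ((1 + j) ^ 2 + t ^ 2)) =
      - ∑ j ∈ range (n + 1), (Real.log ((σ + j) ^ 2 + t ^ 2) -
        (2 - 2 * σ) * Real.log ((1 / 2 + j) ^ 2 + t ^ 2) -
        (2 * σ - 1) * Real.log ((1 + j) ^ 2 + t ^ 2)) := by
    rw [sum_sub_distrib, sum_sub_distrib, ← mul_sum, ← mul_sum]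
    ring
  rw [e, abs_neg]
  refine (abs_sum_le_sum_abs _ _).trans ((sum_le_sum fun j _ =>
    abs_log_interpolation_le ht j hσ).trans ?_)
  rw [← mul_sum]
  have := sum_range_sub' (fun j : ℕ => 1 / (t + j)) (n + 1)
  rw [this]
  have h2 : 0 ≤ 1 / (t + (n + 1 : ℕ)) := by positivity
  have h3 : 48 / t = 48 * (1 / (t + (0 : ℕ))) := by simp; rfl
  rw [h3]
  linarith

theorem norm_sq_Gamma_half (t : ℝ) :
    ‖Gamma ((1 / 2 : ℝ) + t * I)‖ ^ 2 = Real.pi / Real.cosh (Real.pi * t) := by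
  have h := Gamma_mul_Gamma_one_sub ((1 / 2 : ℝ) + t * I)
  have e1 : (1 : ℂ) - ((1 / 2 : ℝ) + t * I) = (starRingEnd ℂ) ((1 / 2 : ℝ) + t * I) := by
    simp only [map_add, map_mul, conj_ofReal, conj_I]; push_cast; ring
  have e2 : sin (Real.pi * ((1 / 2 : ℝ) + t * I)) = (Real.cosh (Real.pi * t) : ℂ) := by
    have : (Real.pi : ℂ) * ((1 / 2 : ℝ) + t * I) = Real.pi * t * I + Real.pi / 2 := by
      push_cast; ring
    rw [this, sin_add_pi_div_two, cos_mul_I]; push_cast; rfl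
  rw [e1, Gamma_conj, mul_conj, normSq_eq_norm_sq, e2] at h
  exact_mod_cast h

theorem norm_sq_Gamma_one {t : ℝ} (ht : 0 < t) :
    ‖Gamma ((1 : ℝ) + t * I)‖ ^ 2 = Real.pi * t / Real.sinh (Real.pi * t) := by
  have h := Gamma_mul_Gamma_one_sub (t * I)
  have e1 : (1 : ℂ) - t * I = (starRingEnd ℂ) ((1 : ℝ) + t * I) := by
    simp only [map_add, map_mul, conj_ofReal, conj_I]; push_cast; ring
  have hne : (t * I : ℂ) ≠ 0 := by simp [ht.ne']
  have e2 : sin (Real.pi * (t * I)) = (Real.sinh (Real.pi * t) : ℂ) * I := by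
    rw [← mul_assoc, sin_mul_I]; push_cast; rfl
  have e3 : Gamma ((1 : ℝ) + t * I) = t * I * Gamma (t * I) := by
    rw [← Gamma_add_one _ hne]; congr 1; push_cast; ring
  have hsinh : 0 < Real.sinh (Real.pi * t) := Real.sinh_pos_iff.mpr (by positivity)
  have hs' : (Real.sinh (Real.pi * t) : ℂ) ≠ 0 := by exact_mod_cast hsinh.ne'
  have h4 : Gamma ((1 : ℝ) + t * I) * (starRingEnd ℂ) (Gamma ((1 : ℝ) + t * I)) =
      (Real.pi * t / Real.sinh (Real.pi * t) : ℝ) := by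
    rw [← Gamma_conj, ← e1]
    rw [e3, mul_assoc, h, e2]
    push_cast
    rw [← ofReal_mul, ← ofReal_sinh, ofReal_mul]
    field_simp
  rw [mul_conj, normSq_eq_norm_sq] at h4
  exact_mod_cast h4

theorem exp_neg_le_inv {x : ℝ} (hx : 0 < x) : Real.exp (-x) ≤ 1 / x := by
  rw [Real.exp_neg, one_div]
  exact inv_anti₀ hx (by linarith [Real.add_one_le_exp x])

theorem log_norm_sq_Gamma {σ t : ℝ} (ht : 1 ≤ t) (hσ : σ ∈ Set.Icc (1 / 2 : ℝ) 2) :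
    |Real.log (‖Gamma (σ + t * I)‖ ^ 2) -
      (Real.log (2 * Real.pi) + (2 * σ - 1) * Real.log t - Real.pi * t)| ≤ 60 / t := by
  have ht0 : 0 < t := by linarith
  have hpi := Real.pi_pos
  have hpi3 := Real.pi_gt_three
  have h := log_norm_Gamma_interpolation ht hσ
  have hpow : ∀ x : ℝ, 2 * Real.log x = Real.log (x ^ 2) := fun x => by
    rw [Real.log_pow]; norm_cast
  rw [hpow, hpow, hpow, norm_sq_Gamma_half, norm_sq_Gamma_one ht0] at h
  set q := Real.exp (-(2 * Real.pi * t)) with hq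
  have hq0 : 0 < q := Real.exp_pos _
  have hq1 : q ≤ 1 / (6 * t) := by
    refine (exp_neg_le_inv (by positivity)).trans ?_
    gcongr
    linarith
  have hq2 : q ≤ 1 / 6 := hq1.trans (by gcongr; linarith)
  have hE : Real.exp (Real.pi * t) * q = Real.exp (-(Real.pi * t)) := by
    rw [hq, ← Real.exp_add]; congr 1; ring
  have hc : Real.log (Real.pi / Real.cosh (Real.pi * t)) =
      Real.log (2 * Real.pi) - Real.pi * t - Real.log (1 + q) := by
    have : Real.pi / Real.cosh (Real.pi * t) =
        2 * Real.pi / (Real.exp (Real.pi * t) * (1 + q)) := by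
      rw [mul_add, mul_one, hE, Real.cosh_eq]; field_simp
    rw [this, Real.log_div (by positivity) (by positivity), Real.log_mul (by positivity)
      (by positivity), Real.log_mul (by positivity) (by positivity), Real.log_exp]
    ring
  have hs : Real.log (Real.pi * t / Real.sinh (Real.pi * t)) =
      Real.log (2 * Real.pi) + Real.log t - Real.pi * t - Real.log (1 - q) := by
    have h1q : 0 < 1 - q := by linarith
    have : Real.pi * t / Real.sinh (Real.pi * t) =
        2 * Real.pi * t / (Real.exp (Real.pi * t) * (1 - q)) := by
      have : Real.exp (Real.pi * t) * (1 - q) = 2 * Real.sinh (Real.pi * t) := by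
        rw [mul_sub, mul_one, hE, Real.sinh_eq]; ring
      rw [this]; field_simp
    rw [this, Real.log_div (by positivity) (by positivity), Real.log_mul (x := 2 * Real.pi)
      (by positivity) (by positivity), Real.log_mul (Real.exp_pos _).ne' h1q.ne', Real.log_exp]
    ring
  rw [hc, hs] at h
  have l1 : |Real.log (1 + q)| ≤ 2 * q := by
    rw [abs_of_nonneg (Real.log_nonneg (by linarith))]
    linarith [Real.log_le_sub_one_of_pos (show 0 < 1 + q by linarith)]
  have l2 : |Real.log (1 - q)| ≤ 2 * q := by
    rw [abs_of_nonpos (Real.log_nonpos (by linarith) (by linarith))]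
    have := Real.one_sub_inv_le_log_of_pos (show 0 < 1 - q by linarith)
    have h3 : (1 - q)⁻¹ ≤ 1 + 2 * q := by
      rw [inv_le_iff_one_le_mul₀ (by linarith)]; nlinarith
    linarith
  have e : Real.log (‖Gamma (σ + t * I)‖ ^ 2) -
      (Real.log (2 * Real.pi) + (2 * σ - 1) * Real.log t - Real.pi * t) =
      (Real.log (‖Gamma (σ + t * I)‖ ^ 2) -
        (2 - 2 * σ) * (Real.log (2 * Real.pi) - Real.pi * t - Real.log (1 + q)) -
        (2 * σ - 1) * (Real.log (2 * Real.pi) + Real.log t - Real.pi * t - Real.log (1 - q))) -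
      ((2 - 2 * σ) * Real.log (1 + q) + (2 * σ - 1) * Real.log (1 - q)) := by ring
  rw [e]
  have m1 : |(2 - 2 * σ) * Real.log (1 + q)| ≤ 2 * (2 * q) := by
    rw [abs_mul]; gcongr
    rw [abs_le]; constructor <;> linarith [hσ.1, hσ.2]
  have m2 : |(2 * σ - 1) * Real.log (1 - q)| ≤ 3 * (2 * q) := by
    rw [abs_mul]; gcongr
    rw [abs_le]; constructor <;> linarith [hσ.1, hσ.2]
  refine (abs_sub _ _).trans ?_
  have m3 := (abs_add_le ((2 - 2 * σ) * Real.log (1 + q)) ((2 * σ - 1) * Real.log (1 - q)))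
  have e4 : 60 / t = 48 / t + 12 / t := by ring
  have e5 : 10 * q ≤ 12 / t := by
    have : 10 * (1 / (6 * t)) ≤ 12 / t := by
      rw [mul_one_div, div_le_div_iff₀ (by positivity) (by positivity)]; nlinarith
    linarith
  linarith

theorem abs_exp_sub_one_le_mul_exp (x : ℝ) : |Real.exp x - 1| ≤ |x| * Real.exp |x| := by
  have h1 := Real.add_one_le_exp x
  have h2 := Real.add_one_le_exp (-x)
  have h3 : Real.exp x - 1 ≤ x * Real.exp x := by
    rw [Real.exp_neg, ← sub_nonneg] at h2
    have h5 := mul_nonneg h2 (Real.exp_pos x).le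
    rw [sub_mul, inv_mul_cancel₀ (Real.exp_pos x).ne'] at h5
    linarith
  have h4 : x * Real.exp x ≤ |x| * Real.exp |x| := by
    gcongr
    · exact le_abs_self x
    · exact le_abs_self x
  rw [abs_le]
  refine ⟨?_, by linarith⟩
  have h5 : |x| * 1 ≤ |x| * Real.exp |x| := by gcongr; exact Real.one_le_exp (abs_nonneg x)
  linarith [neg_abs_le x]

theorem norm_sq_Gamma_eq {σ t : ℝ} (ht : 1 ≤ t) (hσ : σ ∈ Set.Icc (1 / 2 : ℝ) 2) :
    ∃ E : ℝ, |E| ≤ 60 / t ∧ ‖Gamma (σ + t * I)‖ ^ 2 =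
      2 * Real.pi * t ^ (2 * σ - 1) * Real.exp (-(Real.pi * t)) * Real.exp E := by
  have ht0 : 0 < t := by linarith
  have hne : 0 < ‖Gamma (σ + t * I)‖ := norm_pos_iff.mpr
    (Gamma_ne_zero_of_re_pos (by simp; linarith [hσ.1]))
  refine ⟨_, log_norm_sq_Gamma ht hσ, ?_⟩
  rw [Real.rpow_def_of_pos ht0]
  nth_rw 1 [← Real.exp_log (show 0 < 2 * Real.pi by positivity)]
  rw [← Real.exp_add, ← Real.exp_add, ← Real.exp_add]
  nth_rw 1 [← Real.exp_log (show 0 < ‖Gamma (σ + t * I)‖ ^ 2 by positivity)]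
  congr 1
  ring

theorem exists_norm_Gamma_lower :
    ∃ c : ℝ, 0 < c ∧ ∀ σ t : ℝ, 1 ≤ t → σ ∈ Set.Icc (1 / 2 : ℝ) 2 →
      c * (t ^ (σ - 1 / 2) * Real.exp (-(Real.pi * t / 2))) ≤ ‖Gamma (σ + t * I)‖ := by
  refine ⟨Real.exp (-30), Real.exp_pos _, fun σ t ht hσ => ?_⟩
  have ht0 : 0 < t := by linarith
  obtain ⟨E, hE, e⟩ := norm_sq_Gamma_eq ht hσ
  refine (sq_le_sq₀ (by positivity) (norm_nonneg _)).mp ?_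
  rw [e]
  have h60 : 60 / t ≤ 60 := div_le_self (by norm_num) ht
  have hE' : Real.exp (-60) ≤ Real.exp E := Real.exp_le_exp.mpr (by linarith [neg_abs_le E])
  have e1 : (Real.exp (-30) * (t ^ (σ - 1 / 2) * Real.exp (-(Real.pi * t / 2)))) ^ 2 =
      1 * t ^ (2 * σ - 1) * Real.exp (-(Real.pi * t)) * Real.exp (-60) := by
    rw [mul_pow, mul_pow, ← Real.exp_nat_mul, ← Real.exp_nat_mul, ← Real.rpow_mul_natCast ht0.le]
    push_cast
    ring_nf
  rw [e1]
  gcongr ?_ * _ * _ * ?_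
  linarith [Real.pi_gt_three]

theorem abs_inv_norm_sq_Gamma_sub_le {σ t : ℝ} (ht : 1 ≤ t) (hσ : σ ∈ Set.Icc (1 / 2 : ℝ) 2) :
    |t ^ (2 * σ - 1) * Real.exp (-(Real.pi * t)) / ‖Gamma (σ + t * I)‖ ^ 2 - 1 / (2 * Real.pi)| ≤
      60 * Real.exp 60 / t := by
  have ht0 : 0 < t := by linarith
  obtain ⟨E, hE, e⟩ := norm_sq_Gamma_eq ht hσ
  rw [e]
  have hp : 0 < t ^ (2 * σ - 1) := by positivity
  have e2 : t ^ (2 * σ - 1) * Real.exp (-(Real.pi * t)) /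
      (2 * Real.pi * t ^ (2 * σ - 1) * Real.exp (-(Real.pi * t)) * Real.exp E) -
      1 / (2 * Real.pi) = (1 / (2 * Real.pi)) * (Real.exp (-E) - 1) := by
    rw [Real.exp_neg E]
    field_simp
  have h60 : 60 / t ≤ 60 := div_le_self (by norm_num) ht
  have h3 : |Real.exp (-E) - 1| ≤ |E| * Real.exp |E| := by
    simpa using abs_exp_sub_one_le_mul_exp (-E)
  have h4 : 1 / (2 * Real.pi) ≤ 1 := by
    rw [div_le_one (by positivity)]; linarith [Real.pi_gt_three]
  rw [e2, abs_mul, abs_of_pos (a := 1 / (2 * Real.pi)) (by positivity)]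
  calc _ ≤ 1 * (|E| * Real.exp |E|) := by gcongr
    _ ≤ 1 * (60 / t * Real.exp 60) := by gcongr; linarith
    _ = _ := by ring

theorem integrable_exp_mul_sub {σ r : ℝ} (hσ : 0 < σ) (hr : 0 < r) :
    Integrable fun u : ℝ => Real.exp (σ * u - r * Real.exp u) := by
  have h1 : IntegrableOn (fun x : ℝ => x ^ (σ - 1) * Real.exp (-r * x ^ (1 : ℝ))) (Set.Ioi 0) :=
    integrableOn_rpow_mul_exp_neg_mul_rpow (by linarith) one_pos hr
  have h2 := (integrableOn_image_iff_integrableOn_abs_deriv_smul MeasurableSet.univ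
    (fun x _ => (Real.hasDerivAt_exp x).hasDerivWithinAt) Real.exp_injective.injOn
    (fun x : ℝ => x ^ (σ - 1) * Real.exp (-r * x ^ (1 : ℝ)))).mp
    (by rwa [Set.image_univ, Real.range_exp])
  rw [integrableOn_univ] at h2
  refine h2.congr (Eventually.of_forall fun u => ?_)
  simp only [Real.rpow_one, smul_eq_mul, abs_of_pos (Real.exp_pos u), ← Real.exp_mul,
    ← Real.exp_add]
  congr 1; ring

theorem integral_cexp_mul_cexp_neg {s : ℂ} {r : ℝ} (hs : 0 < s.re) (hr : 0 < r) :
    ∫ u : ℝ, cexp (s * u) * cexp (-(r * Real.exp u)) = (r : ℂ) ^ (-s) * Gamma s := by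
  have h1 := integral_cpow_mul_exp_neg_mul_Ioi hs hr
  have h2 := (integral_image_eq_integral_abs_deriv_smul MeasurableSet.univ
    (fun x _ => (Real.hasDerivAt_exp x).hasDerivWithinAt) Real.exp_injective.injOn
    (fun x : ℝ => (x : ℂ) ^ (s - 1) * cexp (-(r * x))))
  rw [Set.image_univ, Real.range_exp, h1, setIntegral_univ] at h2
  have h3 : (1 / (r : ℂ)) ^ s = (r : ℂ) ^ (-s) := by
    rw [one_div, inv_cpow _ _ (by rw [arg_ofReal_of_nonneg hr.le]; exact Real.pi_pos.ne),
      cpow_neg]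
  rw [← h3, h2]
  refine integral_congr_ae (Eventually.of_forall fun u => ?_)
  simp only [abs_of_pos (Real.exp_pos u), real_smul]
  rw [← mul_assoc]
  congr 1
  rw [cpow_def_of_ne_zero (by exact_mod_cast (Real.exp_pos u).ne'), ← ofReal_log (Real.exp_pos u).le,
    Real.log_exp, ofReal_exp, ← Complex.exp_add]
  congr 1; ring

theorem tendsto_exp_mul_sub_atTop (σ : ℝ) {r : ℝ} (hr : 0 < r) :
    Tendsto (fun u : ℝ => Real.exp (σ * u - r * Real.exp u)) atTop (nhds 0) := by
  refine ((tendsto_rpow_mul_exp_neg_mul_atTop_nhds_zero σ r hr).comp Real.tendsto_exp_atTop).congr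
    fun u => ?_
  simp only [Function.comp, ← Real.exp_mul, ← Real.exp_add]
  congr 1; ring

theorem tendsto_exp_mul_sub_atBot {σ r : ℝ} (hσ : 0 < σ) (hr : 0 ≤ r) :
    Tendsto (fun u : ℝ => Real.exp (σ * u - r * Real.exp u)) atBot (nhds 0) := by
  refine squeeze_zero (fun u => (Real.exp_pos _).le) (g := fun u => Real.exp (σ * u)) (fun u => ?_)
    (Real.tendsto_exp_atBot.comp (tendsto_id.const_mul_atBot hσ))
  have := mul_nonneg hr (Real.exp_pos u).le
  exact Real.exp_le_exp.mpr (by linarith)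

theorem integral_line_eq_of_strip {f : ℂ → ℂ} {y₁ y₂ : ℝ} {g : ℝ → ℝ}
    (hf : DifferentiableOn ℂ f {w | w.im ∈ Set.uIcc y₁ y₂})
    (hb : ∀ u : ℝ, ∀ y ∈ Set.uIcc y₁ y₂, ‖f (u + y * I)‖ ≤ g u) (hg : Integrable g)
    (ht : Tendsto g atTop (nhds 0)) (hbt : Tendsto g atBot (nhds 0)) :
    ∫ u : ℝ, f (u + y₁ * I) = ∫ u : ℝ, f (u + y₂ * I) := by
  have hint : ∀ y ∈ Set.uIcc y₁ y₂, Integrable fun u : ℝ => f (u + y * I) := by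
    intro y hy
    refine hg.mono' ?_ (Eventually.of_forall fun u => hb u y hy)
    refine Continuous.aestronglyMeasurable ?_
    have : ContinuousOn f {w | w.im ∈ Set.uIcc y₁ y₂} := hf.continuousOn
    exact this.comp_continuous (by fun_prop) fun u => by simpa using hy
  have hlim : ∀ y ∈ Set.uIcc y₁ y₂, Tendsto (fun R : ℝ => ∫ u in (-R)..R, f (u + y * I)) atTop
      (nhds (∫ u : ℝ, f (u + y * I))) := fun y hy =>
    intervalIntegral_tendsto_integral (hint y hy) tendsto_neg_atTop_atBot tendsto_id
  have hL := ((hlim y₁ Set.left_mem_uIcc).sub (hlim y₂ Set.right_mem_uIcc))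
  have hv : ∀ R : ℝ, ‖∫ y in y₁..y₂, f (R + y * I)‖ ≤ g R * |y₂ - y₁| := fun R =>
    intervalIntegral.norm_integral_le_of_norm_le_const fun y hy => hb R y (Set.uIoc_subset_uIcc hy)
  have h0 : Tendsto (fun R : ℝ => (∫ u in (-R)..R, f (u + y₁ * I)) -
      ∫ u in (-R)..R, f (u + y₂ * I)) atTop (nhds 0) := by
    have hb0 : Tendsto (fun R : ℝ => g R * |y₂ - y₁| + g (-R) * |y₂ - y₁|) atTop (nhds 0) := by
      simpa using (ht.mul_const |y₂ - y₁|).add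
        ((hbt.comp tendsto_neg_atTop_atBot).mul_const |y₂ - y₁|)
    refine squeeze_zero_norm (fun R => ?_) hb0
    have h := integral_boundary_rect_eq_zero_of_differentiableOn f
      ((-R : ℝ) + y₁ * I) ((R : ℝ) + y₂ * I) (hf.mono fun w hw => by simpa using hw.2)
    simp only [add_re, ofReal_re, mul_re, I_re, mul_zero, ofReal_im, I_im, mul_one, sub_self,
      add_zero, add_im, mul_im, zero_add, smul_eq_mul] at h
    have e : (∫ u in (-R)..R, f (u + y₁ * I)) - ∫ u in (-R)..R, f (u + y₂ * I) =
        I * (∫ y in y₁..y₂, f ((-R : ℝ) + y * I)) - I * (∫ y in y₁..y₂, f (R + y * I)) := by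
      linear_combination h
    rw [e]
    refine (norm_sub_le _ _).trans ?_
    rw [norm_mul, norm_mul, norm_I, one_mul, one_mul, add_comm]
    exact add_le_add (hv R) (hv (-R))
  exact sub_eq_zero.mp (tendsto_nhds_unique hL h0)

/-- The root of unity (or point on the unit circle) `e ^ (2 π i λ)`. -/
noncomputable def unitPt (lam : ℝ) : ℂ := cexp (2 * Real.pi * I * lam)

theorem norm_unitPt (lam : ℝ) : ‖unitPt lam‖ = 1 := by
  rw [unitPt, show 2 * (Real.pi : ℂ) * I * lam = ((2 * Real.pi * lam : ℝ) : ℂ) * I by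
    push_cast; ring, norm_exp_ofReal_mul_I]

theorem unitPt_ne_one {lam : ℝ} (h0 : 0 < lam) (h1 : lam < 1) : unitPt lam ≠ 1 := by
  intro h
  obtain ⟨n, hn⟩ := exp_eq_one_iff.mp h
  have h2 : (2 * (Real.pi : ℂ) * I) * (lam - n) = 0 := by linear_combination hn
  rcases mul_eq_zero.mp h2 with h3 | h3
  · simp at h3
  · have h4 : lam = n := by
      have : (lam : ℂ) = n := by linear_combination h3
      exact_mod_cast this
    rw [h4] at h0 h1
    have a1 : 0 < n := by exact_mod_cast h0
    have a2 : n < 1 := by exact_mod_cast h1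
    omega

theorem exp_eq_unitPt_pow (lam : ℝ) (m : ℕ) :
    cexp (2 * Real.pi * I * lam * m) = unitPt lam ^ m := by
  rw [unitPt, ← Complex.exp_nat_mul]; congr 1; ring

/-- The kernel `e ^ (-b x) / (1 - ω e ^ (-x))` at the point `x = i e ^ w`. -/
noncomputable def lker (b lam : ℝ) (w : ℂ) : ℂ :=
  cexp (-(I * b * cexp w)) / (1 - unitPt lam * cexp (-(I * cexp w)))

theorem norm_one_sub_mul_ge_of_norm_le_one {z : ℂ} {r : ℂ} (hz : ‖z‖ = 1) :
    1 - ‖r‖ ≤ ‖1 - z * r‖ := by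
  have := norm_sub_norm_le 1 (z * r)
  rwa [norm_mul, hz, one_mul, norm_one] at this

theorem norm_one_sub_mul_exp_ge_of_small {z x : ℂ} (hz : ‖z‖ = 1) (hx : ‖x‖ ≤ ‖1 - z‖ / 4) :
    ‖1 - z‖ / 2 ≤ ‖1 - z * cexp (-x)‖ := by
  have h2 : ‖1 - z‖ ≤ 2 := (norm_sub_le _ _).trans (by rw [hz, norm_one]; norm_num)
  have h3 := norm_exp_sub_one_le (x := -x) (by rw [norm_neg]; linarith)
  rw [norm_neg] at h3
  have h4 : 1 - z = (1 - z * cexp (-x)) + z * (cexp (-x) - 1) := by ring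
  have h5 := norm_add_le (1 - z * cexp (-x)) (z * (cexp (-x) - 1))
  rw [← h4, norm_mul, hz, one_mul] at h5
  linarith

theorem re_I_mul_cexp (u y : ℝ) : (I * cexp (u + y * I)).re = -(Real.exp u * Real.sin y) := by
  rw [I_mul_re, exp_im]; simp

theorem norm_I_mul_cexp (u y : ℝ) : ‖I * cexp (u + y * I)‖ = Real.exp u := by
  rw [norm_mul, norm_I, one_mul, norm_exp]; simp

theorem norm_one_sub_kernel_ge {lam : ℝ} {δ : ℝ} (hδ : 0 < δ) {u y : ℝ}
    (hy1 : -(Real.pi / 2) ≤ y) (hy2 : y ≤ -δ) :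
    min (‖1 - unitPt lam‖ / 2) (1 - Real.exp (-(‖1 - unitPt lam‖ / 4 * Real.sin δ))) ≤
      ‖1 - unitPt lam * cexp (-(I * cexp (u + y * I)))‖ := by
  have hsin : 0 ≤ Real.sin δ := Real.sin_nonneg_of_nonneg_of_le_pi hδ.le (by linarith [Real.pi_pos])
  have hsy : Real.sin δ ≤ -Real.sin y := by
    rw [← Real.sin_neg]
    exact Real.sin_le_sin_of_le_of_le_pi_div_two (by linarith [Real.pi_pos]) (by linarith)
      (by linarith)
  rcases le_total (Real.exp u) (‖1 - unitPt lam‖ / 4) with h | h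
  · exact (min_le_left _ _).trans (norm_one_sub_mul_exp_ge_of_small (norm_unitPt lam)
      (by rwa [norm_I_mul_cexp]))
  · refine (min_le_right _ _).trans ?_
    have hr : ‖cexp (-(I * cexp (u + y * I)))‖ ≤ Real.exp (-(‖1 - unitPt lam‖ / 4 * Real.sin δ)) := by
      rw [norm_exp, neg_re, re_I_mul_cexp, neg_neg]
      apply Real.exp_le_exp.mpr
      have : ‖1 - unitPt lam‖ / 4 * Real.sin δ ≤ Real.exp u * -Real.sin y := by gcongr
      linarith
    linarith [norm_one_sub_mul_ge_of_norm_le_one (r := cexp (-(I * cexp (u + y * I)))) (norm_unitPt lam)]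

theorem kernel_bound_pos {lam : ℝ} (h0 : 0 < lam) (h1 : lam < 1) {δ : ℝ} (hδ : 0 < δ)
    (hδ2 : δ ≤ Real.pi / 2) :
    0 < min (‖1 - unitPt lam‖ / 2) (1 - Real.exp (-(‖1 - unitPt lam‖ / 4 * Real.sin δ))) := by
  have hn : 0 < ‖1 - unitPt lam‖ := norm_pos_iff.mpr (sub_ne_zero.mpr (unitPt_ne_one h0 h1).symm)
  have hs : 0 < Real.sin δ := Real.sin_pos_of_pos_of_lt_pi hδ (by linarith [Real.pi_pos])
  refine lt_min (by positivity) ?_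
  rw [sub_pos, Real.exp_lt_one_iff, neg_lt_zero]
  positivity

theorem norm_cexp_mul_line (s : ℂ) (u y : ℝ) :
    ‖cexp (s * (u + y * I))‖ = Real.exp (s.re * u - s.im * y) := by
  rw [norm_exp]; simp

theorem norm_cexp_neg_kernel (b u y : ℝ) :
    ‖cexp (-(I * b * cexp (u + y * I)))‖ = Real.exp (b * Real.exp u * Real.sin y) := by
  rw [norm_exp, show I * (b : ℂ) * cexp (u + y * I) = b * (I * cexp (u + y * I)) by ring, neg_re,
    re_ofReal_mul, re_I_mul_cexp]
  congr 1; ring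

theorem norm_lker_strip_le {b lam : ℝ} (hb : 0 < b) (h0 : 0 < lam) (h1 : lam < 1) {δ : ℝ}
    (hδ : 0 < δ) (hδ2 : δ ≤ Real.pi / 2) (s : ℂ) :
    ∃ C : ℝ, 0 < C ∧ ∀ u y : ℝ, -(Real.pi / 2) ≤ y → y ≤ -δ →
      ‖cexp (s * (u + y * I)) * lker b lam (u + y * I)‖ ≤
        C * Real.exp (s.re * u - b * Real.sin δ * Real.exp u) := by
  set c := min (‖1 - unitPt lam‖ / 2) (1 - Real.exp (-(‖1 - unitPt lam‖ / 4 * Real.sin δ))) with hc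
  have hcp : 0 < c := kernel_bound_pos h0 h1 hδ hδ2
  refine ⟨Real.exp (|s.im| * (Real.pi / 2)) / c, by positivity, fun u y hy1 hy2 => ?_⟩
  have hge := norm_one_sub_kernel_ge (lam := lam) hδ (u := u) hy1 hy2
  rw [lker, norm_mul, norm_div, norm_cexp_mul_line, norm_cexp_neg_kernel]
  have hsy : Real.sin δ ≤ -Real.sin y := by
    rw [← Real.sin_neg]
    exact Real.sin_le_sin_of_le_of_le_pi_div_two (by linarith [Real.pi_pos]) (by linarith)
      (by linarith)
  have e1 : Real.exp (s.re * u - s.im * y) ≤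
      Real.exp (|s.im| * (Real.pi / 2)) * Real.exp (s.re * u) := by
    rw [← Real.exp_add]
    apply Real.exp_le_exp.mpr
    have : -(s.im * y) ≤ |s.im| * (Real.pi / 2) := by
      refine (neg_le_abs _).trans ?_
      rw [abs_mul]
      gcongr
      rw [abs_le]; constructor <;> linarith [Real.pi_pos]
    linarith
  have e2 : Real.exp (b * Real.exp u * Real.sin y) ≤ Real.exp (-(b * Real.sin δ * Real.exp u)) := by
    apply Real.exp_le_exp.mpr
    have := mul_le_mul_of_nonneg_left hsy (mul_pos hb (Real.exp_pos u)).le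
    linarith
  calc _ ≤ (Real.exp (|s.im| * (Real.pi / 2)) * Real.exp (s.re * u)) *
        (Real.exp (-(b * Real.sin δ * Real.exp u)) / c) := by gcongr
    _ = _ := by rw [sub_eq_add_neg, Real.exp_add]; ring

theorem differentiableAt_lker {b lam : ℝ} {w : ℂ}
    (h : 1 - unitPt lam * cexp (-(I * cexp w)) ≠ 0) : DifferentiableAt ℂ (lker b lam) w := by
  unfold lker
  exact DifferentiableAt.div (by fun_prop) (by fun_prop) h

theorem integral_lker_line_eq {b lam : ℝ} (hb : 0 < b) (h0 : 0 < lam) (h1 : lam < 1) {δ : ℝ}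
    (hδ : 0 < δ) (hδ2 : δ ≤ Real.pi / 2) {s : ℂ} (hs : 0 < s.re) :
    ∫ u : ℝ, cexp (s * (u + (-(Real.pi / 2) : ℝ) * I)) * lker b lam (u + (-(Real.pi / 2) : ℝ) * I) =
    ∫ u : ℝ, cexp (s * (u + (-δ : ℝ) * I)) * lker b lam (u + (-δ : ℝ) * I) := by
  obtain ⟨C, hC, hbound⟩ := norm_lker_strip_le hb h0 h1 hδ hδ2 s
  have hle : -(Real.pi / 2) ≤ -δ := by linarith
  have hr : 0 < b * Real.sin δ :=
    mul_pos hb (Real.sin_pos_of_pos_of_lt_pi hδ (by linarith [Real.pi_pos]))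
  refine integral_line_eq_of_strip (f := fun w => cexp (s * w) * lker b lam w)
    (g := fun u => C * Real.exp (s.re * u - b * Real.sin δ * Real.exp u)) ?_ ?_
    ((integrable_exp_mul_sub hs hr).const_mul C) ?_ ?_
  · intro w hw
    simp only [Set.uIcc_of_le hle, Set.mem_ofPred_eq] at hw
    have hge := norm_one_sub_kernel_ge (lam := lam) hδ (u := w.re) hw.1 hw.2
    rw [re_add_im] at hge
    have hne : 1 - unitPt lam * cexp (-(I * cexp w)) ≠ 0 :=
      norm_pos_iff.mp ((kernel_bound_pos h0 h1 hδ hδ2).trans_le hge)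
    exact (DifferentiableAt.mul (by fun_prop) (differentiableAt_lker hne)).differentiableWithinAt
  · intro u y hy
    rw [Set.uIcc_of_le hle] at hy
    exact hbound u y hy.1 hy.2
  · simpa using (tendsto_exp_mul_sub_atTop s.re hr).const_mul C
  · simpa using (tendsto_exp_mul_sub_atBot hs hr.le).const_mul C

/-- The line integral `∫ e ^ (s w) K(w) dw` over `Im w = -δ`. -/
noncomputable def lineInt (b lam δ : ℝ) (s : ℂ) : ℂ :=
  ∫ u : ℝ, cexp (s * (u + (-δ : ℝ) * I)) * lker b lam (u + (-δ : ℝ) * I)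

theorem norm_one_sub_mul_real_ge {z : ℂ} (hz : ‖z‖ = 1) {r : ℝ} (h : 0 ≤ r) (hr1 : r ≤ 1) :
    ‖1 - z‖ / 2 ≤ ‖1 - z * r‖ := by
  have h1 := norm_one_sub_mul_ge_of_norm_le_one (z := z) (r := r) hz
  have h4 : 1 - z = (1 - z * r) - z * (1 - r : ℝ) := by push_cast; ring
  have h5 := norm_sub_le (1 - z * r) (z * (1 - r : ℝ))
  rw [← h4, norm_mul, hz, one_mul, norm_real, Real.norm_eq_abs, abs_of_nonneg (by linarith)] at h5
  rw [norm_real, Real.norm_eq_abs, abs_of_nonneg h] at h1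
  linarith

theorem cexp_mul_lker_real_line (b lam : ℝ) (s : ℂ) (u : ℝ) :
    cexp (s * (u + (-(Real.pi / 2) : ℝ) * I)) * lker b lam (u + (-(Real.pi / 2) : ℝ) * I) =
      cexp (-(I * Real.pi * s / 2)) * (cexp (s * u) * (cexp (-(b * Real.exp u)) /
        (1 - unitPt lam * (Real.exp (-Real.exp u) : ℝ)))) := by
  have e : cexp (u + (-(Real.pi / 2) : ℝ) * I) = -I * Real.exp u := by
    rw [Complex.exp_add, ofReal_exp]
    have : cexp ((-(Real.pi / 2) : ℝ) * I) = -I := by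
      rw [exp_mul_I, ← ofReal_cos, ← ofReal_sin, Real.cos_neg, Real.sin_neg]; simp
    rw [this]; ring
  rw [lker, e]
  have e1 : -(I * b * (-I * (Real.exp u : ℂ))) = -(b * Real.exp u) := by
    linear_combination (b * (Real.exp u : ℂ)) * I_mul_I
  have e2 : -(I * (-I * (Real.exp u : ℂ))) = ((-Real.exp u : ℝ) : ℂ) := by
    rw [ofReal_neg]; linear_combination (Real.exp u : ℂ) * I_mul_I
  rw [e1, e2, ← ofReal_exp, ← mul_assoc, ← Complex.exp_add]
  congr 2
  push_cast; ring

theorem norm_Gamma_mul_sum_sub_le {b lam : ℝ} (hb : 0 < b) (h0 : 0 < lam) (h1 : lam < 1)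
    {s : ℂ} (hs : 0 < s.re) (M : ℕ) :
    ‖cexp (I * Real.pi * s / 2) * lineInt b lam (Real.pi / 2) s - Gamma s *
      ∑ k ∈ range M, unitPt lam ^ k * ((k : ℂ) + b) ^ (-s)‖ ≤
      2 / ‖1 - unitPt lam‖ * (Real.Gamma s.re * (b + M) ^ (-s.re)) := by
  have hn : 0 < ‖1 - unitPt lam‖ := norm_pos_iff.mpr (sub_ne_zero.mpr (unitPt_ne_one h0 h1).symm)
  set ω := unitPt lam with hω
  set D : ℝ → ℂ := fun u => 1 - ω * (Real.exp (-Real.exp u) : ℝ) with hD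
  have hDge : ∀ u, ‖1 - ω‖ / 2 ≤ ‖D u‖ := fun u =>
    norm_one_sub_mul_real_ge (norm_unitPt lam) (Real.exp_pos _).le
      (Real.exp_le_one_iff.mpr (by linarith [Real.exp_pos u]))
  have hDne : ∀ u, D u ≠ 0 := fun u => norm_pos_iff.mp (lt_of_lt_of_le (by positivity) (hDge u))
  have hDc : Continuous D := by fun_prop
  have hJ : cexp (I * Real.pi * s / 2) * lineInt b lam (Real.pi / 2) s =
      ∫ u : ℝ, cexp (s * u) * (cexp (-(b * Real.exp u)) / D u) := by
    rw [lineInt, ← integral_const_mul]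
    refine integral_congr_ae (Eventually.of_forall fun u => ?_)
    simp only
    rw [cexp_mul_lker_real_line, ← mul_assoc, ← Complex.exp_add, add_neg_cancel, Complex.exp_zero,
      one_mul]
  have hintb : ∀ r : ℝ, 0 < r → Integrable fun u : ℝ => cexp (s * u) * cexp (-(r * Real.exp u)) := by
    intro r hr
    refine (integrable_exp_mul_sub hs hr).mono' (by fun_prop) (Eventually.of_forall fun u => ?_)
    rw [norm_mul, norm_exp, norm_exp, ← Real.exp_add]
    apply le_of_eq
    congr 1
    rw [neg_re, ← ofReal_mul, ofReal_re]
    simp; ring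
  have hintD : ∀ r : ℝ, 0 < r →
      Integrable fun u : ℝ => cexp (s * u) * (cexp (-(r * Real.exp u)) / D u) := by
    intro r hr
    have : (fun u : ℝ => cexp (s * u) * (cexp (-(r * Real.exp u)) / D u)) =
        fun u => (D u)⁻¹ * (cexp (s * u) * cexp (-(r * Real.exp u))) := by
      ext u; field_simp
    rw [this]
    refine (hintb r hr).bdd_mul (c := 2 / ‖1 - ω‖) ?_ (Eventually.of_forall fun u => ?_)
    · exact (hDc.inv₀ hDne).aestronglyMeasurable
    · rw [norm_inv, show 2 / ‖1 - ω‖ = (‖1 - ω‖ / 2)⁻¹ by rw [inv_div]]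
      exact inv_anti₀ (by positivity) (hDge u)
  have hbk : ∀ k : ℕ, 0 < (k : ℝ) + b := fun k => by positivity
  have hS : Gamma s * ∑ k ∈ range M, ω ^ k * ((k : ℂ) + b) ^ (-s) =
      ∫ u : ℝ, ∑ k ∈ range M, ω ^ k * (cexp (s * u) * cexp (-((k + b : ℝ) * Real.exp u))) := by
    rw [integral_finsetSum _ fun k _ => (hintb _ (hbk k)).const_mul _, mul_sum]
    refine sum_congr rfl fun k _ => ?_
    rw [integral_const_mul, integral_cexp_mul_cexp_neg hs (hbk k)]
    push_cast; ring
  have hgeom : ∀ u : ℝ, cexp (s * u) * (cexp (-(b * Real.exp u)) / D u) -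
      ∑ k ∈ range M, ω ^ k * (cexp (s * u) * cexp (-((k + b : ℝ) * Real.exp u))) =
      ω ^ M * (cexp (s * u) * (cexp (-((b + M : ℝ) * Real.exp u)) / D u)) := by
    intro u
    set X : ℂ := ω * (Real.exp (-Real.exp u) : ℝ) with hX
    have hXk : ∀ k : ℕ, ω ^ k * (cexp (s * u) * cexp (-((k + b : ℝ) * Real.exp u))) =
        cexp (s * u) * cexp (-(b * Real.exp u)) * X ^ k := by
      intro k
      have hE : ((Real.exp (-Real.exp u) : ℝ) : ℂ) ^ k = cexp (k * ((-Real.exp u : ℝ) : ℂ)) := by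
        rw [ofReal_exp (-Real.exp u), ← Complex.exp_nat_mul]
      rw [hX, mul_pow, hE]
      have : cexp (-((k + b : ℝ) * Real.exp u)) =
          cexp (-(b * Real.exp u)) * cexp (k * ((-Real.exp u : ℝ) : ℂ)) := by
        rw [← Complex.exp_add]; congr 1; push_cast; ring
      rw [this]; ring
    have hXM := hXk M
    rw [show (M : ℝ) + b = b + M by ring] at hXM
    have hne : 1 - X ≠ 0 := hDne u
    have hg := mul_neg_geom_sum X M
    rw [sum_congr rfl fun k _ => hXk k, ← mul_sum]
    have hfin : ω ^ M * (cexp (s * u) * (cexp (-((b + M : ℝ) * Real.exp u)) / D u)) =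
        cexp (s * u) * cexp (-(b * Real.exp u)) * X ^ M / D u := by
      rw [← hXM]; ring
    rw [hfin]
    have hDX : D u = 1 - X := rfl
    rw [hDX]
    field_simp
    linear_combination (-1 : ℂ) * hg
  rw [hJ, hS, ← integral_sub (hintD b hb)
    (integrable_finsetSum _ fun k _ => (hintb _ (hbk k)).const_mul _)]
  simp only [hgeom]
  have hbM : 0 < b + M := by positivity
  have hreal := integral_cexp_mul_cexp_neg (s := (s.re : ℂ)) (by simpa using hs) hbM
  have hreal' : ∫ u : ℝ, Real.exp (s.re * u - (b + M) * Real.exp u) =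
      (b + M) ^ (-s.re) * Real.Gamma s.re := by
    have e : ∀ u : ℝ, cexp ((s.re : ℂ) * u) * cexp (-((b + M : ℝ) * Real.exp u)) =
        ((Real.exp (s.re * u - (b + M) * Real.exp u) : ℝ) : ℂ) := by
      intro u; rw [← Complex.exp_add]; push_cast; congr 1
    simp only [e] at hreal
    rw [integral_complex_ofReal, Gamma_ofReal, ← ofReal_neg, ← ofReal_cpow hbM.le] at hreal
    exact_mod_cast hreal
  rw [mul_comm (Real.Gamma _), ← hreal', ← integral_const_mul]
  refine norm_integral_le_of_norm_le ((integrable_exp_mul_sub hs hbM).const_mul _)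
    (Eventually.of_forall fun u => ?_)
  rw [norm_mul, norm_pow, norm_unitPt, one_pow, one_mul, norm_mul, norm_div, norm_exp, norm_exp]
  rw [neg_re, ← ofReal_mul, ofReal_re, re_mul_ofReal,
    show s.re * u - (b + M) * Real.exp u = s.re * u + -((b + M) * Real.exp u) by ring, Real.exp_add]
  calc _ ≤ Real.exp (s.re * u) * (Real.exp (-((b + M) * Real.exp u)) / (‖1 - ω‖ / 2)) := by
        gcongr; exact hDge u
    _ = _ := by field_simp

theorem tendsto_sum_unitPt {b lam : ℝ} (hb : 0 < b) (h0 : 0 < lam) (h1 : lam < 1)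
    {s : ℂ} (hs : 0 < s.re) :
    Tendsto (fun M : ℕ => ∑ k ∈ range M, unitPt lam ^ k * ((k : ℂ) + b) ^ (-s)) atTop
      (nhds (cexp (I * Real.pi * s / 2) * lineInt b lam (Real.pi / 2) s / Gamma s)) := by
  have hG : Gamma s ≠ 0 := Gamma_ne_zero_of_re_pos hs
  have hGn : 0 < ‖Gamma s‖ := norm_pos_iff.mpr hG
  rw [← tendsto_sub_nhds_zero_iff]
  have hlim : Tendsto (fun M : ℕ => 2 / ‖1 - unitPt lam‖ *
      (Real.Gamma s.re * (b + M) ^ (-s.re)) / ‖Gamma s‖) atTop (nhds 0) := by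
    have h2 : Tendsto (fun M : ℕ => (b + M : ℝ) ^ (-s.re)) atTop (nhds 0) :=
      (tendsto_rpow_neg_atTop hs).comp
        (tendsto_atTop_add_const_left _ _ tendsto_natCast_atTop_atTop)
    simpa using ((h2.const_mul (Real.Gamma s.re)).const_mul (2 / ‖1 - unitPt lam‖)).div_const ‖Gamma s‖
  refine squeeze_zero_norm (fun M => ?_) hlim
  rw [le_div_iff₀ hGn, ← norm_mul]
  refine le_trans (le_of_eq ?_) (norm_Gamma_mul_sum_sub_le hb h0 h1 hs M)
  rw [← norm_neg]
  congr 1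
  field_simp
  ring

theorem sum_zetaL_eq (b lam : ℝ) (s : ℂ) (N : ℕ) :
    ∑ m ∈ range N, cexp (2 * Real.pi * I * lam * m) * ((m : ℂ) + b) ^ (-s) =
      ∑ m ∈ range N, unitPt lam ^ m * ((m : ℂ) + b) ^ (-s) :=
  sum_congr rfl fun m _ => by rw [exp_eq_unitPt_pow]

theorem zetaL_eq_half {b lam : ℝ} (hb : 0 < b) (h0 : 0 < lam) (h1 : lam < 1)
    {s : ℂ} (hs : 0 < s.re) :
    zetaL b lam s = cexp (I * Real.pi * s / 2) * lineInt b lam (Real.pi / 2) s / Gamma s := by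
  rw [zetaL]
  simp only [sum_zetaL_eq]
  exact (tendsto_sum_unitPt hb h0 h1 hs).limUnder_eq

theorem zetaL_eq_lineInt {b lam δ : ℝ} (hb : 0 < b) (h0 : 0 < lam) (h1 : lam < 1) (hδ : 0 < δ)
    (hδ2 : δ ≤ Real.pi / 2) {s : ℂ} (hs : 0 < s.re) :
    zetaL b lam s = cexp (I * Real.pi * s / 2) * lineInt b lam δ s / Gamma s := by
  rw [zetaL_eq_half hb h0 h1 hs, lineInt, integral_lker_line_eq hb h0 h1 hδ hδ2 hs, ← lineInt]

theorem tendsto_zetaL {b lam : ℝ} (hb : 0 < b) (h0 : 0 < lam) (h1 : lam < 1)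
    {s : ℂ} (hs : 0 < s.re) :
    Tendsto (fun M : ℕ => ∑ k ∈ range M, unitPt lam ^ k * ((k : ℂ) + b) ^ (-s)) atTop
      (nhds (zetaL b lam s)) := by
  rw [zetaL_eq_half hb h0 h1 hs]
  exact tendsto_sum_unitPt hb h0 h1 hs

theorem norm_zetaL_sub_sum_le {b lam : ℝ} (hb : 0 < b) (h0 : 0 < lam) (h1 : lam < 1)
    {s : ℂ} (hs : 0 < s.re) (M : ℕ) :
    ‖zetaL b lam s - ∑ k ∈ range M, unitPt lam ^ k * ((k : ℂ) + b) ^ (-s)‖ ≤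
      2 / ‖1 - unitPt lam‖ * (Real.Gamma s.re / ‖Gamma s‖) * (b + M) ^ (-s.re) := by
  have hG : Gamma s ≠ 0 := Gamma_ne_zero_of_re_pos hs
  have hGn : 0 < ‖Gamma s‖ := norm_pos_iff.mpr hG
  have := norm_Gamma_mul_sum_sub_le hb h0 h1 hs M
  rw [zetaL_eq_half hb h0 h1 hs]
  calc _ = ‖cexp (I * Real.pi * s / 2) * lineInt b lam (Real.pi / 2) s - Gamma s *
      ∑ k ∈ range M, unitPt lam ^ k * ((k : ℂ) + b) ^ (-s)‖ / ‖Gamma s‖ := by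
        rw [← norm_div]; congr 1; field_simp
    _ ≤ _ := by
        rw [div_le_iff₀ hGn]
        refine this.trans (le_of_eq ?_)
        field_simp

theorem zetaL_eq_sum_add {b lam : ℝ} (hb : 0 < b) (h0 : 0 < lam) (h1 : lam < 1)
    {s : ℂ} (hs : 0 < s.re) (N : ℕ) :
    zetaL b lam s = ∑ k ∈ range N, unitPt lam ^ k * ((k : ℂ) + b) ^ (-s) +
      unitPt lam ^ N * zetaL (N + b) lam s := by
  have hbN : 0 < N + b := by positivity
  have t1 := (tendsto_zetaL hb h0 h1 hs).comp (tendsto_add_atTop_nat N)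
  have t2 := ((tendsto_zetaL hbN h0 h1 hs).const_mul (unitPt lam ^ N)).const_add
    (∑ k ∈ range N, unitPt lam ^ k * ((k : ℂ) + b) ^ (-s))
  refine tendsto_nhds_unique t1 (t2.congr fun M => ?_)
  rw [Function.comp, add_comm M N, sum_range_add, mul_sum]
  congr 1
  refine sum_congr rfl fun k _ => ?_
  rw [pow_add]; push_cast; ring_nf

theorem differentiableOn_zetaL {b lam : ℝ} (hb : 0 < b) (h0 : 0 < lam) (h1 : lam < 1) :
    DifferentiableOn ℂ (zetaL b lam) {s | 0 < s.re} := by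
  have hopen : IsOpen {s : ℂ | 0 < s.re} := isOpen_lt continuous_const continuous_re
  have hloc : TendstoLocallyUniformlyOn
      (fun (M : ℕ) (s : ℂ) => ∑ k ∈ range M, unitPt lam ^ k * ((k : ℂ) + b) ^ (-s))
      (zetaL b lam) atTop {s | 0 < s.re} := by
    rw [tendstoLocallyUniformlyOn_iff_forall_isCompact hopen]
    intro K hK hKc
    rcases K.eq_empty_or_nonempty with rfl | hne
    · exact tendstoUniformlyOn_empty
    obtain ⟨z, hz, hmin⟩ := hKc.exists_isMinOn hne continuous_re.continuousOn
    have hz0 : 0 < z.re := hK hz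
    have hcont : ContinuousOn (fun s : ℂ => Real.Gamma s.re / ‖Gamma s‖) K := by
      refine ContinuousOn.div ?_ ?_ ?_
      · intro s hs
        have hd : ContinuousAt Real.Gamma s.re := (Real.differentiableAt_Gamma fun m hm => by
          have h := hK hs
          simp only [Set.mem_ofPred_eq, hm] at h; linarith [(Nat.cast_nonneg m : (0 : ℝ) ≤ m)]).continuousAt
        exact (hd.comp (f := re) continuous_re.continuousAt).continuousWithinAt
      · intro s hs
        have h := hK hs
        exact ((differentiableAt_Gamma s fun m hm => by
          simp only [Set.mem_ofPred_eq, hm] at h; simp at h; linarith).continuousAt.norm).continuousWithinAt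
      · intro s hs
        exact (norm_pos_iff.mpr (Gamma_ne_zero_of_re_pos (hK hs))).ne'
    obtain ⟨C, hC⟩ := (hKc.bddAbove_image hcont)
    rw [Metric.tendstoUniformlyOn_iff]
    intro ε hε
    have h2 : Tendsto (fun M : ℕ => 2 / ‖1 - unitPt lam‖ * |C| * (b + M : ℝ) ^ (-z.re)) atTop
        (nhds 0) := by
      simpa using (((tendsto_rpow_neg_atTop hz0).comp
        (tendsto_atTop_add_const_left _ b tendsto_natCast_atTop_atTop)).const_mul
          (2 / ‖1 - unitPt lam‖ * |C|))
    filter_upwards [h2.eventually_lt_const hε, eventually_ge_atTop 1] with M hM hM1 s hs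
    rw [dist_eq_norm]
    refine lt_of_le_of_lt (norm_zetaL_sub_sum_le hb h0 h1 (hK hs) M) (lt_of_le_of_lt ?_ hM)
    have hM1' : (1 : ℝ) ≤ M := by exact_mod_cast hM1
    have hp : (b + M : ℝ) ^ (-s.re) ≤ (b + M) ^ (-z.re) :=
      Real.rpow_le_rpow_of_exponent_le (by linarith) (neg_le_neg (hmin hs))
    have hCs : Real.Gamma s.re / ‖Gamma s‖ ≤ |C| := (hC ⟨s, hs, rfl⟩).trans (le_abs_self C)
    have : 0 ≤ Real.Gamma s.re / ‖Gamma s‖ :=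
      div_nonneg (Real.Gamma_pos_of_pos (hK hs)).le (norm_nonneg _)
    gcongr
  refine hloc.differentiableOn (Eventually.of_forall fun M s _ => ?_) hopen
  refine DifferentiableAt.differentiableWithinAt (DifferentiableAt.fun_sum fun k _ => ?_)
  have hk : (k : ℂ) + b ≠ 0 := by
    have : (0 : ℝ) < k + b := by positivity
    exact_mod_cast this.ne'
  exact (DifferentiableAt.const_cpow (by fun_prop) (Or.inl hk)).const_mul _

/-- The integral of `f` over the boundary of the rectangle `[x₀, x₁] × [-δ, δ]`. -/
noncomputable def rectInt (f : ℂ → ℂ) (x₀ x₁ δ : ℝ) : ℂ :=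
  (∫ x : ℝ in x₀..x₁, f (x + (-δ : ℝ) * I)) - (∫ x : ℝ in x₀..x₁, f (x + (δ : ℝ) * I)) +
    I * (∫ y : ℝ in (-δ)..δ, f (x₁ + y * I)) - I * ∫ y : ℝ in (-δ)..δ, f (x₀ + y * I)

theorem rectInt_eq_zero {f : ℂ → ℂ} {x₀ x₁ δ : ℝ} (hx : x₀ ≤ x₁) (hδ : 0 ≤ δ)
    (hf : ∀ w : ℂ, x₀ ≤ w.re → w.re ≤ x₁ → -δ ≤ w.im → w.im ≤ δ → DifferentiableAt ℂ f w) :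
    rectInt f x₀ x₁ δ = 0 := by
  have := integral_boundary_rect_eq_zero_of_differentiableOn f (x₀ + (-δ : ℝ) * I)
    (x₁ + (δ : ℝ) * I) (by
      intro w hw
      simp only [add_re, ofReal_re, mul_re, I_re, mul_zero, ofReal_im, I_im, mul_one, sub_self,
        add_zero, add_im, mul_im, zero_add] at hw
      rw [Set.uIcc_of_le hx, Set.uIcc_of_le (by linarith), mem_reProdIm] at hw
      exact (hf w hw.1.1 hw.1.2 hw.2.1 hw.2.2).differentiableWithinAt)
  simp only [add_re, ofReal_re, mul_re, I_re, mul_zero, ofReal_im, I_im, mul_one, sub_self,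
        add_zero, add_im, mul_im, zero_add, smul_eq_mul] at this
  exact this

theorem log_sub_log_conj_eq {p q δ : ℝ} (hδ : 0 < δ) :
    (log (q + (-δ : ℝ) * I) - log (p + (-δ : ℝ) * I)) -
      (log (q + (δ : ℝ) * I) - log (p + (δ : ℝ) * I)) +
      (log (q + (δ : ℝ) * I) - log (q + (-δ : ℝ) * I)) -
      (log (-(p + (δ : ℝ) * I)) - log (-(p + (-δ : ℝ) * I))) = 2 * Real.pi * I := by
  have e1 : log (-(p + (δ : ℝ) * I)) = log (p + (δ : ℝ) * I) - Real.pi * I := by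
    rw [log, log, norm_neg, arg_neg_eq_arg_sub_pi_of_im_pos (by simpa using hδ)]
    push_cast; ring
  have e2 : log (-(p + (-δ : ℝ) * I)) = log (p + (-δ : ℝ) * I) + Real.pi * I := by
    rw [log, log, norm_neg, arg_neg_eq_arg_add_pi_of_im_neg (by simpa using hδ)]
    push_cast; ring
  rw [e1, e2]; ring

theorem integral_inv_horizontal {p q y : ℝ} (hy : y ≠ 0) :
    ∫ x : ℝ in p..q, 1 / ((x : ℂ) + y * I) = log (q + y * I) - log (p + y * I) := by
  have hne : ∀ x : ℝ, (x : ℂ) + y * I ∈ slitPlane := fun x => by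
    rw [mem_slitPlane_iff]; right; simpa using hy
  refine intervalIntegral.integral_eq_sub_of_hasDerivAt
    (f := fun x : ℝ => log ((x : ℂ) + y * I)) (fun x _ => ?_) ?_
  · have h1 : HasDerivAt (fun x : ℝ => (x : ℂ) + y * I) 1 x := by
      simpa using ((ofRealCLM.hasDerivAt (x := x)).add_const ((y : ℂ) * I))
    exact h1.clog_real (hne x)
  · refine Continuous.intervalIntegrable ?_ _ _
    exact continuous_const.div (by fun_prop) fun x => slitPlane_ne_zero (hne x)

theorem integral_inv_vertical_pos {x δ : ℝ} (hx : 0 < x) :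
    I * ∫ y : ℝ in (-δ)..δ, 1 / ((x : ℂ) + y * I) =
      log (x + (δ : ℝ) * I) - log (x + (-δ : ℝ) * I) := by
  have hne : ∀ y : ℝ, (x : ℂ) + y * I ∈ slitPlane := fun y => by
    rw [mem_slitPlane_iff]; left; simpa using hx
  rw [← intervalIntegral.integral_const_mul]
  refine intervalIntegral.integral_eq_sub_of_hasDerivAt
    (f := fun y : ℝ => log ((x : ℂ) + y * I)) (fun y _ => ?_) ?_
  · have h1 : HasDerivAt (fun y : ℝ => (x : ℂ) + y * I) I y := by
      simpa using ((ofRealCLM.hasDerivAt (x := y)).mul_const I).const_add (x : ℂ)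
    have h2 := h1.clog_real (hne y)
    rw [div_eq_mul_one_div] at h2
    exact h2
  · refine Continuous.intervalIntegrable ?_ _ _
    exact continuous_const.mul (continuous_const.div (by fun_prop) fun y =>
      slitPlane_ne_zero (hne y))

theorem integral_inv_vertical_neg {x δ : ℝ} (hx : x < 0) :
    I * ∫ y : ℝ in (-δ)..δ, 1 / ((x : ℂ) + y * I) =
      log (-(x + (δ : ℝ) * I)) - log (-(x + (-δ : ℝ) * I)) := by
  have hne : ∀ y : ℝ, -((x : ℂ) + y * I) ∈ slitPlane := fun y => by
    rw [mem_slitPlane_iff]; left; simpa using hx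
  rw [← intervalIntegral.integral_const_mul]
  refine intervalIntegral.integral_eq_sub_of_hasDerivAt
    (f := fun y : ℝ => log (-((x : ℂ) + y * I))) (fun y _ => ?_) ?_
  · have h1 : HasDerivAt (fun y : ℝ => -((x : ℂ) + y * I)) (-I) y := by
      have h0 : HasDerivAt (fun y : ℝ => (x : ℂ) + y * I) I y := by
        simpa using ((ofRealCLM.hasDerivAt (x := y)).mul_const I).const_add (x : ℂ)
      exact h0.neg
    have h2 := h1.clog_real (hne y)
    rw [neg_div_neg_eq, div_eq_mul_one_div] at h2
    exact h2
  · refine Continuous.intervalIntegrable ?_ _ _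
    exact continuous_const.mul (continuous_const.div (by fun_prop) fun y h =>
      slitPlane_ne_zero (hne y) (by rw [h, neg_zero]))

theorem rectInt_one_div_sub {x₀ x₁ δ w₀ : ℝ} (h0 : x₀ < w₀) (h1 : w₀ < x₁) (hδ : 0 < δ) :
    rectInt (fun w => 1 / (w - w₀)) x₀ x₁ δ = 2 * Real.pi * I := by
  have hh : ∀ y : ℝ, y ≠ 0 → ∫ x : ℝ in x₀..x₁, 1 / ((x : ℂ) + y * I - w₀) =
      log ((x₁ - w₀ : ℝ) + y * I) - log ((x₀ - w₀ : ℝ) + y * I) := by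
    intro y hy
    rw [← integral_inv_horizontal hy, ← intervalIntegral.integral_comp_sub_right
      (fun x : ℝ => 1 / ((x : ℂ) + y * I)) w₀]
    refine intervalIntegral.integral_congr fun x _ => ?_
    push_cast; ring_nf
  have hv : ∀ x : ℝ, ∀ y : ℝ, 1 / ((x : ℂ) + y * I - w₀) = 1 / ((x - w₀ : ℝ) + y * I) := by
    intro x y; push_cast; ring_nf
  rw [rectInt, hh _ hδ.ne', hh _ (by simpa using hδ.ne')]
  simp only [hv]
  rw [integral_inv_vertical_pos (by linarith), integral_inv_vertical_neg (by linarith)]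
  exact log_sub_log_conj_eq hδ

theorem rectInt_div_of_simple_zero {N D : ℂ → ℂ} (hN : Differentiable ℂ N)
    (hD : Differentiable ℂ D) {x₀ x₁ δ w₀ : ℝ} (h0 : x₀ < w₀) (h1 : w₀ < x₁) (hδ : 0 < δ)
    (hD0 : D w₀ = 0) (hD' : deriv D w₀ ≠ 0)
    (hne : ∀ w : ℂ, x₀ ≤ w.re → w.re ≤ x₁ → -δ ≤ w.im → w.im ≤ δ → D w = 0 → w = w₀) :
    rectInt (fun w => N w / D w) x₀ x₁ δ = 2 * Real.pi * I * (N w₀ / deriv D w₀) := by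
  set E : ℂ → ℂ := dslope D w₀ with hE
  have hEd : Differentiable ℂ E := by
    rw [← differentiableOn_univ]
    exact (Complex.differentiableOn_dslope univ_mem).mpr hD.differentiableOn
  have hE0 : E w₀ = deriv D w₀ := dslope_same _ _
  have hDE : ∀ w, D w = (w - w₀) * E w := by
    intro w
    have := sub_smul_dslope D (w₀ : ℂ) w
    rw [hD0, sub_zero, smul_eq_mul] at this
    exact this.symm
  have hUo : IsOpen {w : ℂ | E w ≠ 0} := isOpen_ne_fun hEd.continuous continuous_const
  have hw0U : (w₀ : ℂ) ∈ {w : ℂ | E w ≠ 0} := by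
    change E w₀ ≠ 0
    rwa [hE0]
  set g : ℂ → ℂ := fun w => N w / E w with hg
  have hgd : DifferentiableOn ℂ g {w : ℂ | E w ≠ 0} := fun w hw =>
    (DifferentiableAt.div (hN w) (hEd w) hw).differentiableWithinAt
  have hsd : DifferentiableOn ℂ (dslope g w₀) {w : ℂ | E w ≠ 0} :=
    (Complex.differentiableOn_dslope (hUo.mem_nhds hw0U)).mpr hgd
  have hEne : ∀ w : ℂ, x₀ ≤ w.re → w.re ≤ x₁ → -δ ≤ w.im → w.im ≤ δ → E w ≠ 0 := by
    intro w a b c d h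
    have hw : w = w₀ := hne w a b c d (by rw [hDE, h, mul_zero])
    rw [hw] at h
    exact hw0U h
  have hz := rectInt_eq_zero (f := dslope g w₀) (h0.trans h1).le hδ.le fun w a b c d =>
    hsd.differentiableAt (hUo.mem_nhds (hEne w a b c d))
  have hsplit : ∀ w : ℂ, w ≠ w₀ → N w / D w = g w₀ * (1 / (w - w₀)) + dslope g w₀ w := by
    intro w hw
    have hw' : w - w₀ ≠ 0 := sub_ne_zero.mpr hw
    have := sub_smul_dslope g (w₀ : ℂ) w
    rw [smul_eq_mul] at this
    have h2 : dslope g w₀ w = (g w - g w₀) / (w - w₀) := by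
      rw [← this]; field_simp
    rw [h2, hDE, mul_comm, ← div_div]
    change g w / (w - w₀) = _
    ring
  have hne_h : ∀ x y : ℝ, y ≠ 0 → (x : ℂ) + y * I ≠ w₀ := by
    intro x y hy h
    have := congrArg im h
    simp at this; exact hy this
  have hne_v : ∀ x y : ℝ, x ≠ w₀ → (x : ℂ) + y * I ≠ w₀ := by
    intro x y hy h
    have := congrArg re h
    simp at this; exact hy this
  have hcd : ∀ w : ℂ, x₀ ≤ w.re → w.re ≤ x₁ → -δ ≤ w.im → w.im ≤ δ →
      ContinuousAt (dslope g w₀) w := fun w a b c d =>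
    (hsd.differentiableAt (hUo.mem_nhds (hEne w a b c d))).continuousAt
  have hHor : ∀ y : ℝ, y ≠ 0 → -δ ≤ y → y ≤ δ →
      ∫ x : ℝ in x₀..x₁, N (x + y * I) / D (x + y * I) =
      g w₀ * (∫ x : ℝ in x₀..x₁, 1 / ((x : ℂ) + y * I - w₀)) +
        ∫ x : ℝ in x₀..x₁, dslope g w₀ (x + y * I) := by
    intro y hy hy1 hy2
    rw [← intervalIntegral.integral_const_mul, ← intervalIntegral.integral_add]
    · exact intervalIntegral.integral_congr fun x _ => hsplit _ (hne_h x y hy)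
    · refine Continuous.intervalIntegrable ?_ _ _
      exact continuous_const.mul (continuous_const.div (by fun_prop) fun x =>
        sub_ne_zero.mpr (hne_h x y hy))
    · refine ContinuousOn.intervalIntegrable fun x hx => ?_
      rw [Set.uIcc_of_le (h0.trans h1).le] at hx
      have hc := hcd (x + y * I) (by simpa using hx.1) (by simpa using hx.2) (by simpa using hy1)
        (by simpa using hy2)
      exact (ContinuousAt.comp (f := fun x : ℝ => (x : ℂ) + y * I) hc (by fun_prop)).continuousWithinAt
  have hVer : ∀ x : ℝ, x ≠ w₀ → x₀ ≤ x → x ≤ x₁ →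
      ∫ y : ℝ in (-δ)..δ, N (x + y * I) / D (x + y * I) =
      g w₀ * (∫ y : ℝ in (-δ)..δ, 1 / ((x : ℂ) + y * I - w₀)) +
        ∫ y : ℝ in (-δ)..δ, dslope g w₀ (x + y * I) := by
    intro x hx hx1 hx2
    rw [← intervalIntegral.integral_const_mul, ← intervalIntegral.integral_add]
    · exact intervalIntegral.integral_congr fun y _ => hsplit _ (hne_v x y hx)
    · refine Continuous.intervalIntegrable ?_ _ _
      exact continuous_const.mul (continuous_const.div (by fun_prop) fun y =>
        sub_ne_zero.mpr (hne_v x y hx))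
    · refine ContinuousOn.intervalIntegrable fun y hy => ?_
      rw [Set.uIcc_of_le (by linarith)] at hy
      have hc := hcd (x + y * I) (by simpa using hx1) (by simpa using hx2) (by simpa using hy.1)
        (by simpa using hy.2)
      exact (ContinuousAt.comp (f := fun y : ℝ => (x : ℂ) + y * I) hc (by fun_prop)).continuousWithinAt
  have hone := rectInt_one_div_sub h0 h1 hδ
  rw [rectInt] at hz hone ⊢
  rw [hHor _ (by simpa using hδ.ne') le_rfl (by linarith), hHor _ hδ.ne' (by linarith) le_rfl,
    hVer _ h1.ne' (h0.trans h1).le le_rfl, hVer _ h0.ne le_rfl (h0.trans h1).le]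
  have hgw : g w₀ = N w₀ / deriv D w₀ := by rw [← hE0]
  rw [← hgw]
  linear_combination g w₀ * hone + hz

theorem rectInt_add {f : ℂ → ℂ} {x₀ x₁ x₂ δ : ℝ}
    (h1 : ∀ y, y = δ ∨ y = -δ → Continuous fun x : ℝ => f (x + (y : ℝ) * I)) :
    rectInt f x₀ x₁ δ + rectInt f x₁ x₂ δ = rectInt f x₀ x₂ δ := by
  have ha := intervalIntegral.integral_add_adjacent_intervals
    ((h1 δ (Or.inl rfl)).intervalIntegrable (μ := volume) x₀ x₁)
    ((h1 δ (Or.inl rfl)).intervalIntegrable x₁ x₂)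
  have hb := intervalIntegral.integral_add_adjacent_intervals
    ((h1 (-δ) (Or.inr rfl)).intervalIntegrable (μ := volume) x₀ x₁)
    ((h1 (-δ) (Or.inr rfl)).intervalIntegrable x₁ x₂)
  simp only [rectInt]
  rw [← ha, ← hb]
  ring

/-- The denominator of `lker`. -/
noncomputable def lden (lam : ℝ) (w : ℂ) : ℂ := 1 - unitPt lam * cexp (-(I * cexp w))

/-- The numerator of `cexp (s * w) * lker b lam w`. -/
noncomputable def lnum (b : ℝ) (s w : ℂ) : ℂ := cexp (s * w) * cexp (-(I * b * cexp w))

theorem cexp_mul_lker (b lam : ℝ) (s w : ℂ) :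
    cexp (s * w) * lker b lam w = lnum b s w / lden lam w := by
  rw [lker, lnum, lden, mul_div_assoc]

theorem differentiable_lden (lam : ℝ) : Differentiable ℂ (lden lam) := by
  unfold lden; fun_prop

theorem differentiable_lnum (b : ℝ) (s : ℂ) : Differentiable ℂ (lnum b s) := by
  unfold lnum; fun_prop

/-- The frequencies `2π(ν + λ)`. -/
noncomputable def freq (lam : ℝ) (ν : ℕ) : ℝ := 2 * Real.pi * (ν + lam)

theorem freq_pos {lam : ℝ} (h0 : 0 < lam) (ν : ℕ) : 0 < freq lam ν := by
  have := Real.pi_pos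
  unfold freq; positivity

theorem eq_log_freq_of_lden_eq_zero {lam : ℝ} (h1 : lam < 1) {w : ℂ}
    (hw1 : -Real.pi < w.im) (hw2 : w.im < Real.pi) (h : lden lam w = 0) :
    ∃ k : ℕ, w = Real.log (freq lam k) := by
  rw [lden, unitPt, ← Complex.exp_add, sub_eq_zero, eq_comm, exp_eq_one_iff] at h
  obtain ⟨n, hn⟩ := h
  have hpi := Real.pi_pos
  have hE : cexp w = ((2 * Real.pi * (lam - n) : ℝ) : ℂ) := by
    have hI : I ≠ 0 := I_ne_zero
    apply mul_left_cancel₀ hI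
    push_cast
    linear_combination -hn
  have him := congrArg im hE
  have hre := congrArg re hE
  rw [exp_im, ofReal_im] at him
  rw [exp_re, ofReal_re] at hre
  have hs : Real.sin w.im = 0 := by
    rcases mul_eq_zero.mp him with h | h
    · exact absurd h (Real.exp_pos _).ne'
    · exact h
  have hw0 : w.im = 0 := (Real.sin_eq_zero_iff_of_lt_of_lt hw1 hw2).mp hs
  rw [hw0, Real.cos_zero, mul_one] at hre
  have hpos : 0 < 2 * Real.pi * (lam - n) := hre ▸ Real.exp_pos _
  have hln : (n : ℝ) < lam := by
    have := pos_of_mul_pos_right hpos (by positivity)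
    linarith
  have hn0 : n ≤ 0 := by
    have : (n : ℝ) < 1 := hln.trans h1
    have : n < 1 := by exact_mod_cast this
    linarith
  obtain ⟨k, hk⟩ := Int.eq_ofNat_of_zero_le (neg_nonneg.mpr hn0)
  refine ⟨k, ?_⟩
  have hk' : (n : ℝ) = -k := by
    have : n = -(k : ℤ) := by omega
    rw [this]; push_cast; ring
  rw [hk', sub_neg_eq_add, add_comm lam] at hre
  rw [freq, ← hre, Real.log_exp]
  apply Complex.ext <;> simp [hw0]

theorem unitPt_mul_cexp_freq (lam : ℝ) (k : ℕ) :
    unitPt lam * cexp (-(I * freq lam k)) = 1 := by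
  rw [unitPt, ← Complex.exp_add, exp_eq_one_iff]
  refine ⟨-k, ?_⟩
  rw [freq]; push_cast; ring

theorem cexp_log_freq {lam : ℝ} (h0 : 0 < lam) (k : ℕ) :
    cexp (Real.log (freq lam k)) = freq lam k := by
  rw [← ofReal_exp, Real.exp_log (freq_pos h0 k)]

theorem lden_log_freq {lam : ℝ} (h0 : 0 < lam) (k : ℕ) :
    lden lam (Real.log (freq lam k)) = 0 := by
  rw [lden, cexp_log_freq h0, unitPt_mul_cexp_freq, sub_self]

theorem deriv_lden_log_freq {lam : ℝ} (h0 : 0 < lam) (k : ℕ) :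
    deriv (lden lam) (Real.log (freq lam k)) = I * freq lam k := by
  have h : HasDerivAt (lden lam) (-(unitPt lam * (cexp (-(I * cexp (Real.log (freq lam k)))) *
      -(I * cexp (Real.log (freq lam k)))))) (Real.log (freq lam k) : ℂ) :=
    ((((Complex.hasDerivAt_exp _).const_mul I).fun_neg.cexp).const_mul (unitPt lam)).const_sub 1
  rw [h.deriv, cexp_log_freq h0, ← mul_assoc, unitPt_mul_cexp_freq]
  ring

theorem residue_eq {b lam : ℝ} (h0 : 0 < lam) (s : ℂ) (k : ℕ) :
    2 * Real.pi * I * (lnum b s (Real.log (freq lam k)) /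
      deriv (lden lam) (Real.log (freq lam k))) =
    2 * Real.pi * ((freq lam k : ℂ) ^ (s - 1) * cexp (-(I * b * freq lam k))) := by
  have hq : (freq lam k : ℂ) ≠ 0 := by exact_mod_cast (freq_pos h0 k).ne'
  rw [deriv_lden_log_freq h0, lnum, cexp_log_freq h0, cpow_sub _ _ hq, cpow_one,
    cpow_def_of_ne_zero hq, ofReal_log (freq_pos h0 k).le, mul_comm s]
  have := I_ne_zero
  field_simp

theorem lden_ne_zero_of_im {lam : ℝ} (h1 : lam < 1) {y : ℝ} (hy : y ≠ 0)
    (hy1 : -Real.pi < y) (hy2 : y < Real.pi) (x : ℝ) : lden lam (x + y * I) ≠ 0 := by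
  intro h
  obtain ⟨k, hk⟩ := eq_log_freq_of_lden_eq_zero h1 (w := x + y * I) (by simpa using hy1)
    (by simpa using hy2) h
  have := congrArg im hk
  simp at this
  exact hy this

theorem continuous_linF_line {lam : ℝ} (h1 : lam < 1) {y : ℝ} (hy : y ≠ 0)
    (hy1 : -Real.pi < y) (hy2 : y < Real.pi) (b : ℝ) (s : ℂ) :
    Continuous fun x : ℝ => lnum b s (x + y * I) / lden lam (x + y * I) :=
  ((differentiable_lnum b s).continuous.comp (by fun_prop)).div
    ((differentiable_lden lam).continuous.comp (by fun_prop))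
    (lden_ne_zero_of_im h1 hy hy1 hy2)

/-- The cut points `2π(Y + λ) - π`. -/
noncomputable def cutPt (lam : ℝ) (Y : ℕ) : ℝ := freq lam Y - Real.pi

theorem freq_lt_cutPt (lam : ℝ) (Y : ℕ) : freq lam Y < cutPt lam (Y + 1) := by
  have := Real.pi_pos
  unfold cutPt freq; push_cast; linarith

theorem cutPt_lt_freq (lam : ℝ) (Y : ℕ) : cutPt lam Y < freq lam Y := by
  have := Real.pi_pos
  unfold cutPt; linarith

theorem freq_mono (lam : ℝ) : StrictMono (freq lam) := by
  intro m n h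
  have := Real.pi_pos
  have h' : (m : ℝ) < n := by exact_mod_cast h
  unfold freq; gcongr

theorem rectInt_linF {lam : ℝ} (h0 : 0 < lam) (h1 : lam < 1) (b : ℝ) (s : ℂ) {x₀ δ : ℝ}
    (hδ : 0 < δ) (hδ2 : δ < Real.pi) (hx : x₀ < Real.log (freq lam 0)) (Y : ℕ) :
    rectInt (fun w => lnum b s w / lden lam w) x₀ (Real.log (cutPt lam (Y + 1))) δ =
      2 * Real.pi * ∑ ν ∈ range (Y + 1),
        (freq lam ν : ℂ) ^ (s - 1) * cexp (-(I * b * freq lam ν)) := by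
  have hcut : ∀ k, 0 < cutPt lam (k + 1) := fun k => (freq_pos h0 k).trans (freq_lt_cutPt lam k)
  induction Y with
  | zero =>
    rw [rectInt_div_of_simple_zero (differentiable_lnum b s) (differentiable_lden lam) hx
      (Real.log_lt_log (freq_pos h0 0) (freq_lt_cutPt lam 0)) hδ (lden_log_freq h0 0)
      (by rw [deriv_lden_log_freq h0]; exact mul_ne_zero I_ne_zero
            (by exact_mod_cast (freq_pos h0 0).ne')) ?_, residue_eq h0]
    · simp
    · intro w _ hw2 hw3 hw4 hw
      obtain ⟨k, hk⟩ := eq_log_freq_of_lden_eq_zero h1 (by linarith) (by linarith) hw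
      rw [hk, ofReal_re] at hw2
      have h3 := (Real.log_le_log_iff (freq_pos h0 k) (hcut 0)).mp hw2
      have h4 := h3.trans_lt (cutPt_lt_freq lam _)
      have h5 := (freq_mono lam).lt_iff_lt.mp h4
      rw [hk]
      have : k = 0 := by omega
      rw [this]
  | succ Y ih =>
    rw [← rectInt_add (x₁ := Real.log (cutPt lam (Y + 1))), ih, sum_range_succ _ (Y + 1), mul_add]
    · congr 1
      rw [rectInt_div_of_simple_zero (differentiable_lnum b s) (differentiable_lden lam)
        (Real.log_lt_log (hcut Y) (cutPt_lt_freq lam (Y + 1)))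
        (Real.log_lt_log (freq_pos h0 (Y + 1)) (freq_lt_cutPt lam (Y + 1))) hδ
        (lden_log_freq h0 (Y + 1))
        (by rw [deriv_lden_log_freq h0]; exact mul_ne_zero I_ne_zero
              (by exact_mod_cast (freq_pos h0 (Y + 1)).ne')) ?_, residue_eq h0]
      intro w hw1 hw2 hw3 hw4 hw
      obtain ⟨k, hk⟩ := eq_log_freq_of_lden_eq_zero h1 (by linarith) (by linarith) hw
      rw [hk, ofReal_re] at hw1 hw2
      have h3 := (Real.log_le_log_iff (freq_pos h0 k) (hcut (Y + 1))).mp hw2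
      have h4 := h3.trans_lt (cutPt_lt_freq lam _)
      have h5 := (freq_mono lam).lt_iff_lt.mp h4
      have h6 := (Real.log_le_log_iff (hcut Y) (freq_pos h0 k)).mp hw1
      have h7 := (freq_mono lam).lt_iff_lt.mp ((freq_lt_cutPt lam Y).trans_le h6)
      rw [hk]
      have : k = Y + 1 := by omega
      rw [this]
    · rintro y (rfl | rfl)
      · exact continuous_linF_line h1 hδ.ne' (by linarith) hδ2 b s
      · exact continuous_linF_line h1 (by simpa using hδ.ne') (by linarith) (by linarith) b s

theorem one_add_pow_le_exp {y : ℝ} (hy : 0 ≤ y) {n : ℕ} (hn : 1 ≤ n) :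
    (1 + y) ^ n ≤ (8 * n) ^ n * Real.exp (y / 8) := by
  have hn' : (1 : ℝ) ≤ n := by exact_mod_cast hn
  have h1 : 1 + y ≤ 8 * n * Real.exp (y / (8 * n)) := by
    have := Real.add_one_le_exp (y / (8 * n))
    calc 1 + y ≤ 8 * n * (y / (8 * n) + 1) := by
          rw [mul_add, mul_div_cancel₀ _ (by positivity)]; linarith
      _ ≤ _ := by gcongr
  calc (1 + y) ^ n ≤ (8 * n * Real.exp (y / (8 * n))) ^ n := by gcongr
    _ = _ := by
      rw [mul_pow, ← Real.exp_nat_mul]; congr 2; field_simp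

theorem mul_div_mul_mul_le {A A' E E' D d z z' q q' : ℝ} (hA : 0 ≤ A) (hAA : A ≤ A') (hE : 0 ≤ E)
    (hEE : E ≤ E') (hd : 0 < d) (hdD : d ≤ D) (hz : 0 ≤ z) (hzz : z ≤ z') (hq : 0 ≤ q)
    (hqq : q ≤ q') : A * E / D * z * q ≤ A' * E' / d * z' * q' := by
  have hA' : 0 ≤ A' := hA.trans hAA
  have hE' : 0 ≤ E' := hE.trans hEE
  have hz' : 0 ≤ z' := hz.trans hzz
  gcongr

theorem norm_lnum (b σ t u y : ℝ) :
    ‖lnum b (σ + t * I) (u + y * I)‖ = Real.exp (σ * u) * Real.exp (b * Real.exp u * Real.sin y - t * y) := by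
  rw [lnum, norm_mul, norm_cexp_mul_line, norm_cexp_neg_kernel, ← Real.exp_add, ← Real.exp_add]
  congr 1; simp; ring

/-- The range of parameters in which the approximate functional equation is used. -/
structure AFEHyp (b h t σ : ℝ) : Prop where
  one_le : 1 ≤ h
  le_b : h / 4 ≤ b
  b_le : b ≤ 4 * h
  t_close : |t - b * h| ≤ 10 * b
  half_le : 1 / 2 ≤ σ
  le_two : σ ≤ 2

theorem left_majorant_le {A B x m y : ℝ} (hA : 0 < A) (hB : 0 ≤ B) (hx : 0 ≤ x) (hm : 0 ≤ m)
    (hy : 0 ≤ y) (hyx : 1 + y ≤ (1 + x) * (1 + m)) :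
    B * Real.exp (-(x / 2)) * Real.exp (40 - m / 4) / (A * (1 + m))⁻¹ * (2 * (1 + y)) *
      (1 + y) ^ 2 ≤ 2 * A * Real.exp 40 * 24 ^ 3 * 32 ^ 4 * B := by
  have hpx := one_add_pow_le_exp hx (n := 3) (by norm_num)
  have hpm := one_add_pow_le_exp hm (n := 4) (by norm_num)
  have hE : Real.exp (-(x / 2)) * Real.exp (40 - m / 4) * Real.exp (x / 8) * Real.exp (m / 8) ≤
      Real.exp 40 := by
    rw [← Real.exp_add, ← Real.exp_add, ← Real.exp_add]
    apply Real.exp_le_exp.mpr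
    linarith
  have h3 : (1 + y) ^ 3 ≤ ((1 + x) * (1 + m)) ^ 3 := by gcongr
  have hP : 0 ≤ Real.exp (-(x / 2)) * Real.exp (40 - m / 4) := by positivity
  calc _ = 2 * A * B * (Real.exp (-(x / 2)) * Real.exp (40 - m / 4)) * (1 + m) *
          (1 + y) ^ 3 := by rw [div_inv_eq_mul]; ring
    _ ≤ 2 * A * B * (Real.exp (-(x / 2)) * Real.exp (40 - m / 4)) * (1 + m) *
          ((1 + x) * (1 + m)) ^ 3 := mul_le_mul_of_nonneg_left h3 (by positivity)
    _ = 2 * A * B * (Real.exp (-(x / 2)) * Real.exp (40 - m / 4)) *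
          ((1 + x) ^ 3 * (1 + m) ^ 4) := by ring
    _ ≤ 2 * A * B * (Real.exp (-(x / 2)) * Real.exp (40 - m / 4)) *
          (((8 * (3 : ℕ)) ^ 3 * Real.exp (x / 8)) * ((8 * (4 : ℕ)) ^ 4 * Real.exp (m / 8))) :=
        mul_le_mul_of_nonneg_left (mul_le_mul hpx hpm (by positivity) (by positivity))
          (by positivity)
    _ = 2 * A * B * 24 ^ 3 * 32 ^ 4 *
          (Real.exp (-(x / 2)) * Real.exp (40 - m / 4) * Real.exp (x / 8) * Real.exp (m / 8)) := by
        push_cast; ring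
    _ ≤ 2 * A * B * 24 ^ 3 * 32 ^ 4 * Real.exp 40 := mul_le_mul_of_nonneg_left hE (by positivity)
    _ = _ := by ring

set_option maxHeartbeats 1000000 in
theorem norm_linF_left_le {lam : ℝ} (h0 : 0 < lam) (h1 : lam < 1) :
    ∃ C : ℝ, 0 < C ∧ ∀ b h t σ u : ℝ, AFEHyp b h t σ → u ≤ Real.log h →
      ‖lnum b (σ + t * I) (u + (1 / h : ℝ) * I) / lden lam (u + (1 / h : ℝ) * I)‖ *
        (1 + h * ‖(u + (1 / h : ℝ) * I : ℂ) - Real.log h‖) ≤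
      C * h ^ σ * (1 + (h * (u - Real.log h)) ^ 2)⁻¹ := by
  set c := ‖1 - unitPt lam‖ with hc
  have hcp : 0 < c := norm_pos_iff.mpr (sub_ne_zero.mpr (unitPt_ne_one h0 h1).symm)
  set C0 : ℝ := 4 / c + 2 * (1 + 4 / c) with hC0
  have hC0p : 0 < C0 := by positivity
  refine ⟨2 * C0 * Real.exp 40 * 24 ^ 3 * 32 ^ 4, by positivity, ?_⟩
  rintro b h t σ u ⟨hh1, hb1, hb2, ht, hs1, hs2⟩ hu
  have hh : 0 < h := by linarith
  have hb : 0 < b := by linarith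
  set δ := 1 / h with hδ
  have hδp : 0 < δ := by positivity
  have hδ1 : δ ≤ 1 := by rw [hδ, div_le_one hh]; exact hh1
  have hδh : h * δ = 1 := by rw [hδ]; field_simp
  set x := Real.log h - u with hx
  have hx0 : 0 ≤ x := by linarith
  set r := Real.exp u with hr
  have hrp : 0 < r := Real.exp_pos u
  have hrh : r = h * Real.exp (-x) := by
    rw [hr, hx, show -(Real.log h - u) = u - Real.log h by ring, Real.exp_sub, Real.exp_log hh]
    field_simp
  have hrle : r ≤ h := by
    rw [hrh]; exact mul_le_of_le_one_right hh.le (Real.exp_le_one_iff.mpr (by linarith))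
  set m := h - r with hm
  have hm0 : 0 ≤ m := by linarith
  have hsin1 : Real.sin δ ≤ δ := Real.sin_le hδp.le
  have hsin2 : δ / 2 ≤ Real.sin δ := by
    have := Real.sin_gt_sub_cube hδp
    nlinarith [pow_le_one₀ (n := 2) hδp.le hδ1]
  have hhx : h * x ≤ (1 + x) * m := by
    have h2 : m = h * (1 - Real.exp (-x)) := by rw [hm, hrh]; ring
    have h3 : x ≤ (1 + x) * (1 - Real.exp (-x)) := by
      have := Real.add_one_le_exp x
      have h4 : (1 + x) * Real.exp (-x) ≤ 1 := by
        calc (1 + x) * Real.exp (-x) ≤ Real.exp x * Real.exp (-x) := by gcongr; linarith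
          _ = 1 := by rw [← Real.exp_add]; simp
      linarith
    rw [h2]
    nlinarith
  have hnI : ‖I * cexp (u + δ * I)‖ = r := norm_I_mul_cexp u δ
  have hD : (C0 * (1 + m))⁻¹ ≤ ‖lden lam (u + δ * I)‖ := by
    have hk : h ≤ (1 + r) * (1 + m) := by rw [hm]; nlinarith
    rcases le_total r (c / 4) with h4 | h4
    · have := norm_one_sub_mul_exp_ge_of_small (norm_unitPt lam) (x := I * cexp (u + δ * I))
        (by rw [hnI]; exact h4)
      refine le_trans ?_ this
      rw [← hc, inv_le_comm₀ (by positivity) (by positivity), inv_div]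
      have : 2 / c ≤ C0 := by
        rw [hC0]; have : 0 < 1 / c := by positivity
        have e1 : 2 / c = 2 * (1 / c) := by ring
        have e2 : 4 / c = 4 * (1 / c) := by ring
        rw [e1, e2]; linarith
      nlinarith
    · have h5 : r * δ / 2 ≤ ‖lden lam (u + δ * I)‖ := by
        have h6 : ‖unitPt lam * cexp (-(I * cexp (u + δ * I)))‖ = Real.exp (r * Real.sin δ) := by
          rw [norm_mul, norm_unitPt, one_mul, norm_exp, neg_re, re_I_mul_cexp, neg_neg]
        have h7 := norm_sub_norm_le (unitPt lam * cexp (-(I * cexp (u + δ * I)))) 1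
        rw [h6, norm_one, norm_sub_rev] at h7
        have h8 := Real.add_one_le_exp (r * Real.sin δ)
        have h9 : r * (δ / 2) ≤ r * Real.sin δ := by gcongr
        rw [lden]; linarith
      refine le_trans ?_ h5
      rw [inv_le_comm₀ (by positivity) (by positivity)]
      have h10 : (r * δ / 2)⁻¹ = 2 * h / r := by rw [hδ]; field_simp
      rw [h10, div_le_iff₀ hrp]
      have h11 : 1 + r ≤ (1 + 4 / c) * r := by
        have : 1 ≤ 4 / c * r := by
          rw [div_mul_eq_mul_div, le_div_iff₀ hcp]; linarith
        linarith
      have h12 : 2 * (1 + 4 / c) ≤ C0 := by rw [hC0]; have : 0 < 4 / c := by positivity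
                                            linarith
      calc 2 * h ≤ 2 * ((1 + r) * (1 + m)) := by linarith
        _ ≤ 2 * (((1 + 4 / c) * r) * (1 + m)) := by gcongr
        _ = 2 * (1 + 4 / c) * ((1 + m) * r) := by ring
        _ ≤ C0 * ((1 + m) * r) := by gcongr
        _ = _ := by ring
  have hexp : b * r * Real.sin δ - t * δ ≤ 40 - m / 4 := by
    have h5 : b * r * Real.sin δ ≤ b * r * δ := by gcongr
    have h6 : b * h - 10 * b ≤ t := by linarith [(abs_le.mp ht).1]
    have h7 : (b * h - 10 * b) * δ ≤ t * δ := by gcongr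
    have h8 : b * δ ≤ 4 := by rw [hδ, mul_one_div, div_le_iff₀ hh]; linarith
    have h9 : 1 / 4 ≤ b * δ := by rw [hδ, mul_one_div, le_div_iff₀ hh]; linarith
    have h10 : m * (1 / 4) ≤ m * (b * δ) := by gcongr
    have : b * r * δ - (b * h - 10 * b) * δ = 10 * (b * δ) - m * (b * δ) := by rw [hm]; ring
    linarith
  have hsu : Real.exp (σ * u) ≤ h ^ σ * Real.exp (-(x / 2)) := by
    rw [Real.rpow_def_of_pos hh, ← Real.exp_add]
    apply Real.exp_le_exp.mpr
    have : u = Real.log h - x := by rw [hx]; ring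
    rw [this]; nlinarith
  have hz : 1 + h * ‖(u + (δ : ℝ) * I : ℂ) - Real.log h‖ ≤ 2 * (1 + h * x) := by
    have : ‖(u + (δ : ℝ) * I : ℂ) - Real.log h‖ ≤ x + δ := by
      rw [show (u + (δ : ℝ) * I : ℂ) - Real.log h = ((-x : ℝ) : ℂ) + (δ : ℝ) * I by
        rw [hx]; push_cast; ring]
      refine (norm_add_le _ _).trans ?_
      rw [norm_mul, norm_I, norm_real, norm_real, Real.norm_eq_abs, Real.norm_eq_abs, abs_neg,
        abs_of_nonneg hx0, abs_of_pos hδp, mul_one]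
    nlinarith [mul_nonneg hh.le hx0]
  have h1hx : 1 + h * x ≤ (1 + x) * (1 + m) := by nlinarith
  have hsq : 1 + (h * (u - Real.log h)) ^ 2 ≤ (1 + h * x) ^ 2 := by
    have : u - Real.log h = -x := by rw [hx]; ring
    rw [this]; nlinarith [mul_nonneg hh.le hx0]
  have hhx0 : 0 ≤ h * x := mul_nonneg hh.le hx0
  rw [← div_eq_mul_inv, le_div_iff₀ (by positivity), norm_div, norm_lnum]
  refine (mul_div_mul_mul_le (Real.exp_pos _).le hsu (Real.exp_pos _).le
    (Real.exp_le_exp.mpr hexp) (by positivity) hD (by positivity) hz (by positivity) hsq).trans ?_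
  exact left_majorant_le hC0p (by positivity) hx0 hm0 hhx0 h1hx

theorem norm_linF_right_le (lam : ℝ) :
    ∃ C : ℝ, 0 < C ∧ ∀ b h t σ u : ℝ, AFEHyp b h t σ → Real.log h ≤ u →
      ‖lnum b (σ + t * I) (u + (-(1 / h) : ℝ) * I) / lden lam (u + (-(1 / h) : ℝ) * I)‖ *
        (1 + h * ‖(u + (-(1 / h) : ℝ) * I : ℂ) - Real.log h‖) ≤
      C * h ^ σ * (1 + (h * (u - Real.log h)) ^ 2)⁻¹ := by
  refine ⟨6 * Real.exp 44 * 40 ^ 5, by positivity, ?_⟩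
  rintro b h t σ u ⟨hh1, hb1, hb2, ht, hs1, hs2⟩ hu
  have hh : 0 < h := by linarith
  have hb : 0 < b := by linarith
  set δ := 1 / h with hδ
  have hδp : 0 < δ := by positivity
  have hδ1 : δ ≤ 1 := by rw [hδ, div_le_one hh]; exact hh1
  have hδh : h * δ = 1 := by rw [hδ]; field_simp
  set x := u - Real.log h with hx
  have hx0 : 0 ≤ x := by linarith
  set r := Real.exp u with hr
  have hrp : 0 < r := Real.exp_pos u
  have hrh : r = h * Real.exp x := by
    rw [hr, hx, Real.exp_sub, Real.exp_log hh]
    field_simp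
  set m := r - h with hm
  have hmx : h * x ≤ m := by
    rw [hm, hrh]; have := Real.add_one_le_exp x; nlinarith
  have hhx0 : 0 ≤ h * x := mul_nonneg hh.le hx0
  have hm0 : 0 ≤ m := hhx0.trans hmx
  have hsin1 : Real.sin δ ≤ δ := Real.sin_le hδp.le
  have hsc := Real.sin_gt_sub_cube hδp
  have hsin2 : δ / 2 ≤ Real.sin δ := by
    nlinarith [pow_le_one₀ (n := 2) hδp.le hδ1]
  have hD : 1 / 3 ≤ ‖lden lam (u + (-δ : ℝ) * I)‖ := by
    have h6 : ‖cexp (-(I * cexp (u + (-δ : ℝ) * I)))‖ ≤ 2 / 3 := by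
      rw [norm_exp, neg_re, re_I_mul_cexp, neg_neg, Real.sin_neg]
      have h7 : 1 / 2 ≤ r * Real.sin δ := by
        calc 1 / 2 = h * (δ / 2) := by linarith
          _ ≤ r * Real.sin δ := by gcongr; linarith
      have h8 := exp_neg_le_inv (x := 1 + 1 / 2) (by norm_num)
      have h9 := Real.add_one_le_exp (1 / 2 : ℝ)
      calc Real.exp (r * -Real.sin δ) ≤ Real.exp (-(1 / 2)) := by
            apply Real.exp_le_exp.mpr; linarith
        _ ≤ 2 / 3 := by
          rw [Real.exp_neg, inv_le_comm₀ (Real.exp_pos _) (by norm_num)]; linarith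
    have := norm_one_sub_mul_ge_of_norm_le_one (r := cexp (-(I * cexp (u + (-δ : ℝ) * I))))
      (norm_unitPt lam)
    rw [lden]; linarith
  have hexp : b * r * Real.sin (-δ) - t * -δ ≤ 44 - m / 8 := by
    rw [Real.sin_neg]
    have h6 : t ≤ b * h + 10 * b := by linarith [(abs_le.mp ht).2]
    have h7 : t * δ ≤ (b * h + 10 * b) * δ := by gcongr
    have h8 : b * δ ≤ 4 := by rw [hδ, mul_one_div, div_le_iff₀ hh]; linarith
    have h9 : 1 / 4 ≤ b * δ := by rw [hδ, mul_one_div, le_div_iff₀ hh]; linarith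
    have h10 : m * (1 / 8) ≤ m * (b * Real.sin δ) := by
      gcongr
      calc 1 / 8 ≤ b * (δ / 2) := by linarith
        _ ≤ _ := by gcongr
    have h11 : b * h * (δ - Real.sin δ) ≤ 4 := by
      calc b * h * (δ - Real.sin δ) ≤ b * h * (δ ^ 3 / 6) := by gcongr; linarith
        _ = b * δ * (h * δ) * δ / 6 := by ring
        _ ≤ 4 * (h * δ) * 1 / 6 := by gcongr
        _ ≤ 4 := by rw [hδh]; norm_num
    have : (b * h + 10 * b) * δ - b * r * Real.sin δ =
      10 * (b * δ) + b * h * (δ - Real.sin δ) - m * (b * Real.sin δ) := by rw [hm]; ring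
    linarith
  have hsu : Real.exp (σ * u) ≤ h ^ σ * (1 + m) ^ 2 := by
    have e1 : Real.exp (σ * u) = h ^ σ * Real.exp (σ * x) := by
      rw [Real.rpow_def_of_pos hh, ← Real.exp_add, hx]; congr 1; ring
    have e2 : Real.exp (σ * x) ≤ Real.exp x ^ 2 := by
      rw [← Real.exp_nat_mul]; apply Real.exp_le_exp.mpr; push_cast; gcongr
    have e3 : Real.exp x ≤ 1 + m := by
      rw [hm, hrh]; have := Real.one_le_exp hx0; nlinarith
    rw [e1]
    gcongr
    exact e2.trans (by gcongr)
  have hz : 1 + h * ‖(u + (-δ : ℝ) * I : ℂ) - Real.log h‖ ≤ 2 * (1 + m) := by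
    have : ‖(u + (-δ : ℝ) * I : ℂ) - Real.log h‖ ≤ x + δ := by
      rw [show (u + (-δ : ℝ) * I : ℂ) - Real.log h = ((x : ℝ) : ℂ) + (-δ : ℝ) * I by
        rw [hx]; push_cast; ring]
      refine (norm_add_le _ _).trans ?_
      rw [norm_mul, norm_I, norm_real, norm_real, Real.norm_eq_abs, Real.norm_eq_abs, abs_neg,
        abs_of_nonneg hx0, abs_of_pos hδp, mul_one]
    nlinarith
  have hsq : 1 + (h * x) ^ 2 ≤ (1 + m) ^ 2 := by nlinarith
  have hpm := one_add_pow_le_exp hm0 (n := 5) (by norm_num)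
  rw [← div_eq_mul_inv, le_div_iff₀ (by positivity), norm_div, norm_lnum]
  calc _ ≤ (h ^ σ * (1 + m) ^ 2) * Real.exp (44 - m / 8) / (1 / 3) *
        (2 * (1 + m)) * (1 + m) ^ 2 :=
        mul_div_mul_mul_le (Real.exp_pos _).le hsu (Real.exp_pos _).le
          (Real.exp_le_exp.mpr hexp) (by norm_num) hD (by positivity) hz (by positivity) hsq
    _ = 6 * h ^ σ * Real.exp (44 - m / 8) * (1 + m) ^ 5 := by ring
    _ ≤ 6 * h ^ σ * Real.exp (44 - m / 8) * ((8 * (5 : ℕ)) ^ 5 * Real.exp (m / 8)) := by gcongr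
    _ = 6 * 40 ^ 5 * h ^ σ * (Real.exp (44 - m / 8) * Real.exp (m / 8)) := by push_cast; ring
    _ = _ := by rw [← Real.exp_add, sub_add_cancel]; ring

theorem norm_linF_arc_le {lam : ℝ} (Y : ℕ) {b t σ y : ℝ} (H : AFEHyp b (cutPt lam Y) t σ)
    (hy : |y| ≤ 1 / cutPt lam Y) :
      ‖lnum b (σ + t * I) (Real.log (cutPt lam Y) + y * I) /
        lden lam (Real.log (cutPt lam Y) + y * I)‖ *
        (1 + cutPt lam Y * ‖(Real.log (cutPt lam Y) + y * I : ℂ) - Real.log (cutPt lam Y)‖) ≤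
      2 * Real.exp 41 * cutPt lam Y ^ σ := by
  set h := cutPt lam Y with hhdef
  obtain ⟨hh1, hb1, hb2, ht, hs1, hs2⟩ := H
  have hh : 0 < h := by linarith
  have hb : 0 < b := by linarith
  have hhy : h * |y| ≤ 1 := by rw [le_div_iff₀ hh] at hy; linarith
  have hy1 : |y| ≤ 1 := hy.trans (by rw [div_le_one hh]; exact hh1)
  have hz : 1 + h * ‖(Real.log h + y * I : ℂ) - Real.log h‖ ≤ 2 := by
    rw [add_sub_cancel_left, norm_mul, norm_I, norm_real, mul_one, Real.norm_eq_abs]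
    linarith
  have hD : 1 ≤ ‖lden lam (Real.log h + y * I)‖ := by
    refine le_trans ?_ (abs_re_le_norm _)
    refine le_trans ?_ (le_abs_self _)
    have e : unitPt lam * cexp (-(I * cexp (Real.log h + y * I))) =
        cexp ((h * Real.sin y : ℝ) + (Real.pi + h * (1 - Real.cos y) : ℝ) * I) := by
      have e1 : cexp (Real.log h + y * I) = h * (Real.cos y + Real.sin y * I) := by
        rw [Complex.exp_add, ← ofReal_exp, Real.exp_log hh, exp_mul_I, ofReal_cos, ofReal_sin]
      rw [e1, unitPt, ← Complex.exp_add, exp_eq_exp_iff_exists_int]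
      refine ⟨-Y, ?_⟩
      have : (h : ℂ) = 2 * Real.pi * (Y + lam) - Real.pi := by
        rw [hhdef, cutPt, freq]; push_cast; ring
      push_cast
      linear_combination (-(h : ℂ) * Complex.sin y) * I_mul_I - I * this
    rw [lden, e, sub_re, one_re, exp_re]
    simp only [add_re, ofReal_re, mul_re, I_re, mul_zero, ofReal_im, I_im, mul_one, sub_self,
      add_zero, add_im, mul_im, zero_add]
    have hcos : 0 ≤ Real.cos (h * (1 - Real.cos y)) := by
      have h2 := Real.one_sub_sq_div_two_le_cos (x := y)
      have h3 := Real.cos_le_one y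
      apply Real.cos_nonneg_of_mem_Icc
      have h4 : h * (1 - Real.cos y) ≤ 1 := by
        have : h * (1 - Real.cos y) ≤ h * (y ^ 2 / 2) := by gcongr; linarith
        have h5 : h * (y ^ 2 / 2) = (h * |y|) * |y| / 2 := by rw [← sq_abs]; ring
        have h6 : (h * |y|) * |y| ≤ 1 * 1 := by gcongr
        linarith
      have h7 : 0 ≤ h * (1 - Real.cos y) := mul_nonneg hh.le (by linarith)
      constructor <;> linarith [Real.pi_gt_three]
    rw [add_comm Real.pi, Real.cos_add_pi]
    nlinarith [Real.exp_pos (h * Real.sin y)]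
  have hexp : b * h * Real.sin y - t * y ≤ 41 := by
    have h8 : b * |y| ≤ 4 := by nlinarith [abs_nonneg y]
    have h9 : -((t - b * h) * y) ≤ 40 := by
      refine (neg_le_abs _).trans ?_
      rw [abs_mul]
      calc _ ≤ 10 * b * |y| := by gcongr
        _ ≤ 40 := by linarith
    have h10 : b * h * (Real.sin y - y) ≤ 1 := by
      rcases le_total 0 y with h0 | h0
      · have := Real.sin_le h0
        have h3 : b * h * (Real.sin y - y) ≤ 0 := mul_nonpos_of_nonneg_of_nonpos (by positivity) (by linarith)
        linarith
      · rcases h0.eq_or_lt with rfl | h0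
        · simp
        · have h4 := Real.sin_gt_sub_cube (x := -y) (by linarith)
          rw [Real.sin_neg] at h4
          rw [abs_of_neg h0] at h8 hhy hy1
          calc b * h * (Real.sin y - y) ≤ b * h * ((-y) ^ 3 / 6) := by gcongr; linarith
            _ = (b * -y) * (h * -y) * (-y) / 6 := by ring
            _ ≤ 4 * 1 * 1 / 6 := by
              have : 0 ≤ -y := by linarith
              gcongr
            _ ≤ 1 := by norm_num
    nlinarith
  rw [norm_div, norm_lnum, Real.exp_log hh]
  have e : Real.exp (σ * Real.log h) = h ^ σ := by
    rw [Real.rpow_def_of_pos hh, mul_comm]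
  rw [e]
  calc _ ≤ h ^ σ * Real.exp 41 / 1 * 2 := by gcongr
    _ = _ := by ring

/-- The integrand `e ^ (s w) K(w)`. -/
noncomputable def linF (b lam : ℝ) (s w : ℂ) : ℂ := lnum b s w / lden lam w

/-- The three measures carrying the pieces of the contour: left ray, arc, right ray. -/
noncomputable def pathMu (h : ℝ) : Fin 3 → Measure ℝ :=
  ![volume.restrict (Set.Iic (Real.log h)), volume.restrict (Set.Ioc (-(1 / h)) (1 / h)),
    volume.restrict (Set.Ioi (Real.log h))]

/-- Parametrisations of the pieces of the contour. -/
noncomputable def pathPt (h : ℝ) : Fin 3 → ℝ → ℂ :=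
  ![fun u => u + (1 / h : ℝ) * I, fun y => Real.log h + y * I, fun u => u + (-(1 / h) : ℝ) * I]

/-- Coefficients of the pieces of the contour. -/
noncomputable def pathCoef : Fin 3 → ℂ := ![1, -I, 1]

/-- The remainder in the approximate functional equation. -/
noncomputable def afeRem (b lam h : ℝ) (s : ℂ) : ℂ :=
  ∑ i, pathCoef i * ∫ u, linF b lam s (pathPt h i u) ∂pathMu h i

theorem norm_pathCoef (i : Fin 3) : ‖pathCoef i‖ = 1 := by
  fin_cases i <;> simp [pathCoef]

instance (h : ℝ) (i : Fin 3) : SFinite (pathMu h i) := by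
  fin_cases i
  · exact inferInstanceAs (SFinite (volume.restrict (Set.Iic (Real.log h))))
  · exact inferInstanceAs (SFinite (volume.restrict (Set.Ioc (-(1 / h)) (1 / h))))
  · exact inferInstanceAs (SFinite (volume.restrict (Set.Ioi (Real.log h))))

theorem continuous_pathPt (h : ℝ) (i : Fin 3) : Continuous (pathPt h i) := by
  fin_cases i <;> (simp only [pathPt]; dsimp; fun_prop)

theorem integrable_inv_one_add_sq_scaled {h : ℝ} (hh : 0 < h) (L : ℝ) :
    Integrable fun u : ℝ => (1 + (h * (u - L)) ^ 2)⁻¹ :=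
  (integrable_inv_one_add_sq.comp_mul_left' hh.ne').comp_sub_right L

theorem integral_inv_one_add_sq_scaled {h : ℝ} (hh : 0 < h) (L : ℝ) :
    ∫ u : ℝ, (1 + (h * (u - L)) ^ 2)⁻¹ = Real.pi / h := by
  rw [integral_sub_right_eq_self (fun u : ℝ => (1 + (h * u) ^ 2)⁻¹) L,
    Measure.integral_comp_mul_left (fun u : ℝ => (1 + u ^ 2)⁻¹) h, integral_univ_inv_one_add_sq,
    abs_of_pos (inv_pos.mpr hh), smul_eq_mul]
  field_simp

theorem exists_path_majorant {lam : ℝ} (h0 : 0 < lam) (h1 : lam < 1) :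
    ∃ C : ℝ, 0 < C ∧ ∀ (b σ : ℝ) (Y : ℕ), 1 ≤ cutPt lam Y → ∀ i : Fin 3, ∃ P : ℝ → ℝ,
      Integrable P (pathMu (cutPt lam Y) i) ∧
      ∫ u, P u ∂pathMu (cutPt lam Y) i ≤ C * cutPt lam Y ^ (σ - 1) ∧
      ∀ t : ℝ, AFEHyp b (cutPt lam Y) t σ → ∀ᵐ u ∂pathMu (cutPt lam Y) i,
        ‖linF b lam (σ + t * I) (pathPt (cutPt lam Y) i u)‖ *
          (1 + cutPt lam Y * ‖pathPt (cutPt lam Y) i u - Real.log (cutPt lam Y)‖) ≤ P u := by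
  obtain ⟨C1, hC1, H1⟩ := norm_linF_left_le h0 h1
  obtain ⟨C2, hC2, H2⟩ := norm_linF_right_le lam
  refine ⟨C1 * Real.pi + 4 * Real.exp 41 + C2 * Real.pi, by positivity, ?_⟩
  intro b σ Y hh1 i
  set h := cutPt lam Y with hh
  have hp : 0 < h := by linarith
  have hpow : h ^ (σ - 1) = h ^ σ / h := by rw [Real.rpow_sub_one hp.ne']
  have hray : ∀ (C : ℝ) (s : Set ℝ), 0 < C →
      ∫ u in s, C * h ^ σ * (1 + (h * (u - Real.log h)) ^ 2)⁻¹ ≤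
        C * Real.pi * h ^ (σ - 1) := by
    intro C s hC
    refine (setIntegral_le_integral ((integrable_inv_one_add_sq_scaled hp _).const_mul _)
      (Eventually.of_forall fun u => ?_)).trans (le_of_eq ?_)
    · simp only [Pi.zero_apply]; positivity
    · rw [integral_const_mul, integral_inv_one_add_sq_scaled hp, hpow]; ring
  have hpp : 0 < h ^ (σ - 1) := by positivity
  have hpi := Real.pi_pos
  have hexp := Real.exp_pos 41
  fin_cases i
  · refine ⟨fun u => C1 * h ^ σ * (1 + (h * (u - Real.log h)) ^ 2)⁻¹,
      ((integrable_inv_one_add_sq_scaled hp _).const_mul _).integrableOn,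
      (hray C1 _ hC1).trans (by gcongr; nlinarith [mul_pos hC2 hpi]), fun t H => ?_⟩
    exact (ae_restrict_mem measurableSet_Iic).mono fun u hu => H1 b h t σ u H hu
  · refine ⟨fun _ => 2 * Real.exp 41 * h ^ σ, ?_, ?_, fun t H => ?_⟩
    · change Integrable _ (volume.restrict (Set.Ioc (-(1 / h)) (1 / h)))
      exact integrable_const _
    · simp only [pathMu]
      dsimp
      rw [setIntegral_const, measureReal_def, Real.volume_Ioc, ENNReal.toReal_ofReal
        (by have : 0 < 1 / h := by positivity
            linarith), smul_eq_mul]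
      calc (1 / h - -(1 / h)) * (2 * Real.exp 41 * h ^ σ) = 4 * Real.exp 41 * h ^ (σ - 1) := by
            rw [hpow]; ring
        _ ≤ _ := by gcongr; nlinarith [mul_pos hC2 hpi, mul_pos hC1 hpi]
    · refine (ae_restrict_mem measurableSet_Ioc).mono fun y hy => ?_
      exact norm_linF_arc_le Y H (abs_le.mpr ⟨hy.1.le, hy.2⟩)
  · refine ⟨fun u => C2 * h ^ σ * (1 + (h * (u - Real.log h)) ^ 2)⁻¹,
      ((integrable_inv_one_add_sq_scaled hp _).const_mul _).integrableOn,
      (hray C2 _ hC2).trans (by gcongr; nlinarith [mul_pos hC1 hpi]), fun t H => ?_⟩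
    exact (ae_restrict_mem measurableSet_Ioi).mono fun u hu => H2 b h t σ u H hu.le

theorem measurable_linF_pathPt (b lam h : ℝ) (s : ℂ) (i : Fin 3) :
    Measurable fun u => linF b lam s (pathPt h i u) := by
  have hc := continuous_pathPt h i
  exact (((differentiable_lnum b s).continuous.comp hc).measurable).div
    (((differentiable_lden lam).continuous.comp hc).measurable)

theorem integrable_linF_pathPt {lam : ℝ} (h0 : 0 < lam) (h1 : lam < 1) {b t σ : ℝ} {Y : ℕ}
    (H : AFEHyp b (cutPt lam Y) t σ) (i : Fin 3) :
    Integrable (fun u => linF b lam (σ + t * I) (pathPt (cutPt lam Y) i u))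
      (pathMu (cutPt lam Y) i) := by
  obtain ⟨C, hC, hP⟩ := exists_path_majorant h0 h1
  obtain ⟨P, hPi, -, hPb⟩ := hP b σ Y H.one_le i
  refine hPi.mono' (measurable_linF_pathPt _ _ _ _ _).aestronglyMeasurable ?_
  filter_upwards [hPb t H] with u hu
  refine le_trans ?_ hu
  have : 0 ≤ cutPt lam Y * ‖pathPt (cutPt lam Y) i u - Real.log (cutPt lam Y)‖ :=
    mul_nonneg (by linarith [H.one_le]) (norm_nonneg _)
  exact le_mul_of_one_le_right (norm_nonneg _) (by linarith)

theorem exists_norm_afeRem_le {lam : ℝ} (h0 : 0 < lam) (h1 : lam < 1) :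
    ∃ C : ℝ, 0 < C ∧ ∀ (b t σ : ℝ) (Y : ℕ), AFEHyp b (cutPt lam Y) t σ →
      ‖afeRem b lam (cutPt lam Y) (σ + t * I)‖ ≤ C * cutPt lam Y ^ (σ - 1) := by
  obtain ⟨C, hC, hP⟩ := exists_path_majorant h0 h1
  refine ⟨3 * C, by positivity, fun b t σ Y H => ?_⟩
  have : ∀ i : Fin 3, ‖pathCoef i * ∫ u, linF b lam (σ + t * I) (pathPt (cutPt lam Y) i u)
      ∂pathMu (cutPt lam Y) i‖ ≤ C * cutPt lam Y ^ (σ - 1) := by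
    intro i
    obtain ⟨P, hPi, hPle, hPb⟩ := hP b σ Y H.one_le i
    rw [norm_mul, norm_pathCoef, one_mul]
    refine le_trans (norm_integral_le_of_norm_le hPi ?_) hPle
    filter_upwards [hPb t H] with u hu
    refine le_trans ?_ hu
    have : 0 ≤ cutPt lam Y * ‖pathPt (cutPt lam Y) i u - Real.log (cutPt lam Y)‖ :=
      mul_nonneg (by linarith [H.one_le]) (norm_nonneg _)
    exact le_mul_of_one_le_right (norm_nonneg _) (by linarith)
  calc _ ≤ ∑ _i : Fin 3, C * cutPt lam Y ^ (σ - 1) := norm_sum_le_of_le _ fun i _ => this i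
    _ = _ := by simp; ring

theorem tendsto_vertical_zero {lam : ℝ} (h0 : 0 < lam) (h1 : lam < 1) {b σ δ : ℝ} (hb : 0 < b)
    (hδ : 0 < δ) (hσ : 0 < σ) (t : ℝ) :
    Tendsto (fun x : ℝ => ∫ y in (-δ)..δ, linF b lam (σ + t * I) (x + y * I)) atBot (nhds 0) := by
  have hcp : 0 < ‖1 - unitPt lam‖ :=
    norm_pos_iff.mpr (sub_ne_zero.mpr (unitPt_ne_one h0 h1).symm)
  set c := ‖1 - unitPt lam‖ with hc
  have hlim : Tendsto (fun x : ℝ => Real.exp (σ * x) * Real.exp (b + |t| * δ) / (c / 2) *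
      |δ - -δ|) atBot (nhds 0) := by
    have h2 : Tendsto (fun x : ℝ => Real.exp (σ * x)) atBot (nhds 0) :=
      Real.tendsto_exp_atBot.comp (tendsto_id.const_mul_atBot hσ)
    simpa using ((h2.mul_const (Real.exp (b + |t| * δ))).div_const (c / 2)).mul_const |δ - -δ|
  have hsmall : ∀ᶠ x : ℝ in atBot, Real.exp x < min (c / 4) 1 :=
    Real.tendsto_exp_atBot.eventually_lt_const (by positivity)
  refine squeeze_zero_norm' ?_ hlim
  filter_upwards [hsmall] with x hx
  have hx1 : Real.exp x ≤ c / 4 := hx.le.trans (min_le_left _ _)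
  have hx2 : Real.exp x ≤ 1 := hx.le.trans (min_le_right _ _)
  refine intervalIntegral.norm_integral_le_of_norm_le_const fun y hy => ?_
  rw [Set.uIoc_of_le (by linarith)] at hy
  have hyd : |y| ≤ δ := abs_le.mpr ⟨hy.1.le, hy.2⟩
  have hD : c / 2 ≤ ‖lden lam (x + y * I)‖ :=
    norm_one_sub_mul_exp_ge_of_small (norm_unitPt lam) (by rw [norm_I_mul_cexp]; exact hx1)
  rw [linF, norm_div, norm_lnum]
  have : b * Real.exp x * Real.sin y - t * y ≤ b + |t| * δ := by
    have e1 : b * Real.exp x * Real.sin y ≤ b * 1 * 1 := by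
      have := Real.sin_le_one y
      have h5 : b * Real.exp x * Real.sin y ≤ b * Real.exp x * 1 := by gcongr
      have h6 : b * Real.exp x * 1 ≤ b * 1 * 1 := by gcongr
      linarith
    have e2 : -(t * y) ≤ |t| * δ := by
      refine (neg_le_abs _).trans ?_
      rw [abs_mul]; gcongr
    linarith
  gcongr

theorem lineInt_eq_sum_add_afeRem {lam : ℝ} (h0 : 0 < lam) (h1 : lam < 1) {b t σ : ℝ} {Y : ℕ}
    (hY : 1 ≤ Y) (H : AFEHyp b (cutPt lam Y) t σ) :
    lineInt b lam (1 / cutPt lam Y) (σ + t * I) =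
      2 * Real.pi * ∑ ν ∈ range Y,
        (freq lam ν : ℂ) ^ ((σ + t * I : ℂ) - 1) * cexp (-(I * b * freq lam ν)) +
      afeRem b lam (cutPt lam Y) (σ + t * I) := by
  have hi := integrable_linF_pathPt h0 h1 H
  set h := cutPt lam Y with hh
  have hp : 0 < h := by linarith [H.one_le]
  have hb : 0 < b := by linarith [H.le_b]
  have hσ : 0 < σ := by linarith [H.half_le]
  set δ := 1 / h with hδ
  have hδp : 0 < δ := by positivity
  have hδ1 : δ ≤ 1 := by rw [hδ, div_le_one hp]; exact H.one_le
  have hpi := Real.pi_gt_three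
  set s : ℂ := σ + t * I with hs
  have hsre : s.re = σ := by simp [hs]
  have hfull : Integrable fun u : ℝ => linF b lam s (u + (-δ : ℝ) * I) := by
    obtain ⟨C, hC, hbd⟩ := norm_lker_strip_le hb h0 h1 hδp (by linarith) s
    refine ((integrable_exp_mul_sub (hsre ▸ hσ : 0 < s.re) (mul_pos hb
      (Real.sin_pos_of_pos_of_lt_pi hδp (by linarith)))).const_mul C).mono'
      (continuous_linF_line h1 (by simpa using hδp.ne') (by linarith) (by linarith)
        b s).aestronglyMeasurable (Eventually.of_forall fun u => ?_)
    rw [linF, ← cexp_mul_lker]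
    exact hbd u (-δ) (by linarith) le_rfl
  have hlin : lineInt b lam δ s = (∫ u in Set.Iic (Real.log h), linF b lam s (u + (-δ : ℝ) * I)) +
      ∫ u in Set.Ioi (Real.log h), linF b lam s (u + (-δ : ℝ) * I) := by
    rw [intervalIntegral.integral_Iic_add_Ioi hfull.integrableOn hfull.integrableOn, lineInt]
    simp only [cexp_mul_lker]
    rfl
  have hleft : IntegrableOn (fun u : ℝ => linF b lam s (u + (δ : ℝ) * I)) (Set.Iic (Real.log h)) :=
    hi 0
  have T1 := intervalIntegral_tendsto_integral_Iic (Real.log h) hfull.integrableOn tendsto_id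
  have T2 := intervalIntegral_tendsto_integral_Iic (Real.log h) hleft tendsto_id
  have T3 := tendsto_vertical_zero h0 h1 hb hδp hσ t
  have T := (((T1.sub T2).add_const (I * ∫ y in (-δ)..δ, linF b lam s (Real.log h + y * I))).sub
    (T3.const_mul I))
  obtain ⟨Y', rfl⟩ : ∃ Y', Y = Y' + 1 := ⟨Y - 1, by omega⟩
  have hev : ∀ᶠ x : ℝ in atBot, rectInt (linF b lam s) x (Real.log h) δ =
      2 * Real.pi * ∑ ν ∈ range (Y' + 1),
        (freq lam ν : ℂ) ^ (s - 1) * cexp (-(I * b * freq lam ν)) := by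
    filter_upwards [eventually_lt_atBot (Real.log (freq lam 0))] with x hx
    exact rectInt_linF h0 h1 b s hδp (by linarith) hx Y'
  have hT := tendsto_nhds_unique (T.congr' (f₂ := fun _ => 2 * Real.pi * ∑ ν ∈ range (Y' + 1),
        (freq lam ν : ℂ) ^ (s - 1) * cexp (-(I * b * freq lam ν)))
        (by filter_upwards [hev] with x hx; rw [← hx]; rfl)) tendsto_const_nhds
  have hrem : afeRem b lam h s = (∫ u in Set.Iic (Real.log h), linF b lam s (u + (δ : ℝ) * I)) -
      I * (∫ y in (-δ)..δ, linF b lam s (Real.log h + y * I)) +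
      ∫ u in Set.Ioi (Real.log h), linF b lam s (u + (-δ : ℝ) * I) := by
    rw [afeRem, Fin.sum_univ_three, intervalIntegral.integral_of_le (by linarith)]
    simp only [pathCoef, pathMu, pathPt]
    simp [hδ]
    ring
  rw [hlin, hrem, ← hT]
  ring

theorem cutPt_eq (lam : ℝ) (Y : ℕ) : cutPt lam Y = 2 * Real.pi * (Y + lam - 1 / 2) := by
  unfold cutPt freq; ring

theorem natCast_le_cutPt {lam : ℝ} (h0 : 0 < lam) {Y : ℕ} (hY : 1 ≤ Y) :
    (Y : ℝ) ≤ cutPt lam Y := by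
  have hY' : (1 : ℝ) ≤ Y := by exact_mod_cast hY
  have := Real.pi_gt_three
  rw [cutPt_eq]
  nlinarith

theorem freq_lt_cutPt_of_lt {lam : ℝ} {ν Y : ℕ} (h : ν < Y) : freq lam ν < cutPt lam Y := by
  obtain ⟨Y, rfl⟩ : ∃ Y', Y = Y' + 1 := ⟨Y - 1, by omega⟩
  exact ((freq_mono lam).monotone (by omega : ν ≤ Y)).trans_lt (freq_lt_cutPt lam Y)

theorem freq_rpow_le {lam σ : ℝ} (h0 : 0 < lam) (hσ : σ ≤ 1) (ν : ℕ) :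
    freq lam ν ^ (σ - 1) ≤ ((ν : ℝ) + lam) ^ (-(1 - σ)) := by
  have hp := Real.pi_gt_three
  rw [freq, Real.mul_rpow (by positivity) (by positivity), neg_sub]
  exact mul_le_of_le_one_left (by positivity)
    (Real.rpow_le_one_of_one_le_of_nonpos (by linarith) (by linarith))

theorem sum_freq_rpow_le {lam : ℝ} (h0 : 0 < lam) (h1 : lam < 1) {σ : ℝ} (hσ : 1 / 2 ≤ σ) {Y : ℕ}
    (hY : 1 ≤ Y) :
    ∑ ν ∈ range Y, freq lam ν ^ (σ - 1) ≤ (lam⁻¹ + 2) * cutPt lam Y ^ σ := by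
  have hYh := natCast_le_cutPt h0 hY
  have hY' : (1 : ℝ) ≤ Y := by exact_mod_cast hY
  have hlam : 0 < lam⁻¹ := by positivity
  rcases lt_or_ge σ 1 with hs | hs
  · calc ∑ ν ∈ range Y, freq lam ν ^ (σ - 1)
        ≤ ∑ ν ∈ range Y, ((ν : ℝ) + lam) ^ (-(1 - σ)) :=
          sum_le_sum fun ν _ => freq_rpow_le h0 hs.le ν
      _ ≤ (lam ^ (-(1 - σ)) + 1 / (1 - (1 - σ))) * (Y : ℝ) ^ (1 - (1 - σ)) :=
          sum_rpow_neg_le (by linarith) (by linarith) h0 Y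
      _ ≤ (lam⁻¹ + 2) * cutPt lam Y ^ σ := by
          rw [sub_sub_cancel]
          gcongr
          · rw [← Real.rpow_neg_one]
            exact Real.rpow_le_rpow_of_exponent_ge h0 h1.le (by linarith)
          · rw [div_le_iff₀ (by linarith)]; linarith
  · have hh : 0 < cutPt lam Y := by linarith
    calc ∑ ν ∈ range Y, freq lam ν ^ (σ - 1)
        ≤ ∑ ν ∈ range Y, cutPt lam Y ^ (σ - 1) :=
          sum_le_sum fun ν hν => Real.rpow_le_rpow (freq_pos h0 ν).le
            (freq_lt_cutPt_of_lt (mem_range.mp hν)).le (by linarith)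
      _ = Y * cutPt lam Y ^ (σ - 1) := by simp
      _ ≤ cutPt lam Y * cutPt lam Y ^ (σ - 1) := by gcongr
      _ = 1 * cutPt lam Y ^ σ := by rw [Real.rpow_sub_one hh.ne']; field_simp
      _ ≤ _ := by gcongr; linarith

/-- The main terms of the approximate functional equation. -/
noncomputable def afeSum (b lam : ℝ) (Y : ℕ) (s : ℂ) : ℂ :=
  ∑ ν ∈ range Y, (freq lam ν : ℂ) ^ (s - 1) * cexp (-(I * b * freq lam ν))

theorem norm_afeTerm {lam : ℝ} (h0 : 0 < lam) (b σ t : ℝ) (ν : ℕ) :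
    ‖(freq lam ν : ℂ) ^ ((σ + t * I : ℂ) - 1) * cexp (-(I * b * freq lam ν))‖ =
      freq lam ν ^ (σ - 1) := by
  rw [norm_mul, norm_cpow_eq_rpow_re_of_pos (freq_pos h0 ν), norm_exp]
  simp

theorem exists_norm_lineInt_le {lam : ℝ} (h0 : 0 < lam) (h1 : lam < 1) :
    ∃ C : ℝ, 0 < C ∧ ∀ (b t σ : ℝ) (Y : ℕ), 1 ≤ Y → AFEHyp b (cutPt lam Y) t σ →
      ‖lineInt b lam (1 / cutPt lam Y) (σ + t * I)‖ ≤ C * cutPt lam Y ^ σ := by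
  obtain ⟨C, hC, hr⟩ := exists_norm_afeRem_le h0 h1
  refine ⟨2 * Real.pi * (lam⁻¹ + 2) + C, by positivity, fun b t σ Y hY H => ?_⟩
  rw [lineInt_eq_sum_add_afeRem h0 h1 hY H]
  refine (norm_add_le _ _).trans ?_
  have e1 : ‖∑ ν ∈ range Y, (freq lam ν : ℂ) ^ ((σ + t * I : ℂ) - 1) *
      cexp (-(I * b * freq lam ν))‖ ≤ (lam⁻¹ + 2) * cutPt lam Y ^ σ :=
    (norm_sum_le_of_le _ fun ν _ => (norm_afeTerm h0 b σ t ν).le).trans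
      (sum_freq_rpow_le h0 h1 H.half_le hY)
  have e2 : cutPt lam Y ^ (σ - 1) ≤ cutPt lam Y ^ σ :=
    Real.rpow_le_rpow_of_exponent_le H.one_le (by linarith)
  have e3 := hr b t σ Y H
  rw [norm_mul, show ‖(2 * Real.pi : ℂ)‖ = 2 * Real.pi by
    simp [abs_of_pos Real.pi_pos], add_mul, mul_assoc _ (lam⁻¹ + 2)]
  have := Real.pi_pos
  gcongr
  exact e3.trans (by gcongr)

/-- The range of parameters for a dyadic block `[T, 2T]` with tail parameter `b ≈ √T`. -/
structure DyadicHyp (T b : ℝ) : Prop where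
  le_T : 400 ≤ T
  sqrt_le : √T ≤ b
  le_sqrt : b ≤ √T + 2

namespace DyadicHyp

theorem twenty_le {T b : ℝ} (H : DyadicHyp T b) : 20 ≤ √T := by
  rw [show (20 : ℝ) = √400 by rw [show (400 : ℝ) = 20 ^ 2 by norm_num]; simp]
  exact Real.sqrt_le_sqrt H.le_T

theorem T_pos {T b : ℝ} (H : DyadicHyp T b) : 0 < T := by linarith [H.le_T]

theorem b_pos {T b : ℝ} (H : DyadicHyp T b) : 0 < b := by linarith [H.twenty_le, H.sqrt_le]

theorem sq_sqrt {T b : ℝ} (H : DyadicHyp T b) : √T * √T = T :=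
  Real.mul_self_sqrt H.T_pos.le

theorem cutPt_mul_bounds {T b lam t : ℝ} (H : DyadicHyp T b) (h0 : 0 < lam) (h1 : lam < 1) {Y : ℕ}
    (hY1 : 2 * Real.pi * b * Y ≤ t) (hY2 : t ≤ 2 * Real.pi * b * (Y + 1)) :
    |t - b * cutPt lam Y| ≤ 10 * b := by
  have hb := H.b_pos
  have hp := Real.pi_gt_three
  have hp' := Real.pi_lt_d2
  have hpb : 0 < Real.pi * b := by positivity
  have hpb' : Real.pi * b ≤ 3.15 * b := by gcongr
  have := mul_pos hpb h0
  have := mul_lt_mul_of_pos_left h1 hpb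
  rw [cutPt_eq, abs_le]
  constructor <;> nlinarith

theorem cutPt_le {T b lam t : ℝ} (H : DyadicHyp T b) (h0 : 0 < lam) (h1 : lam < 1) {Y : ℕ}
    (ht2 : t ≤ 2 * T) (hY1 : 2 * Real.pi * b * Y ≤ t) (hY2 : t ≤ 2 * Real.pi * b * (Y + 1)) :
    cutPt lam Y ≤ 2 * √T + 10 := by
  have hb := H.b_pos
  have h := (abs_le.mp (H.cutPt_mul_bounds h0 h1 hY1 hY2)).1
  have := H.sq_sqrt
  have h3 : b * cutPt lam Y ≤ b * (2 * √T + 10) := by nlinarith [H.sqrt_le, H.twenty_le]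
  exact le_of_mul_le_mul_left h3 hb

theorem le_cutPt {T b lam t : ℝ} (H : DyadicHyp T b) (h0 : 0 < lam) (h1 : lam < 1) {Y : ℕ}
    (ht1 : T ≤ t) (hY1 : 2 * Real.pi * b * Y ≤ t) (hY2 : t ≤ 2 * Real.pi * b * (Y + 1)) :
    √T - 12 ≤ cutPt lam Y := by
  have hb := H.b_pos
  have h := (abs_le.mp (H.cutPt_mul_bounds h0 h1 hY1 hY2)).2
  have := H.sq_sqrt
  have h3 : b * (√T - 12) ≤ b * cutPt lam Y := by nlinarith [H.le_sqrt, H.twenty_le]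
  exact le_of_mul_le_mul_left h3 hb

theorem afeHyp {T b lam t σ : ℝ} (H : DyadicHyp T b) (h0 : 0 < lam) (h1 : lam < 1) {Y : ℕ}
    (ht1 : T ≤ t) (ht2 : t ≤ 2 * T) (hY1 : 2 * Real.pi * b * Y ≤ t)
    (hY2 : t ≤ 2 * Real.pi * b * (Y + 1)) (hσ : σ ∈ Set.Icc (1 / 2 : ℝ) 2) :
    AFEHyp b (cutPt lam Y) t σ := by
  have e1 := H.cutPt_le h0 h1 ht2 hY1 hY2
  have e2 := H.le_cutPt h0 h1 ht1 hY1 hY2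
  have e3 := H.twenty_le
  exact ⟨by linarith, by linarith [H.sqrt_le], by linarith [H.le_sqrt],
    H.cutPt_mul_bounds h0 h1 hY1 hY2, hσ.1, hσ.2⟩

theorem one_le_of_le {T b t : ℝ} (H : DyadicHyp T b) {Y : ℕ}
    (ht1 : T ≤ t) (hY2 : t ≤ 2 * Real.pi * b * (Y + 1)) : 1 ≤ Y := by
  by_contra hY
  obtain rfl : Y = 0 := by omega
  have hb := H.b_pos
  have hp' := Real.pi_lt_d2
  have hpb' : Real.pi * b ≤ 3.15 * b := by gcongr
  have := H.sq_sqrt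
  push_cast at hY2
  nlinarith [H.le_sqrt, H.twenty_le]

end DyadicHyp

theorem norm_zetaL_eq {b lam δ : ℝ} (hb : 0 < b) (h0 : 0 < lam) (h1 : lam < 1) (hδ : 0 < δ)
    (hδ2 : δ ≤ Real.pi / 2) {σ : ℝ} (hσ : 0 < σ) (t : ℝ) :
    ‖zetaL b lam (σ + t * I)‖ = Real.exp (-(Real.pi * t / 2)) * ‖lineInt b lam δ (σ + t * I)‖ /
      ‖Gamma (σ + t * I)‖ := by
  rw [zetaL_eq_lineInt hb h0 h1 hδ hδ2 (by simpa using hσ), norm_div, norm_mul, norm_exp]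
  congr 3
  simp
  ring

theorem exists_norm_zetaL_le {lam : ℝ} (h0 : 0 < lam) (h1 : lam < 1) :
    ∃ C : ℝ, 0 < C ∧ ∀ T b : ℝ, DyadicHyp T b → ∀ t ∈ Set.Icc T (2 * T),
      ∀ σ ∈ Set.Icc (1 / 2 : ℝ) 2, ‖zetaL b lam (σ + t * I)‖ ≤ C * √T * b ^ (-σ) := by
  obtain ⟨C, hC, hZ⟩ := exists_norm_lineInt_le h0 h1
  obtain ⟨c, hc, hG⟩ := exists_norm_Gamma_lower
  refine ⟨C / c * 16, by positivity, fun T b H t ht σ hσ => ?_⟩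
  have hb := H.b_pos
  have hT := H.T_pos
  have hS := H.twenty_le
  have hpi := Real.pi_gt_three
  have ht0 : 0 < t := hT.trans_le ht.1
  set Y := ⌊t / (2 * Real.pi * b)⌋₊ with hY
  have hq : 0 < 2 * Real.pi * b := by positivity
  have hY1 : 2 * Real.pi * b * Y ≤ t := by
    rw [mul_comm, ← le_div_iff₀ hq]; exact Nat.floor_le (by positivity)
  have hY2 : t ≤ 2 * Real.pi * b * (Y + 1) := by
    rw [mul_comm, ← div_le_iff₀ hq]; exact (Nat.lt_floor_add_one _).le
  have hA := H.afeHyp h0 h1 ht.1 ht.2 hY1 hY2 hσ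
  have hYone := H.one_le_of_le ht.1 hY2
  have e1 := hZ b t σ Y hYone hA
  have hle := H.cutPt_le h0 h1 ht.2 hY1 hY2
  have hp : 0 < cutPt lam Y := by linarith [hA.one_le]
  have e2 := hG σ t (by linarith [ht.1, H.le_T]) hσ
  rw [norm_zetaL_eq hb h0 h1 (δ := 1 / cutPt lam Y) (by positivity)
    ((div_le_one hp).mpr hA.one_le |>.trans (by linarith)) (by linarith [hσ.1])]
  have e3 : cutPt lam Y ^ σ ≤ 16 * (√T ^ (2 * σ) * b ^ (-σ)) := by
    have : cutPt lam Y * b ≤ 4 * √T ^ 2 := by nlinarith [H.le_sqrt, H.sqrt_le]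
    calc cutPt lam Y ^ σ = (cutPt lam Y * b) ^ σ * b ^ (-σ) := by
          rw [Real.mul_rpow hp.le hb.le, mul_assoc, ← Real.rpow_add hb]; simp
      _ ≤ (4 * √T ^ 2) ^ σ * b ^ (-σ) := by gcongr; linarith [hσ.1]
      _ = 4 ^ σ * (√T ^ (2 * σ) * b ^ (-σ)) := by
          rw [Real.mul_rpow (by positivity) (by positivity), ← Real.rpow_natCast,
            ← Real.rpow_mul (by positivity)]
          push_cast; ring
      _ ≤ _ := by
          gcongr
          calc (4 : ℝ) ^ σ ≤ 4 ^ (2 : ℝ) := by gcongr; exacts [by norm_num, hσ.2]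
            _ = 16 := by norm_num
  have e4 : t ^ (σ - 1 / 2) ≥ T ^ (σ - 1 / 2) := by
    gcongr; exacts [by linarith [hσ.1], ht.1]
  have e5 : √T ^ (2 * σ) = √T * T ^ (σ - 1 / 2) := by
    rw [Real.sqrt_eq_rpow, ← Real.rpow_mul hT.le, ← Real.rpow_add hT]; congr 1; ring
  calc Real.exp (-(Real.pi * t / 2)) * ‖lineInt b lam (1 / cutPt lam Y) (σ + t * I)‖ /
      ‖Gamma (σ + t * I)‖
      ≤ Real.exp (-(Real.pi * t / 2)) * (C * (16 * (√T ^ (2 * σ) * b ^ (-σ)))) /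
        (c * (T ^ (σ - 1 / 2) * Real.exp (-(Real.pi * t / 2)))) := by
        gcongr
        · exact e1.trans (by gcongr)
        · exact le_trans (by gcongr) e2
    _ = _ := by
        rw [e5]
        have := Real.exp_pos (-(Real.pi * t / 2))
        have := Real.rpow_pos_of_pos hT (σ - 1 / 2)
        field_simp

theorem integrable_oscillatory {μ : Measure ℝ} [SFinite μ] {W Φ : ℝ → ℂ} (hW : Measurable W)
    (hΦ : Measurable Φ) {t₁ t₂ : ℝ} {P : ℝ → ℝ} (hP : Integrable P μ) (l : ℝ)
    (hb : ∀ t ∈ Set.Icc t₁ t₂, ∀ᵐ u ∂μ, ‖cexp (I * t * W u) * Φ u‖ ≤ P u) :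
    Integrable (Function.uncurry fun (t u : ℝ) =>
      cexp (I * t * W u) * Φ u * cexp (-(I * t * l)))
      ((volume.restrict (Set.Ioc t₁ t₂)).prod μ) := by
  have hnl : ∀ t : ℝ, ‖cexp (-(I * t * l))‖ = 1 := by intro t; rw [norm_exp]; simp
  have hmeas : Measurable (Function.uncurry fun (t u : ℝ) =>
      cexp (I * t * W u) * Φ u * cexp (-(I * t * l))) := by
    unfold Function.uncurry; fun_prop
  rw [integrable_prod_iff hmeas.aestronglyMeasurable]
  constructor
  · refine (ae_restrict_mem measurableSet_Ioc).mono fun t ht => ?_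
    refine hP.mono' (by fun_prop) ?_
    filter_upwards [hb t ⟨ht.1.le, ht.2⟩] with u hu
    simpa [Function.uncurry, hnl] using hu
  · refine Integrable.mono' (integrable_const (∫ u, P u ∂μ))
      hmeas.aestronglyMeasurable.norm.integral_prod_right' ?_
    refine (ae_restrict_mem measurableSet_Ioc).mono fun t ht => ?_
    rw [Real.norm_of_nonneg (integral_nonneg fun _ => norm_nonneg _)]
    refine integral_mono_of_nonneg (Eventually.of_forall fun _ => norm_nonneg _) hP ?_
    filter_upwards [hb t ⟨ht.1.le, ht.2⟩] with u hu
    simpa [Function.uncurry, hnl] using hu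

theorem intervalIntegrable_oscillatory {μ : Measure ℝ} [SFinite μ] {W Φ : ℝ → ℂ}
    (hW : Measurable W) (hΦ : Measurable Φ) {t₁ t₂ : ℝ} (ht : t₁ ≤ t₂) {P : ℝ → ℝ}
    (hP : Integrable P μ) (l : ℝ)
    (hb : ∀ t ∈ Set.Icc t₁ t₂, ∀ᵐ u ∂μ, ‖cexp (I * t * W u) * Φ u‖ ≤ P u) :
    IntervalIntegrable (fun t : ℝ => (∫ u, cexp (I * t * W u) * Φ u ∂μ) * cexp (-(I * t * l)))
      volume t₁ t₂ := by
  rw [intervalIntegrable_iff_integrableOn_Ioc_of_le ht]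
  simp only [← integral_mul_const]
  exact (integrable_oscillatory hW hΦ hP l hb).integral_prod_left

theorem norm_integral_oscillatory_le {μ : Measure ℝ} [SFinite μ] {W Φ : ℝ → ℂ} (hW : Measurable W)
    (hΦ : Measurable Φ) {t₁ t₂ : ℝ} (ht : t₁ ≤ t₂) {P : ℝ → ℝ} (hP : Integrable P μ) {l L : ℝ}
    (hL : 0 < L) (hWl : ∀ᵐ u ∂μ, W u ≠ l)
    (hb : ∀ t ∈ Set.Icc t₁ t₂, ∀ᵐ u ∂μ, ‖cexp (I * t * W u) * Φ u‖ ≤ P u)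
    (hb' : ∀ t ∈ Set.Icc t₁ t₂, ∀ᵐ u ∂μ, ‖cexp (I * t * W u) * Φ u‖ * L ≤ P u * ‖W u - l‖) :
    ‖∫ t in t₁..t₂, (∫ u, cexp (I * t * W u) * Φ u ∂μ) * cexp (-(I * t * l))‖ ≤
      2 * (∫ u, P u ∂μ) / L := by
  have hnl : ∀ t : ℝ, ‖cexp (-(I * t * l))‖ = 1 := by intro t; rw [norm_exp]; simp
  have hint := integrable_oscillatory hW hΦ hP l hb
  rw [intervalIntegral.integral_of_le ht]
  simp only [← integral_mul_const]
  rw [integral_integral_swap hint, mul_div_right_comm, ← integral_const_mul]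
  refine norm_integral_le_of_norm_le (hP.const_mul _) ?_
  filter_upwards [hWl, hb' t₁ ⟨le_rfl, ht⟩, hb' t₂ ⟨ht, le_rfl⟩] with u h0 h1 h2
  have hk : I * (W u - l) ≠ 0 := mul_ne_zero I_ne_zero (sub_ne_zero.mpr h0)
  have hkp : 0 < ‖W u - l‖ := norm_pos_iff.mpr (sub_ne_zero.mpr h0)
  have e : (∫ t in Set.Ioc t₁ t₂, cexp (I * t * W u) * Φ u * cexp (-(I * t * l))) =
      (cexp (I * t₂ * W u) * Φ u * cexp (-(I * t₂ * l)) -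
        cexp (I * t₁ * W u) * Φ u * cexp (-(I * t₁ * l))) / (I * (W u - l)) := by
    rw [← intervalIntegral.integral_of_le ht]
    have : ∀ t : ℝ, cexp (I * t * W u) * Φ u * cexp (-(I * t * l)) =
        Φ u * cexp (I * (W u - l) * t) := by
      intro t
      rw [mul_comm _ (Φ u), mul_assoc, ← Complex.exp_add]; congr 2; ring
    simp only [this]
    rw [intervalIntegral.integral_const_mul, integral_exp_mul_complex hk]
    ring
  rw [e, norm_div, norm_mul, norm_I, one_mul, div_le_iff₀ hkp]
  refine (norm_sub_le _ _).trans ?_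
  rw [norm_mul _ (cexp (-(I * t₁ * l))), norm_mul _ (cexp (-(I * t₂ * l))), hnl, hnl, mul_one,
    mul_one, div_mul_eq_mul_div, div_mul_eq_mul_div, le_div_iff₀ hL]
  linarith

theorem linF_add_mul_I (b lam σ t : ℝ) (w : ℂ) :
    linF b lam (σ + t * I) w = cexp (I * t * w) * linF b lam σ w := by
  simp only [linF, lnum]
  rw [← mul_div_assoc, add_mul, Complex.exp_add, mul_comm (t : ℂ) I]
  ring

theorem log_ratio_le_dist_path {h q : ℝ} (hq : 0 < q) (hqh : q < h) (i : Fin 3) (u : ℝ) :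
    Real.log (h / q) ≤ ‖pathPt h i u - Real.log q‖ * (1 + h * ‖pathPt h i u - Real.log h‖) := by
  have hh : 0 < h := hq.trans hqh
  have hL : 0 < Real.log (h / q) := Real.log_pos ((one_lt_div hq).mpr hqh)
  have hlog : Real.log (h / q) = Real.log h - Real.log q := Real.log_div hh.ne' hq.ne'
  have tri : Real.log (h / q) ≤
      ‖pathPt h i u - Real.log q‖ + ‖pathPt h i u - Real.log h‖ := by
    have : ‖((Real.log (h / q) : ℝ) : ℂ)‖ = Real.log (h / q) := by simp [abs_of_pos hL]
    rw [← this, hlog]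
    push_cast
    rw [show (Real.log h - Real.log q : ℂ) =
      (pathPt h i u - Real.log q) - (pathPt h i u - Real.log h) by ring]
    exact norm_sub_le _ _
  have hray : |(pathPt h i u - Real.log q).im| = 1 / h →
      Real.log (h / q) ≤
        ‖pathPt h i u - Real.log q‖ * (1 + h * ‖pathPt h i u - Real.log h‖) := by
    intro hi
    have h1 : 1 / h ≤ ‖pathPt h i u - Real.log q‖ := hi ▸ abs_im_le_norm _
    rw [div_le_iff₀ hh] at h1
    nlinarith [norm_nonneg (pathPt h i u - Real.log h), norm_nonneg (pathPt h i u - Real.log q)]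
  fin_cases i
  · refine hray ?_
    simp [pathPt, abs_of_pos hh]
  · have h1 : Real.log (h / q) ≤ ‖pathPt h 1 u - Real.log q‖ := by
      refine le_trans ?_ (abs_re_le_norm _)
      rw [hlog]
      simp [pathPt, le_abs_self]
    refine h1.trans (le_mul_of_one_le_right (norm_nonneg _) ?_)
    have := mul_nonneg hh.le (norm_nonneg (pathPt h 1 u - Real.log h))
    exact le_add_of_nonneg_right this
  · refine hray ?_
    simp [pathPt, abs_of_pos hh]

theorem pathPt_ne_log {h q : ℝ} (hq : 0 < q) (hqh : q < h) (i : Fin 3) (u : ℝ) :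
    pathPt h i u ≠ Real.log q := by
  intro he
  have := log_ratio_le_dist_path hq hqh i u
  rw [he] at this
  simp only [sub_self, norm_zero, zero_mul] at this
  exact absurd this (not_le.mpr (Real.log_pos ((one_lt_div hq).mpr hqh)))

theorem exists_norm_integral_afeRem_mul_le {lam : ℝ} (h0 : 0 < lam) (h1 : lam < 1) :
    ∃ C : ℝ, 0 < C ∧ ∀ (b σ t₁ t₂ : ℝ) (Y : ℕ), t₁ ≤ t₂ →
      (∀ t ∈ Set.Icc t₁ t₂, AFEHyp b (cutPt lam Y) t σ) → ∀ ν < Y,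
      ‖∫ t in t₁..t₂, afeRem b lam (cutPt lam Y) (σ + t * I) *
        cexp (-(I * t * Real.log (freq lam ν)))‖ ≤
        C * cutPt lam Y ^ (σ - 1) / Real.log (cutPt lam Y / freq lam ν) := by
  obtain ⟨C, hC, hP⟩ := exists_path_majorant h0 h1
  refine ⟨6 * C, by positivity, fun b σ t₁ t₂ Y ht H ν hν => ?_⟩
  have hq := freq_pos h0 ν
  have hqh := freq_lt_cutPt_of_lt (lam := lam) hν
  set h := cutPt lam Y with hh
  set L := Real.log (h / freq lam ν) with hLdef
  have hL : 0 < L := Real.log_pos ((one_lt_div hq).mpr hqh)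
  have hone : 1 ≤ h := (H t₁ ⟨le_rfl, ht⟩).one_le
  have key : ∀ i : Fin 3, IntervalIntegrable (fun t : ℝ =>
      (∫ u, cexp (I * t * pathPt h i u) * linF b lam σ (pathPt h i u) ∂pathMu h i) *
        cexp (-(I * t * Real.log (freq lam ν)))) volume t₁ t₂ ∧ ‖∫ t in t₁..t₂,
      (∫ u, cexp (I * t * pathPt h i u) * linF b lam σ (pathPt h i u) ∂pathMu h i) *
        cexp (-(I * t * Real.log (freq lam ν)))‖ ≤ 2 * (C * h ^ (σ - 1)) / L := by
    intro i
    obtain ⟨P, hPi, hPle, hPb⟩ := hP b σ Y hone i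
    have hm := (continuous_pathPt h i).measurable
    have hm' := measurable_linF_pathPt b lam h σ i
    have hb1 : ∀ t ∈ Set.Icc t₁ t₂, ∀ᵐ u ∂pathMu h i,
        ‖cexp (I * t * pathPt h i u) * linF b lam σ (pathPt h i u)‖ ≤ P u := by
      intro t ht
      filter_upwards [hPb t (H t ht)] with u hu
      rw [← linF_add_mul_I]
      refine le_trans ?_ hu
      have : 0 ≤ h * ‖pathPt h i u - Real.log h‖ := by positivity
      exact le_mul_of_one_le_right (norm_nonneg _) (by linarith)
    refine ⟨intervalIntegrable_oscillatory hm hm' ht hPi _ hb1,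
      (norm_integral_oscillatory_le hm hm' ht hPi hL
        (Eventually.of_forall fun u => pathPt_ne_log hq hqh i u) hb1 ?_).trans (by gcongr)⟩
    intro t ht
    filter_upwards [hPb t (H t ht)] with u hu
    rw [← linF_add_mul_I]
    have h3 := log_ratio_le_dist_path hq hqh i u
    calc _ ≤ ‖linF b lam (σ + t * I) (pathPt h i u)‖ *
          (‖pathPt h i u - Real.log (freq lam ν)‖ *
            (1 + h * ‖pathPt h i u - Real.log h‖)) := by gcongr
      _ = (‖linF b lam (σ + t * I) (pathPt h i u)‖ *
            (1 + h * ‖pathPt h i u - Real.log h‖)) *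
            ‖pathPt h i u - Real.log (freq lam ν)‖ := by ring
      _ ≤ _ := by gcongr
  simp only [afeRem, linF_add_mul_I, sum_mul, mul_assoc (pathCoef _)]
  rw [intervalIntegral.integral_finsetSum fun i _ => (key i).1.const_mul _]
  simp only [intervalIntegral.integral_const_mul]
  calc _ ≤ ∑ _i : Fin 3, 2 * (C * h ^ (σ - 1)) / L := norm_sum_le_of_le _ fun i _ => by
        rw [norm_mul, norm_pathCoef, one_mul]; exact (key i).2
    _ = _ := by simp; ring

theorem afeTerm_eq {lam : ℝ} (h0 : 0 < lam) (b σ t : ℝ) (ν : ℕ) :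
    (freq lam ν : ℂ) ^ ((σ + t * I : ℂ) - 1) * cexp (-(I * b * freq lam ν)) =
      ((freq lam ν ^ (σ - 1) : ℝ) : ℂ) *
        cexp (I * ((t * Real.log (freq lam ν) - b * freq lam ν : ℝ) : ℂ)) := by
  have hq := freq_pos h0 ν
  have hq' : (freq lam ν : ℂ) ≠ 0 := by exact_mod_cast hq.ne'
  rw [ofReal_cpow hq.le, cpow_def_of_ne_zero hq', cpow_def_of_ne_zero hq', ← ofReal_log hq.le,
    ← Complex.exp_add, ← Complex.exp_add]
  congr 1
  push_cast
  ring

theorem conj_afeSum {lam : ℝ} (h0 : 0 < lam) (b σ t : ℝ) (Y : ℕ) :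
    (starRingEnd ℂ) (afeSum b lam Y (σ + t * I)) =
      ∑ ν ∈ range Y, (((freq lam ν ^ (σ - 1) : ℝ) : ℂ) * cexp (I * (b * freq lam ν))) *
        cexp (-(I * t * Real.log (freq lam ν))) := by
  rw [afeSum, map_sum]
  refine sum_congr rfl fun ν _ => ?_
  rw [afeTerm_eq h0, map_mul, conj_ofReal, ← exp_conj, mul_assoc, ← Complex.exp_add, map_mul, conj_I,
    conj_ofReal]
  congr 2
  push_cast
  ring

theorem continuous_afeSum {lam : ℝ} (h0 : 0 < lam) (b σ : ℝ) (Y : ℕ) :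
    Continuous fun t : ℝ => afeSum b lam Y (σ + t * I) := by
  unfold afeSum
  simp only [afeTerm_eq h0]
  fun_prop

theorem continuous_zetaL {b lam : ℝ} (hb : 0 < b) (h0 : 0 < lam) (h1 : lam < 1) {σ : ℝ}
    (hσ : 0 < σ) : Continuous fun t : ℝ => zetaL b lam (σ + t * I) := by
  refine (differentiableOn_zetaL hb h0 h1).continuousOn.comp_continuous (by fun_prop) fun t => ?_
  simpa using hσ

theorem continuous_lineInt {b lam δ : ℝ} (hb : 0 < b) (h0 : 0 < lam) (h1 : lam < 1) (hδ : 0 < δ)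
    (hδ2 : δ ≤ Real.pi / 2) {σ : ℝ} (hσ : 0 < σ) :
    Continuous fun t : ℝ => lineInt b lam δ (σ + t * I) := by
  have hre : ∀ t : ℝ, 0 < (σ + t * I : ℂ).re := fun t => by simpa using hσ
  have hG : Continuous fun t : ℝ => Gamma (σ + t * I) := by
    refine continuous_iff_continuousAt.mpr fun t => ?_
    refine ContinuousAt.comp (g := Gamma) (f := fun t : ℝ => (σ + t * I : ℂ)) ?_ (by fun_prop)
    refine (differentiableAt_Gamma _ fun m hm => ?_).continuousAt
    have := hre t
    rw [hm] at this
    simp at this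
    linarith [(Nat.cast_nonneg m : (0 : ℝ) ≤ m)]
  have : (fun t : ℝ => lineInt b lam δ (σ + t * I)) = fun t : ℝ =>
      zetaL b lam (σ + t * I) * Gamma (σ + t * I) * cexp (-(I * Real.pi * (σ + t * I) / 2)) := by
    funext t
    rw [zetaL_eq_lineInt hb h0 h1 hδ hδ2 (hre t),
      div_mul_cancel₀ _ (Gamma_ne_zero_of_re_pos (hre t)), mul_right_comm, ← Complex.exp_add]
    simp
  rw [this]
  exact ((continuous_zetaL hb h0 h1 hσ).mul hG).mul (by fun_prop)

theorem norm_sq_two_pi_add (B ρ : ℂ) :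
    ‖2 * Real.pi * B + ρ‖ ^ 2 / (2 * Real.pi) = 2 * Real.pi * ‖B‖ ^ 2 +
      2 * (ρ * (starRingEnd ℂ) B).re + ‖ρ‖ ^ 2 / (2 * Real.pi) := by
  have := Real.pi_pos
  rw [Complex.sq_norm, Complex.sq_norm, Complex.sq_norm, normSq_apply, normSq_apply, normSq_apply]
  simp
  field_simp
  ring

theorem exists_sum_freq_div_log_le {lam : ℝ} (h0 : 0 < lam) {σ : ℝ} (hσ0 : 0 < σ)
    (hσ : σ < 1) :
    ∃ C : ℝ, 0 < C ∧ ∀ Y : ℕ, 1 ≤ Y → 1 ≤ cutPt lam Y →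
      ∑ ν ∈ range Y, freq lam ν ^ (σ - 1) / Real.log (cutPt lam Y / freq lam ν) ≤
        C * cutPt lam Y ^ σ * (3 + Real.log (cutPt lam Y)) := by
  obtain ⟨C, hC, hS⟩ := sum_rpow_div_log_le (α := 1 - σ) (by linarith) (by linarith) h0
  refine ⟨C, hC, fun Y hY hh => ?_⟩
  have hY' : (1 : ℝ) ≤ Y := by exact_mod_cast hY
  have hpi := Real.pi_gt_three
  have hX : 0 < (Y : ℝ) + lam - 1 / 2 := by linarith
  have hXh : (Y : ℝ) + lam - 1 / 2 ≤ cutPt lam Y := by rw [cutPt_eq]; nlinarith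
  obtain ⟨-, h⟩ := hS Y (Y + lam - 1 / 2) (by linarith) (by linarith)
  have hlogY : 0 ≤ 3 + Real.log ((Y : ℝ) + lam - 1 / 2) := by
    have : -Real.log 2 ≤ Real.log ((Y : ℝ) + lam - 1 / 2) := by
      rw [← Real.log_inv]; exact Real.log_le_log (by norm_num) (by norm_num; linarith)
    linarith [Real.log_two_lt_d9]
  calc _ ≤ ∑ ν ∈ range Y, ((ν : ℝ) + lam) ^ (-(1 - σ)) /
        Real.log (((Y : ℝ) + lam - 1 / 2) / (ν + lam)) := by
        refine sum_le_sum fun ν hν => ?_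
        have hν' := freq_lt_cutPt_of_lt (lam := lam) (mem_range.mp hν)
        have hq := freq_pos h0 ν
        have hlt : 0 < Real.log (cutPt lam Y / freq lam ν) :=
          Real.log_pos ((one_lt_div hq).mpr hν')
        have e : cutPt lam Y / freq lam ν = ((Y : ℝ) + lam - 1 / 2) / (ν + lam) := by
          rw [cutPt_eq, freq, mul_div_mul_left _ _ (by positivity)]
        rw [← e]
        gcongr
        exact freq_rpow_le h0 hσ.le ν
    _ ≤ _ := h
    _ ≤ _ := by rw [sub_sub_cancel]; gcongr

theorem norm_integral_afeRem_mul_conj_le {lam : ℝ} (h0 : 0 < lam) (h1 : lam < 1) {σ : ℝ}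
    (hσ0 : 0 < σ) (hσ : σ < 1) :
    ∃ C : ℝ, 0 < C ∧ ∀ (b t₁ t₂ : ℝ) (Y : ℕ), 1 ≤ Y → t₁ ≤ t₂ →
      (∀ t ∈ Set.Icc t₁ t₂, AFEHyp b (cutPt lam Y) t σ) →
      ‖∫ t in t₁..t₂, (lineInt b lam (1 / cutPt lam Y) (σ + t * I) -
          2 * Real.pi * afeSum b lam Y (σ + t * I)) *
        (starRingEnd ℂ) (afeSum b lam Y (σ + t * I))‖ ≤
        C * cutPt lam Y ^ (2 * σ - 1) * (3 + Real.log (cutPt lam Y)) := by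
  obtain ⟨C1, hC1, H1⟩ := exists_norm_integral_afeRem_mul_le h0 h1
  obtain ⟨C2, hC2, H2⟩ := exists_sum_freq_div_log_le h0 hσ0 hσ
  refine ⟨C1 * C2, by positivity, fun b t₁ t₂ Y hY ht H => ?_⟩
  have hA := H t₁ ⟨le_rfl, ht⟩
  have hone := hA.one_le
  have hh : 0 < cutPt lam Y := by linarith
  have hb : 0 < b := by linarith [hA.le_b]
  have hpi := Real.pi_gt_three
  have hcρ : Continuous fun t : ℝ => lineInt b lam (1 / cutPt lam Y) (σ + t * I) -
      2 * Real.pi * afeSum b lam Y (σ + t * I) :=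
    (continuous_lineInt hb h0 h1 (by positivity)
      ((div_le_one hh).mpr hone |>.trans (by linarith)) hσ0).sub
      (continuous_const.mul (continuous_afeSum h0 b σ Y))
  have hρ : ∀ t ∈ Set.uIcc t₁ t₂, lineInt b lam (1 / cutPt lam Y) (σ + t * I) -
      2 * Real.pi * afeSum b lam Y (σ + t * I) = afeRem b lam (cutPt lam Y) (σ + t * I) := by
    intro t ht'
    rw [Set.uIcc_of_le ht] at ht'
    rw [lineInt_eq_sum_add_afeRem h0 h1 hY (H t ht'), afeSum, add_sub_cancel_left]
  simp only [conj_afeSum h0, mul_sum]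
  rw [intervalIntegral.integral_finsetSum]
  swap
  · exact fun ν _ => (hcρ.mul (by fun_prop)).intervalIntegrable _ _
  have key : ∀ ν ∈ range Y, ‖∫ t in t₁..t₂, (lineInt b lam (1 / cutPt lam Y) (σ + t * I) -
      2 * Real.pi * afeSum b lam Y (σ + t * I)) *
      ((((freq lam ν ^ (σ - 1) : ℝ) : ℂ) * cexp (I * (b * freq lam ν))) *
        cexp (-(I * t * Real.log (freq lam ν))))‖ ≤
      C1 * cutPt lam Y ^ (σ - 1) *
        (freq lam ν ^ (σ - 1) / Real.log (cutPt lam Y / freq lam ν)) := by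
    intro ν hν
    have hq := freq_pos h0 ν
    rw [intervalIntegral.integral_congr (g := fun t : ℝ =>
      (((freq lam ν ^ (σ - 1) : ℝ) : ℂ) * cexp (I * (b * freq lam ν))) *
      (afeRem b lam (cutPt lam Y) (σ + t * I) * cexp (-(I * t * Real.log (freq lam ν)))))
      fun t ht' => by
        rw [hρ t ht']; ring, intervalIntegral.integral_const_mul, norm_mul, norm_mul,
      norm_real, Real.norm_of_nonneg (by positivity), norm_exp]
    have hre : (I * (b * freq lam ν : ℂ)).re = 0 := by simp
    rw [hre, Real.exp_zero, mul_one]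
    calc _ ≤ freq lam ν ^ (σ - 1) * (C1 * cutPt lam Y ^ (σ - 1) /
          Real.log (cutPt lam Y / freq lam ν)) := by
          gcongr; exact H1 b σ t₁ t₂ Y ht H ν (mem_range.mp hν)
      _ = _ := by ring
  refine (norm_sum_le_of_le _ key).trans ?_
  rw [← mul_sum]
  calc _ ≤ C1 * cutPt lam Y ^ (σ - 1) *
        (C2 * cutPt lam Y ^ σ * (3 + Real.log (cutPt lam Y))) := by
        gcongr; exact H2 Y hY hone
    _ = _ := by
        rw [show 2 * σ - 1 = (σ - 1) + σ by ring, Real.rpow_add hh]; ring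

theorem sq_norm_zetaL_eq {b lam δ : ℝ} (hb : 0 < b) (h0 : 0 < lam) (h1 : lam < 1) (hδ : 0 < δ)
    (hδ2 : δ ≤ Real.pi / 2) {σ : ℝ} (hσ : 0 < σ) (t : ℝ) :
    t ^ (2 * σ - 1) * ‖zetaL b lam (σ + t * I)‖ ^ 2 =
      t ^ (2 * σ - 1) * Real.exp (-(Real.pi * t)) / ‖Gamma (σ + t * I)‖ ^ 2 *
        ‖lineInt b lam δ (σ + t * I)‖ ^ 2 := by
  rw [norm_zetaL_eq hb h0 h1 hδ hδ2 hσ, div_pow, mul_pow, ← Real.exp_nat_mul]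
  rw [show ((2 : ℕ) : ℝ) * -(Real.pi * t / 2) = -(Real.pi * t) by push_cast; ring]
  ring

theorem DyadicHyp.rpow_cutPt_bounds {T b lam t σ : ℝ} (H : DyadicHyp T b) (h0 : 0 < lam)
    (h1 : lam < 1) {Y : ℕ} (ht1 : T ≤ t) (ht2 : t ≤ 2 * T) (hY1 : 2 * Real.pi * b * Y ≤ t)
    (hY2 : t ≤ 2 * Real.pi * b * (Y + 1)) (hσ0 : 1 / 2 < σ) (hσ : σ < 1) :
    cutPt lam Y ^ (2 * σ) ≤ 9 * T ^ σ ∧ cutPt lam Y ^ (2 * (σ - 1)) ≤ 7 * T ^ (σ - 1) ∧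
      cutPt lam Y ^ (2 * σ - 1) ≤ 3 * T ^ (σ - 1 / 2) ∧
      3 + Real.log (cutPt lam Y) ≤ 2 * Real.log T := by
  have hT := H.T_pos
  have hS := H.twenty_le
  have hS0 : 0 < √T := by linarith
  have e1 : cutPt lam Y ≤ 3 * √T := by linarith [H.cutPt_le h0 h1 ht2 hY1 hY2]
  have e2 : 2 / 5 * √T ≤ cutPt lam Y := by linarith [H.le_cutPt h0 h1 ht1 hY1 hY2]
  have hh : 0 < cutPt lam Y := by linarith
  have hpow : ∀ p : ℝ, √T ^ p = T ^ (p / 2) := by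
    intro p; rw [Real.sqrt_eq_rpow, ← Real.rpow_mul hT.le]; congr 1; ring
  have hlogT : 3 ≤ Real.log T := by
    rw [Real.le_log_iff_exp_le hT]
    have : Real.exp 3 = Real.exp 1 ^ 3 := by rw [← Real.exp_nat_mul]; norm_num
    have h2 := Real.exp_one_lt_d9
    have h3 : Real.exp 1 ^ 3 ≤ 3 ^ 3 := by gcongr; linarith
    linarith [H.le_T]
  refine ⟨?_, ?_, ?_, ?_⟩
  · calc cutPt lam Y ^ (2 * σ) ≤ (3 * √T) ^ (2 * σ) := by gcongr
      _ = 3 ^ (2 * σ) * T ^ σ := by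
          rw [Real.mul_rpow (by norm_num) hS0.le, hpow]; congr 2; ring
      _ ≤ 3 ^ (2 : ℝ) * T ^ σ := by gcongr; exacts [by norm_num, by linarith]
      _ = _ := by norm_num
  · calc cutPt lam Y ^ (2 * (σ - 1)) ≤ (2 / 5 * √T) ^ (2 * (σ - 1)) :=
          Real.rpow_le_rpow_of_nonpos (by positivity) e2 (by linarith)
      _ = (5 / 2) ^ (2 * (1 - σ)) * T ^ (σ - 1) := by
          rw [Real.mul_rpow (by norm_num) hS0.le, hpow,
            show (2 / 5 : ℝ) = (5 / 2)⁻¹ by norm_num, Real.inv_rpow (by norm_num),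
            ← Real.rpow_neg (by norm_num)]
          congr 2 <;> ring
      _ ≤ (5 / 2) ^ (2 : ℝ) * T ^ (σ - 1) := by gcongr; exacts [by norm_num, by linarith]
      _ ≤ _ := by gcongr; norm_num
  · calc cutPt lam Y ^ (2 * σ - 1) ≤ (3 * √T) ^ (2 * σ - 1) := by
          gcongr; linarith
      _ = 3 ^ (2 * σ - 1) * T ^ (σ - 1 / 2) := by
          rw [Real.mul_rpow (by norm_num) hS0.le, hpow]; congr 2; ring
      _ ≤ 3 ^ (1 : ℝ) * T ^ (σ - 1 / 2) := by gcongr; exacts [by norm_num, by linarith]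
      _ = _ := by norm_num
  · have : Real.log (cutPt lam Y) ≤ Real.log T :=
      Real.log_le_log hh (e1.trans (by nlinarith [H.sq_sqrt]))
    linarith

theorem exists_block_le {lam : ℝ} (h0 : 0 < lam) (h1 : lam < 1) {σ : ℝ}
    (hσ0 : 1 / 2 < σ) (hσ : σ < 1) :
    ∃ C : ℝ, 0 < C ∧ ∀ (T b : ℝ), DyadicHyp T b → ∀ (t₁ t₂ : ℝ) (Y : ℕ), t₁ ≤ t₂ → T ≤ t₁ →
      t₂ ≤ 2 * T → 2 * Real.pi * b * Y ≤ t₁ → t₂ ≤ 2 * Real.pi * b * (Y + 1) →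
      |(∫ t in t₁..t₂, t ^ (2 * σ - 1) * ‖zetaL b lam (σ + t * I)‖ ^ 2) -
        ∫ t in t₁..t₂, 2 * Real.pi * ‖afeSum b lam Y (σ + t * I)‖ ^ 2| ≤
        C * (T ^ (σ - 1 / 2) * Real.log T + T ^ (σ - 1) * (t₂ - t₁)) := by
  obtain ⟨C1, hC1, H1⟩ := norm_integral_afeRem_mul_conj_le h0 h1 (by linarith : 0 < σ) hσ
  obtain ⟨C2, hC2, H2⟩ := exists_norm_afeRem_le h0 h1
  obtain ⟨C3, hC3, H3⟩ := exists_norm_lineInt_le h0 h1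
  refine ⟨12 * C1 + (60 * Real.exp 60 * (C3 ^ 2 * 9) + C2 ^ 2 * 7), by positivity,
    fun T b H t₁ t₂ Y ht hT1 hT2 hY1 hY2 => ?_⟩
  have hT := H.T_pos
  have hb := H.b_pos
  have hpi := Real.pi_gt_three
  have hY := H.one_le_of_le (hT1.trans ht) hY2
  have hA : ∀ t ∈ Set.Icc t₁ t₂, AFEHyp b (cutPt lam Y) t σ := fun t ht' =>
    H.afeHyp h0 h1 (hT1.trans ht'.1) (ht'.2.trans hT2) (hY1.trans ht'.1) (ht'.2.trans hY2)
      ⟨hσ0.le, by linarith⟩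
  obtain ⟨B1, B2, B3, B4⟩ := H.rpow_cutPt_bounds h0 h1 hT1 (ht.trans hT2) hY1 (ht.trans hY2)
    hσ0 hσ
  set h := cutPt lam Y with hh
  have hone := (hA t₁ ⟨le_rfl, ht⟩).one_le
  have hp : 0 < h := by linarith
  have hδ : 0 < 1 / h := by positivity
  have hδ2 : 1 / h ≤ Real.pi / 2 := (div_le_one hp).mpr hone |>.trans (by linarith)
  have hσp : 0 < σ := by linarith
  have cZ := continuous_lineInt hb h0 h1 hδ hδ2 hσp
  have cB := continuous_afeSum h0 b σ Y
  have cz := continuous_zetaL hb h0 h1 hσp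
  set Z : ℝ → ℂ := fun t => lineInt b lam (1 / h) (σ + t * I) with hZ
  set B : ℝ → ℂ := fun t => afeSum b lam Y (σ + t * I) with hB
  set ρ : ℝ → ℂ := fun t => Z t - 2 * Real.pi * B t with hρ
  have cρ : Continuous ρ := cZ.sub (continuous_const.mul cB)
  have cc : Continuous fun t => ρ t * (starRingEnd ℂ) (B t) := cρ.mul (continuous_conj.comp cB)
  set g : ℝ → ℝ := fun t => t ^ (2 * σ - 1) * ‖zetaL b lam (σ + t * I)‖ ^ 2 with hg
  have cg : Continuous g :=
    (Real.continuous_rpow_const (by linarith)).mul ((continuous_norm.comp cz).pow 2)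
  have hdec : (∫ t in t₁..t₂, g t) - ∫ t in t₁..t₂, 2 * Real.pi * ‖B t‖ ^ 2 =
      (∫ t in t₁..t₂, (g t - ‖Z t‖ ^ 2 / (2 * Real.pi) + ‖ρ t‖ ^ 2 / (2 * Real.pi))) +
        2 * (∫ t in t₁..t₂, ρ t * (starRingEnd ℂ) (B t)).re := by
    have : (∫ t in t₁..t₂, ρ t * (starRingEnd ℂ) (B t)).re =
        ∫ t in t₁..t₂, (ρ t * (starRingEnd ℂ) (B t)).re :=
      (reCLM.intervalIntegral_comp_comm (cc.intervalIntegrable _ _)).symm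
    rw [this, ← intervalIntegral.integral_const_mul, ← intervalIntegral.integral_sub,
      ← intervalIntegral.integral_add]
    · refine intervalIntegral.integral_congr fun t _ => ?_
      have := norm_sq_two_pi_add (B t) (ρ t)
      rw [show 2 * Real.pi * B t + ρ t = Z t by simp [hρ]] at this
      change g t - 2 * Real.pi * ‖B t‖ ^ 2 = _
      linarith
    all_goals exact Continuous.intervalIntegrable (by fun_prop) _ _
  have hpt : ∀ t ∈ Set.uIoc t₁ t₂, ‖g t - ‖Z t‖ ^ 2 / (2 * Real.pi) + ‖ρ t‖ ^ 2 / (2 * Real.pi)‖ ≤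
      (60 * Real.exp 60 * (C3 ^ 2 * 9) + C2 ^ 2 * 7) * T ^ (σ - 1) := by
    intro t ht'
    rw [Set.uIoc_of_le ht] at ht'
    have hAt := hA t ⟨ht'.1.le, ht'.2⟩
    have htT : T ≤ t := hT1.trans ht'.1.le
    have ht1 : 1 ≤ t := by linarith [H.le_T]
    have hZle : ‖Z t‖ ^ 2 ≤ C3 ^ 2 * (9 * T ^ σ) := by
      calc ‖Z t‖ ^ 2 ≤ (C3 * h ^ σ) ^ 2 := by gcongr; exact H3 b t σ Y hY hAt
        _ = C3 ^ 2 * h ^ (2 * σ) := by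
            rw [mul_pow, ← Real.rpow_natCast (h ^ σ), ← Real.rpow_mul hp.le]
            congr 2; push_cast; ring
        _ ≤ _ := by gcongr
    have hρle : ‖ρ t‖ ^ 2 ≤ C2 ^ 2 * (7 * T ^ (σ - 1)) := by
      have : ρ t = afeRem b lam h (σ + t * I) := by
        simp only [hρ, hZ, hB]
        rw [lineInt_eq_sum_add_afeRem h0 h1 hY hAt, afeSum, add_sub_cancel_left]
      rw [this]
      calc _ ≤ (C2 * h ^ (σ - 1)) ^ 2 := by gcongr; exact H2 b t σ Y hAt
        _ = C2 ^ 2 * h ^ (2 * (σ - 1)) := by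
            rw [mul_pow, ← Real.rpow_natCast (h ^ (σ - 1)), ← Real.rpow_mul hp.le]
            congr 2; push_cast; ring
        _ ≤ _ := by gcongr
    have e1 : g t - ‖Z t‖ ^ 2 / (2 * Real.pi) =
        (t ^ (2 * σ - 1) * Real.exp (-(Real.pi * t)) / ‖Gamma (σ + t * I)‖ ^ 2 -
          1 / (2 * Real.pi)) * ‖Z t‖ ^ 2 := by
      simp only [hg]
      rw [sq_norm_zetaL_eq hb h0 h1 hδ hδ2 hσp]; ring
    have e2 : |g t - ‖Z t‖ ^ 2 / (2 * Real.pi)| ≤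
        60 * Real.exp 60 / T * (C3 ^ 2 * (9 * T ^ σ)) := by
      rw [e1, abs_mul, abs_of_nonneg (sq_nonneg ‖Z t‖)]
      gcongr
      exact (abs_inv_norm_sq_Gamma_sub_le ht1 ⟨hσ0.le, by linarith⟩).trans (by gcongr)
    have e3 : ‖ρ t‖ ^ 2 / (2 * Real.pi) ≤ C2 ^ 2 * (7 * T ^ (σ - 1)) :=
      (div_le_self (sq_nonneg _) (by linarith)).trans hρle
    have e4 : 0 ≤ ‖ρ t‖ ^ 2 / (2 * Real.pi) := by positivity
    have e5 : T ^ (σ - 1) = T ^ σ / T := Real.rpow_sub_one hT.ne' σ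
    have e6 : 60 * Real.exp 60 / T * (C3 ^ 2 * (9 * T ^ σ)) =
        60 * Real.exp 60 * (C3 ^ 2 * 9) * T ^ (σ - 1) := by rw [e5]; ring
    rw [Real.norm_eq_abs]
    refine (abs_add_le _ _).trans ?_
    rw [abs_of_nonneg e4]
    linarith
  have hI1 := intervalIntegral.norm_integral_le_of_norm_le_const hpt
  rw [abs_of_nonneg (by linarith : 0 ≤ t₂ - t₁), Real.norm_eq_abs] at hI1
  have hI2 := H1 b t₁ t₂ Y hY ht hA
  have hre := (abs_re_le_norm (∫ t in t₁..t₂, ρ t * (starRingEnd ℂ) (B t))).trans hI2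
  have hfin : C1 * h ^ (2 * σ - 1) * (3 + Real.log h) ≤
      C1 * (3 * T ^ (σ - 1 / 2)) * (2 * Real.log T) := by
    have := Real.log_nonneg hone
    gcongr
  rw [hdec]
  refine (abs_add_le _ _).trans ?_
  rw [abs_mul, abs_two]
  set K := 60 * Real.exp 60 * (C3 ^ 2 * 9) + C2 ^ 2 * 7 with hK
  have hK0 : 0 < K := by positivity
  have hlT : 0 ≤ Real.log T := Real.log_nonneg (by linarith [H.le_T])
  have q1 : 0 ≤ K * (T ^ (σ - 1 / 2) * Real.log T) := by positivity
  have q2 : 0 ≤ 12 * C1 * (T ^ (σ - 1) * (t₂ - t₁)) :=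
    mul_nonneg (by positivity) (mul_nonneg (by positivity) (by linarith))
  nlinarith [hI1, hre, hfin]

/-- The sum of the off-diagonal terms of index `m` in the square of a Dirichlet polynomial. -/
noncomputable def offTerm (r l φ : ℕ → ℝ) (m : ℕ) (t : ℝ) : ℝ :=
  ∑ n ∈ range m, 2 * (r n * r m) * Real.cos ((l m - l n) * t + (φ m - φ n))

theorem continuous_offTerm (r l φ : ℕ → ℝ) (m : ℕ) : Continuous (offTerm r l φ m) := by
  unfold offTerm; fun_prop

theorem norm_sq_sum_cexp (r l φ : ℕ → ℝ) (N : ℕ) (t : ℝ) :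
    ‖∑ n ∈ range N, (r n : ℂ) * cexp (I * ((l n * t + φ n : ℝ) : ℂ))‖ ^ 2 =
      ∑ n ∈ range N, r n ^ 2 + ∑ m ∈ range N, offTerm r l φ m t := by
  induction N with
  | zero => simp
  | succ N ih =>
    rw [sum_range_succ, sum_range_succ, sum_range_succ]
    have e : ∀ z w : ℂ, ‖z + w‖ ^ 2 = ‖z‖ ^ 2 + ‖w‖ ^ 2 + 2 * (z * (starRingEnd ℂ) w).re := by
      intro z w
      rw [Complex.sq_norm, Complex.sq_norm, Complex.sq_norm, normSq_add]
    rw [e, ih]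
    have e1 : ‖(r N : ℂ) * cexp (I * ((l N * t + φ N : ℝ) : ℂ))‖ ^ 2 = r N ^ 2 := by
      rw [norm_mul, mul_comm I, norm_exp_ofReal_mul_I, mul_one, norm_real, Real.norm_eq_abs,
        sq_abs]
    have e2 : 2 * ((∑ n ∈ range N, (r n : ℂ) * cexp (I * ((l n * t + φ n : ℝ) : ℂ))) *
        (starRingEnd ℂ) ((r N : ℂ) * cexp (I * ((l N * t + φ N : ℝ) : ℂ)))).re =
        offTerm r l φ N t := by
      rw [sum_mul, re_sum, mul_sum, offTerm]
      refine sum_congr rfl fun n _ => ?_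
      have : (r n : ℂ) * cexp (I * ((l n * t + φ n : ℝ) : ℂ)) *
          (starRingEnd ℂ) ((r N : ℂ) * cexp (I * ((l N * t + φ N : ℝ) : ℂ))) =
          ((r n * r N : ℝ) : ℂ) *
            cexp (((-((l N - l n) * t + (φ N - φ n)) : ℝ) : ℂ) * I) := by
        rw [map_mul, ← exp_conj, conj_ofReal, map_mul, conj_I, conj_ofReal, mul_mul_mul_comm,
          ← Complex.exp_add, ofReal_mul]
        congr 2
        push_cast
        ring
      rw [this, re_ofReal_mul, exp_ofReal_mul_I_re, Real.cos_neg]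
      ring
    rw [e1, e2]
    ring

theorem abs_integral_cos_le {k : ℝ} (hk : 0 < |k|) (c t₁ t₂ : ℝ) :
    |∫ t in t₁..t₂, Real.cos (k * t + c)| ≤ 2 / |k| := by
  have hk0 : k ≠ 0 := abs_pos.mp hk
  rw [intervalIntegral.integral_comp_mul_add _ hk0, integral_cos, smul_eq_mul, abs_mul, abs_inv,
    inv_mul_eq_div]
  gcongr
  refine (abs_sub _ _).trans ?_
  linarith [Real.abs_sin_le_one (k * t₂ + c), Real.abs_sin_le_one (k * t₁ + c)]

theorem abs_integral_offTerm_le {r l φ : ℕ → ℝ} (hr : ∀ n, 0 ≤ r n) {m : ℕ}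
    (hl : ∀ n < m, 0 < |l m - l n|) (t₁ t₂ : ℝ) :
    |∫ t in t₁..t₂, offTerm r l φ m t| ≤ 4 * ∑ n ∈ range m, r n * r m / |l m - l n| := by
  simp only [offTerm]
  rw [intervalIntegral.integral_finsetSum]
  swap
  · exact fun n _ => Continuous.intervalIntegrable (by fun_prop) _ _
  rw [mul_sum]
  refine (abs_sum_le_sum_abs _ _).trans (sum_le_sum fun n hn => ?_)
  rw [intervalIntegral.integral_const_mul, abs_mul,
    abs_of_nonneg (mul_nonneg zero_le_two (mul_nonneg (hr _) (hr _)))]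
  calc _ ≤ 2 * (r n * r m) * (2 / |l m - l n|) :=
        mul_le_mul_of_nonneg_left (abs_integral_cos_le (hl n (mem_range.mp hn)) _ _ _)
          (mul_nonneg zero_le_two (mul_nonneg (hr _) (hr _)))
    _ = _ := by ring

theorem sum_integral_sum_telescope {p : ℕ → ℝ → ℝ} (hp : ∀ m, Continuous (p m)) (a : ℕ → ℝ)
    (K : ℕ) :
    ∑ Y ∈ range K, ∫ t in a Y..a (Y + 1), ∑ m ∈ range Y, p m t =
      ∑ m ∈ range K, ∫ t in a (m + 1)..a K, p m t := by
  induction K with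
  | zero => simp
  | succ K ih =>
    rw [sum_range_succ, ih, sum_range_succ, intervalIntegral.integral_same, add_zero,
      intervalIntegral.integral_finsetSum fun m _ => (hp m).intervalIntegrable _ _,
      ← sum_add_distrib]
    exact sum_congr rfl fun m _ => intervalIntegral.integral_add_adjacent_intervals
      ((hp m).intervalIntegrable _ _) ((hp m).intervalIntegrable _ _)

theorem sum_rpow_one_sub_two_mul_le {α x₀ : ℝ} (hα1 : α < 1) (hx : 0 < x₀)
    (hx1 : x₀ ≤ 1) :
    ∃ C : ℝ, 0 < C ∧ ∀ K : ℕ,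
      ∑ m ∈ range K, ((m : ℝ) + x₀) ^ (1 - 2 * α) ≤ C * (K : ℝ) ^ (2 - 2 * α) := by
  rcases lt_or_ge (1 / 2) α with h | h
  · refine ⟨x₀ ^ (-(2 * α - 1)) + 1 / (1 - (2 * α - 1)), ?_, fun K => ?_⟩
    · have : 0 < 1 - (2 * α - 1) := by linarith
      positivity
    · have := sum_rpow_neg_le (α := 2 * α - 1) (by linarith) (by linarith) hx K
      simpa only [neg_sub, show 1 - (2 * α - 1) = 2 - 2 * α by ring] using this
  · refine ⟨1, one_pos, fun K => ?_⟩
    rcases Nat.eq_zero_or_pos K with rfl | hK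
    · simp; positivity
    have hK' : (0 : ℝ) < K := by exact_mod_cast hK
    calc _ ≤ ∑ m ∈ range K, (K : ℝ) ^ (1 - 2 * α) := by
          refine sum_le_sum fun m hm => ?_
          have : (m : ℝ) + 1 ≤ K := by exact_mod_cast mem_range.mp hm
          exact Real.rpow_le_rpow (by positivity) (by linarith) (by linarith)
      _ = _ := by
          rw [sum_const, card_range, nsmul_eq_mul, one_mul,
            show 2 - 2 * α = 1 + (1 - 2 * α) by ring, Real.rpow_add hK', Real.rpow_one]

theorem sum_offdiag_le {α x₀ : ℝ} (hα0 : 0 < α) (hα1 : α < 1) (hx : 0 < x₀) (hx1 : x₀ ≤ 1) :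
    ∃ C : ℝ, 0 < C ∧ ∀ K : ℕ,
      ∑ m ∈ range K, ∑ n ∈ range m, ((n : ℝ) + x₀) ^ (-α) * ((m : ℝ) + x₀) ^ (-α) /
        Real.log (((m : ℝ) + x₀) / (n + x₀)) ≤
        C * (K : ℝ) ^ (2 - 2 * α) * (3 + Real.log (K + 1)) := by
  obtain ⟨C1, hC1, H1⟩ := sum_rpow_div_log_le hα0 hα1 hx
  obtain ⟨C2, hC2, H2⟩ := sum_rpow_one_sub_two_mul_le hα1 hx hx1
  refine ⟨C1 * C2, by positivity, fun K => ?_⟩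
  have hlK : 0 ≤ Real.log ((K : ℝ) + 1) := Real.log_nonneg (by linarith [K.cast_nonneg (α := ℝ)])
  calc _ ≤ ∑ m ∈ range K, C1 * (3 + Real.log (K + 1)) * ((m : ℝ) + x₀) ^ (1 - 2 * α) := by
        refine sum_le_sum fun m hm => ?_
        have hm0 : 0 < (m : ℝ) + x₀ := by positivity
        rcases Nat.eq_zero_or_pos m with rfl | hmp
        · simp only [range_zero, sum_empty]; positivity
        have hm1 : (1 : ℝ) ≤ m := by exact_mod_cast hmp
        have hmK : (m : ℝ) ≤ K := by exact_mod_cast (mem_range.mp hm).le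
        obtain ⟨-, h⟩ := H1 m (m + x₀) (by linarith) (by linarith)
        have hl : Real.log ((m : ℝ) + x₀) ≤ Real.log (K + 1) :=
          Real.log_le_log hm0 (by linarith)
        calc _ = ((m : ℝ) + x₀) ^ (-α) * ∑ n ∈ range m, ((n : ℝ) + x₀) ^ (-α) /
              Real.log (((m : ℝ) + x₀) / (n + x₀)) := by
              rw [mul_sum]; exact sum_congr rfl fun n _ => by ring
          _ ≤ ((m : ℝ) + x₀) ^ (-α) *
              (C1 * ((m : ℝ) + x₀) ^ (1 - α) * (3 + Real.log (K + 1))) := by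
              gcongr; exact h.trans (by gcongr)
          _ = _ := by
              rw [show 1 - 2 * α = -α + (1 - α) by ring, Real.rpow_add hm0]; ring
    _ ≤ C1 * (3 + Real.log (K + 1)) * (C2 * (K : ℝ) ^ (2 - 2 * α)) := by
        rw [← mul_sum]; gcongr; exact H2 K
    _ = _ := by ring

theorem abs_rpow_sub_rpow_le {m x y p : ℝ} (hm : 0 < m) (hx : m ≤ x) (hy : m ≤ y) (hp0 : 0 ≤ p)
    (hp1 : p ≤ 1) : |y ^ p - x ^ p| ≤ m ^ (p - 1) * |y - x| := by
  wlog h : x ≤ y generalizing x y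
  · rw [abs_sub_comm, abs_sub_comm y]; exact this hy hx (by linarith)
  have hx0 : 0 < x := by linarith
  have hle : x ^ p ≤ y ^ p := by gcongr
  rw [abs_of_nonneg (by linarith), abs_of_nonneg (by linarith)]
  have h1 := _root_.rpow_one_add_le_one_add_mul_self (s := (y - x) / x) (p := p)
    (le_trans (by norm_num) (div_nonneg (by linarith) hx0.le : 0 ≤ (y - x) / x)) hp0 hp1
  have e : 1 + (y - x) / x = y / x := by field_simp; ring
  rw [e, Real.div_rpow (by linarith) hx0.le, div_le_iff₀ (by positivity)] at h1
  have h2 : x ^ (p - 1) ≤ m ^ (p - 1) := Real.rpow_le_rpow_of_nonpos hm hx (by linarith)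
  calc y ^ p - x ^ p ≤ p * (x ^ (p - 1) * (y - x)) := by
        rw [Real.rpow_sub_one hx0.ne']
        have : (1 + p * ((y - x) / x)) * x ^ p = x ^ p + p * (x ^ p / x * (y - x)) := by ring
        linarith
    _ ≤ 1 * (m ^ (p - 1) * (y - x)) := by
        gcongr
    _ = _ := one_mul _

theorem mul_mul_rpow_sub_one {c y : ℝ} (hc : 0 < c) (hy : 0 < y) (p : ℝ) :
    c * (c * y) ^ (p - 1) = c ^ p * y ^ (p - 1) := by
  rw [Real.mul_rpow hc.le hy.le, ← mul_assoc, Real.rpow_sub_one hc.ne', mul_div_cancel₀ _ hc.ne']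

theorem DyadicHyp.diagonal_le {T b lam t σ Z : ℝ} (H : DyadicHyp T b) (h0 : 0 < lam)
    (h1 : lam < 1) {Y : ℕ} (ht1 : T ≤ t) (hY1 : 2 * Real.pi * b * Y ≤ t)
    (hY2 : t ≤ 2 * Real.pi * b * (Y + 1)) (hσ0 : 1 / 2 < σ) (hσ : σ < 1)
    (hZ : |∑ n ∈ range Y, ((n : ℝ) + lam) ^ (-(2 - 2 * σ)) - Z -
      ((Y : ℝ) + lam) ^ (1 - (2 - 2 * σ)) / (1 - (2 - 2 * σ))| ≤
        ((Y : ℝ) + lam) ^ (-(2 - 2 * σ))) :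
    |2 * Real.pi * ∑ ν ∈ range Y, (freq lam ν ^ (σ - 1)) ^ 2 -
      ((2 * Real.pi) ^ (2 * σ - 1) * Z + t ^ (2 * σ - 1) * b ^ (1 - 2 * σ) / (2 * σ - 1))| ≤
      (175 + 175 / (2 * σ - 1)) * T ^ (σ - 1) := by
  have hT := H.T_pos
  have hS := H.twenty_le
  have hb := H.b_pos
  have hpi := Real.pi_gt_three
  have hpi' := Real.pi_lt_d2
  have hp : 0 < 2 * σ - 1 := by linarith
  have hlow : √T / 5 ≤ 2 * Real.pi * Y := by
    have := H.le_cutPt h0 h1 ht1 hY1 hY2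
    rw [cutPt_eq] at this
    nlinarith
  have hYl : 0 < (Y : ℝ) + lam := by positivity
  have hm : 0 < √T / 5 := by positivity
  have hfreq : √T / 5 ≤ freq lam Y := by unfold freq; nlinarith
  have hf0 := freq_pos h0 Y
  have htb : √T / 5 ≤ t / b := by
    rw [le_div_iff₀ hb]; nlinarith
  have hdist : |freq lam Y - t / b| ≤ 2 * Real.pi := by
    have e1 : 2 * Real.pi * Y ≤ t / b := by rw [le_div_iff₀ hb]; linarith
    have e2 : t / b ≤ 2 * Real.pi * (Y + 1) := by rw [div_le_iff₀ hb]; linarith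
    rw [abs_le]; unfold freq
    constructor <;> nlinarith
  have hpow : (√T / 5) ^ (2 * σ - 1 - 1) ≤ 25 * T ^ (σ - 1) := by
    rw [Real.div_rpow (by positivity) (by norm_num), Real.sqrt_eq_rpow, ← Real.rpow_mul hT.le,
      div_eq_mul_inv, ← Real.rpow_neg (by norm_num), mul_comm,
      show 1 / 2 * (2 * σ - 1 - 1) = σ - 1 by ring]
    gcongr
    calc (5 : ℝ) ^ (-(2 * σ - 1 - 1)) ≤ 5 ^ (2 : ℝ) := by
          gcongr; exacts [by norm_num, by linarith]
      _ = 25 := by norm_num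
  have hsum : 2 * Real.pi * ∑ ν ∈ range Y, (freq lam ν ^ (σ - 1)) ^ 2 =
      (2 * Real.pi) ^ (2 * σ - 1) * ∑ n ∈ range Y, ((n : ℝ) + lam) ^ (-(2 - 2 * σ)) := by
    rw [mul_sum, mul_sum]
    refine sum_congr rfl fun ν _ => ?_
    have hν : 0 < (ν : ℝ) + lam := by positivity
    rw [← Real.rpow_natCast, ← Real.rpow_mul (freq_pos h0 ν).le, freq,
      show (σ - 1) * ((2 : ℕ) : ℝ) = 2 * σ - 1 - 1 by push_cast; ring,
      show -(2 - 2 * σ) = 2 * σ - 1 - 1 by ring]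
    exact mul_mul_rpow_sub_one (by positivity) hν _
  have hmain := abs_rpow_sub_rpow_le hm htb hfreq hp.le (by linarith)
  have e1 : freq lam Y ^ (2 * σ - 1) =
      (2 * Real.pi) ^ (2 * σ - 1) * ((Y : ℝ) + lam) ^ (2 * σ - 1) := by
    rw [freq, Real.mul_rpow (by positivity) hYl.le]
  have e2 : (t / b) ^ (2 * σ - 1) = t ^ (2 * σ - 1) * b ^ (1 - 2 * σ) := by
    rw [Real.div_rpow (by linarith) hb.le, div_eq_mul_inv, ← Real.rpow_neg hb.le, neg_sub]
  have e3 : (2 * Real.pi) ^ (2 * σ - 1) * ((Y : ℝ) + lam) ^ (-(2 - 2 * σ)) ≤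
      175 * T ^ (σ - 1) := by
    have : (2 * Real.pi) ^ (2 * σ - 1) * ((Y : ℝ) + lam) ^ (-(2 - 2 * σ)) =
        2 * Real.pi * freq lam Y ^ (2 * σ - 1 - 1) := by
      rw [freq, show -(2 - 2 * σ) = 2 * σ - 1 - 1 by ring]
      exact (mul_mul_rpow_sub_one (by positivity) hYl _).symm
    rw [this]
    calc _ ≤ 7 * (25 * T ^ (σ - 1)) := by
          gcongr
          · linarith
          · exact (Real.rpow_le_rpow_of_nonpos hm hfreq (by linarith)).trans hpow
      _ = _ := by ring
  rw [hsum]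
  set S := ∑ n ∈ range Y, ((n : ℝ) + lam) ^ (-(2 - 2 * σ)) with hSdef
  have hW : 0 < (2 * Real.pi) ^ (2 * σ - 1) := by positivity
  have hZ' := mul_le_mul_of_nonneg_left hZ hW.le
  rw [← abs_of_pos hW, ← abs_mul, abs_of_pos hW] at hZ'
  rw [show 1 - (2 - 2 * σ) = 2 * σ - 1 by ring] at hZ'
  have e4 : (2 * Real.pi) ^ (2 * σ - 1) * S -
      ((2 * Real.pi) ^ (2 * σ - 1) * Z + t ^ (2 * σ - 1) * b ^ (1 - 2 * σ) / (2 * σ - 1)) =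
      (2 * Real.pi) ^ (2 * σ - 1) * (S - Z - ((Y : ℝ) + lam) ^ (2 * σ - 1) / (2 * σ - 1)) +
      (freq lam Y ^ (2 * σ - 1) - (t / b) ^ (2 * σ - 1)) / (2 * σ - 1) := by
    rw [e1, e2]; ring
  rw [e4]
  refine (abs_add_le _ _).trans ?_
  rw [add_mul]
  refine add_le_add (hZ'.trans e3) ?_
  rw [abs_div, abs_of_pos hp, div_mul_eq_mul_div]
  gcongr
  calc _ ≤ (√T / 5) ^ (2 * σ - 1 - 1) * |freq lam Y - t / b| := hmain
    _ ≤ 25 * T ^ (σ - 1) * (2 * Real.pi) := by gcongr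
    _ ≤ 175 * T ^ (σ - 1) := by
        have : 0 < T ^ (σ - 1) := by positivity
        nlinarith

/-- Breakpoints cutting `[T, 2T]` at the multiples of `2πb`. -/
noncomputable def breakPt (T b : ℝ) (j : ℕ) : ℝ := max T (min (2 * T) (2 * Real.pi * b * j))

theorem le_breakPt (T b : ℝ) (j : ℕ) : T ≤ breakPt T b j := le_max_left _ _

theorem breakPt_le {T : ℝ} (hT : 0 ≤ T) (b : ℝ) (j : ℕ) : breakPt T b j ≤ 2 * T :=
  max_le (by linarith) (min_le_left _ _)

theorem breakPt_le_succ {b : ℝ} (hb : 0 ≤ b) (T : ℝ) (j : ℕ) :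
    breakPt T b j ≤ breakPt T b (j + 1) := by
  have := Real.pi_pos
  unfold breakPt
  gcongr
  simp

theorem breakPt_zero {T : ℝ} (hT : 0 ≤ T) (b : ℝ) : breakPt T b 0 = T := by
  simp [breakPt, hT]

theorem breakPt_eq_of_le {T b : ℝ} (hT : 0 ≤ T) {j : ℕ} (h : 2 * T ≤ 2 * Real.pi * b * j) :
    breakPt T b j = 2 * T := by
  rw [breakPt, min_eq_left h, max_eq_right (by linarith)]

theorem breakPt_bounds_of_lt {T b : ℝ} (hT : 0 ≤ T) {j : ℕ}
    (h : breakPt T b j < breakPt T b (j + 1)) :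
    2 * Real.pi * b * j ≤ breakPt T b j ∧ breakPt T b (j + 1) ≤ 2 * Real.pi * b * (j + 1) := by
  have h1 : 2 * Real.pi * b * j < 2 * T := by
    by_contra hcon
    rw [breakPt_eq_of_le hT (not_lt.mp hcon)] at h
    exact absurd (breakPt_le hT b (j + 1)) (not_le.mpr h)
  have h2 : T < 2 * Real.pi * b * (j + 1) := by
    by_contra hcon
    have : breakPt T b (j + 1) = T := by
      rw [breakPt, max_eq_left]
      exact (min_le_right _ _).trans (by push_cast; linarith)
    rw [this] at h
    exact absurd (le_breakPt T b j) (not_le.mpr h)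
  refine ⟨?_, max_le h2.le ((min_le_right _ _).trans (by push_cast; rfl))⟩
  rw [breakPt, min_eq_right h1.le]
  exact le_max_right _ _

theorem norm_sq_afeSum {lam : ℝ} (h0 : 0 < lam) (b σ t : ℝ) (Y : ℕ) :
    ‖afeSum b lam Y (σ + t * I)‖ ^ 2 = ∑ ν ∈ range Y, (freq lam ν ^ (σ - 1)) ^ 2 +
      ∑ m ∈ range Y, offTerm (fun ν => freq lam ν ^ (σ - 1)) (fun ν => Real.log (freq lam ν))
        (fun ν => -(b * freq lam ν)) m t := by
  rw [← norm_sq_sum_cexp, afeSum]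
  congr 2
  refine sum_congr rfl fun ν _ => ?_
  rw [afeTerm_eq h0]
  congr 4
  ring

theorem exists_block_sub_le {lam : ℝ} (h0 : 0 < lam) (h1 : lam < 1) {σ : ℝ}
    (hσ0 : 1 / 2 < σ) (hσ : σ < 1) :
    ∃ Z : ℝ, hzeta lam ((2 - 2 * σ : ℝ) : ℂ) = Z ∧
    ∃ C : ℝ, 0 < C ∧ ∀ (T b : ℝ), DyadicHyp T b → ∀ Y : ℕ,
      |(∫ t in breakPt T b Y..breakPt T b (Y + 1),
          (t ^ (2 * σ - 1) * ‖zetaL b lam (σ + t * I)‖ ^ 2 -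
          ((2 * Real.pi) ^ (2 * σ - 1) * Z + t ^ (2 * σ - 1) * b ^ (1 - 2 * σ) / (2 * σ - 1)))) -
        2 * Real.pi * ∫ t in breakPt T b Y..breakPt T b (Y + 1), ∑ m ∈ range Y,
          offTerm (fun ν => freq lam ν ^ (σ - 1)) (fun ν => Real.log (freq lam ν))
            (fun ν => -(b * freq lam ν)) m t| ≤
        C * (T ^ (σ - 1 / 2) * Real.log T +
          T ^ (σ - 1) * (breakPt T b (Y + 1) - breakPt T b Y)) := by
  obtain ⟨Z, hZ, hZb⟩ := hzeta_asymp h0 h1.le (s := 2 - 2 * σ) (by linarith)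
    (by intro h; linarith)
  obtain ⟨C, hC, hB⟩ := exists_block_le h0 h1 hσ0 hσ
  have hp : 0 < 2 * σ - 1 := by linarith
  refine ⟨Z, hZ, C + (175 + 175 / (2 * σ - 1)), by positivity, fun T b H Y => ?_⟩
  have hT := H.T_pos
  have hb := H.b_pos
  have hlT : 0 ≤ Real.log T := Real.log_nonneg (by linarith [H.le_T])
  have hle := breakPt_le_succ hb.le T Y
  rcases hle.eq_or_lt with heq | hlt
  · rw [← heq]; simp; positivity
  obtain ⟨hY1, hY2⟩ := breakPt_bounds_of_lt hT.le hlt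
  have hT1 := le_breakPt T b Y
  have hT2 := breakPt_le hT.le b (Y + 1)
  set t₁ := breakPt T b Y
  set t₂ := breakPt T b (Y + 1)
  have hmain := hB T b H t₁ t₂ Y hle hT1 hT2 hY1 hY2
  set off : ℝ → ℝ := fun t => ∑ m ∈ range Y,
    offTerm (fun ν => freq lam ν ^ (σ - 1)) (fun ν => Real.log (freq lam ν))
            (fun ν => -(b * freq lam ν)) m t with hoff
  have coff : Continuous off := by
    have := continuous_offTerm (fun ν => freq lam ν ^ (σ - 1)) (fun ν => Real.log (freq lam ν))
            (fun ν => -(b * freq lam ν))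
    fun_prop
  set g : ℝ → ℝ := fun t => t ^ (2 * σ - 1) * ‖zetaL b lam (σ + t * I)‖ ^ 2 with hg
  have cr : Continuous fun t : ℝ => t ^ (2 * σ - 1) := Real.continuous_rpow_const hp.le
  have cg : Continuous g :=
    cr.mul ((continuous_norm.comp (continuous_zetaL hb h0 h1 (by linarith))).pow 2)
  set M : ℝ → ℝ := fun t =>
    (2 * Real.pi) ^ (2 * σ - 1) * Z + t ^ (2 * σ - 1) * b ^ (1 - 2 * σ) / (2 * σ - 1) with hM
  have cM : Continuous M := by fun_prop
  set D := ∑ ν ∈ range Y, (freq lam ν ^ (σ - 1)) ^ 2 with hD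
  simp only [norm_sq_afeSum h0] at hmain
  have hdec : (∫ t in t₁..t₂, (g t - M t)) - 2 * Real.pi * ∫ t in t₁..t₂, off t =
      ((∫ t in t₁..t₂, g t) - ∫ t in t₁..t₂, 2 * Real.pi * (D + off t)) +
      ∫ t in t₁..t₂, (2 * Real.pi * D - M t) := by
    rw [← intervalIntegral.integral_const_mul, ← intervalIntegral.integral_sub,
      ← intervalIntegral.integral_sub, ← intervalIntegral.integral_add]
    · exact intervalIntegral.integral_congr fun t _ => by ring
    all_goals exact Continuous.intervalIntegrable (by fun_prop) _ _
  have hdiag : ‖∫ t in t₁..t₂, (2 * Real.pi * D - M t)‖ ≤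
      (175 + 175 / (2 * σ - 1)) * T ^ (σ - 1) * |t₂ - t₁| := by
    refine intervalIntegral.norm_integral_le_of_norm_le_const fun t ht => ?_
    rw [Set.uIoc_of_le hle] at ht
    exact H.diagonal_le h0 h1 (hT1.trans ht.1.le) (hY1.trans ht.1.le) (ht.2.trans hY2) hσ0 hσ
      (hZb Y)
  rw [abs_of_nonneg (by linarith), Real.norm_eq_abs] at hdiag
  refine hdec ▸ (abs_add_le _ _).trans ((add_le_add hmain hdiag).trans ?_)
  have : 0 ≤ (175 + 175 / (2 * σ - 1)) * (T ^ (σ - 1 / 2) * Real.log T) := by positivity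
  linarith

theorem log_freq_sub_log_freq {lam : ℝ} (h0 : 0 < lam) (m n : ℕ) :
    Real.log (freq lam m) - Real.log (freq lam n) =
      Real.log (((m : ℝ) + lam) / (n + lam)) := by
  have := Real.pi_pos
  rw [← Real.log_div (freq_pos h0 m).ne' (freq_pos h0 n).ne', freq, freq,
    mul_div_mul_left _ _ (by positivity)]

theorem log_add_div_add_pos {x : ℝ} (hx : 0 < x) {m n : ℕ} (h : n < m) :
    0 < Real.log (((m : ℝ) + x) / (n + x)) := by
  have : (n : ℝ) < m := by exact_mod_cast h
  exact Real.log_pos ((one_lt_div (by positivity)).mpr (by linarith))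

theorem DyadicHyp.exists_blocks {T b : ℝ} (H : DyadicHyp T b) :
    ∃ K : ℕ, (K : ℝ) ≤ √T ∧ breakPt T b K = 2 * T := by
  have hT := H.T_pos
  have hb := H.b_pos
  have hpi := Real.pi_gt_three
  refine ⟨⌈T / (Real.pi * b)⌉₊, ?_, breakPt_eq_of_le hT.le ?_⟩
  · have h1 := (Nat.ceil_lt_add_one (by positivity : 0 ≤ T / (Real.pi * b))).le
    have h2 : T / (Real.pi * b) ≤ √T / 3 := by
      rw [div_le_div_iff₀ (by positivity) (by norm_num)]
      have : √T * √T ≤ √T * b := by gcongr; exact H.sqrt_le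
      nlinarith [H.sq_sqrt, H.twenty_le]
    linarith [H.twenty_le]
  · have := Nat.le_ceil (T / (Real.pi * b))
    rw [div_le_iff₀ (by positivity)] at this
    linarith

theorem DyadicHyp.three_le_log {T b : ℝ} (H : DyadicHyp T b) : 3 ≤ Real.log T := by
  rw [Real.le_log_iff_exp_le H.T_pos]
  have : Real.exp 3 = Real.exp 1 ^ 3 := by rw [← Real.exp_nat_mul]; norm_num
  have h2 := Real.exp_one_lt_d9
  have h3 : Real.exp 1 ^ 3 ≤ 3 ^ 3 := by gcongr; linarith
  linarith [H.le_T]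

theorem exists_tail_le {lam : ℝ} (h0 : 0 < lam) (h1 : lam < 1) {σ : ℝ}
    (hσ0 : 1 / 2 < σ) (hσ : σ < 1) :
    ∃ Z : ℝ, hzeta lam ((2 - 2 * σ : ℝ) : ℂ) = Z ∧
    ∃ C : ℝ, 0 < C ∧ ∀ (T b : ℝ), DyadicHyp T b →
      |∫ t in T..2 * T, (t ^ (2 * σ - 1) * ‖zetaL b lam (σ + t * I)‖ ^ 2 -
          ((2 * Real.pi) ^ (2 * σ - 1) * Z + t ^ (2 * σ - 1) * b ^ (1 - 2 * σ) / (2 * σ - 1)))| ≤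
        C * (T ^ σ * Real.log T) := by
  obtain ⟨Z, hZ, C, hC, hB⟩ := exists_block_sub_le h0 h1 hσ0 hσ
  obtain ⟨C', hC', hO⟩ := sum_offdiag_le (α := 1 - σ) (by linarith) (by linarith) h0 h1.le
  refine ⟨Z, hZ, 2 * C + 2 * Real.pi * (4 * (C' * 2)), by positivity, fun T b H => ?_⟩
  have hT := H.T_pos
  have hb := H.b_pos
  have hS := H.twenty_le
  have hp : 0 < 2 * σ - 1 := by linarith
  have hlT := H.three_le_log
  obtain ⟨K, hK, hKe⟩ := H.exists_blocks
  set f : ℝ → ℝ := fun t => t ^ (2 * σ - 1) * ‖zetaL b lam (σ + t * I)‖ ^ 2 -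
    ((2 * Real.pi) ^ (2 * σ - 1) * Z + t ^ (2 * σ - 1) * b ^ (1 - 2 * σ) / (2 * σ - 1)) with hf
  have cr : Continuous fun t : ℝ => t ^ (2 * σ - 1) := Real.continuous_rpow_const hp.le
  have cz := continuous_zetaL hb h0 h1 (by linarith : 0 < σ)
  have cf : Continuous f := by fun_prop
  set p : ℕ → ℝ → ℝ := offTerm (fun ν => freq lam ν ^ (σ - 1))
    (fun ν => Real.log (freq lam ν)) (fun ν => -(b * freq lam ν)) with hpdef
  have hsplit : ∫ t in T..2 * T, f t =
      ∑ Y ∈ range K, ∫ t in breakPt T b Y..breakPt T b (Y + 1), f t := by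
    rw [intervalIntegral.sum_integral_adjacent_intervals fun k _ => cf.intervalIntegrable _ _,
      breakPt_zero hT.le, hKe]
  have htel := sum_integral_sum_telescope (p := p) (fun m => continuous_offTerm _ _ _ m)
    (breakPt T b) K
  have hdec : ∫ t in T..2 * T, f t =
      (∑ Y ∈ range K, ((∫ t in breakPt T b Y..breakPt T b (Y + 1), f t) -
        2 * Real.pi * ∫ t in breakPt T b Y..breakPt T b (Y + 1), ∑ m ∈ range Y, p m t)) +
      2 * Real.pi * ∑ m ∈ range K, ∫ t in breakPt T b (m + 1)..breakPt T b K, p m t := by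
    rw [← htel, sum_sub_distrib, ← mul_sum, hsplit]; ring
  have hsum1 : |∑ Y ∈ range K, ((∫ t in breakPt T b Y..breakPt T b (Y + 1), f t) -
        2 * Real.pi * ∫ t in breakPt T b Y..breakPt T b (Y + 1), ∑ m ∈ range Y, p m t)| ≤
      2 * C * (T ^ σ * Real.log T) := by
    refine (abs_sum_le_sum_abs _ _).trans ((sum_le_sum fun Y _ => hB T b H Y).trans ?_)
    rw [← mul_sum, sum_add_distrib, sum_const, card_range, nsmul_eq_mul, ← mul_sum, sum_range_sub,
      breakPt_zero hT.le, hKe, mul_comm 2 C, mul_assoc]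
    gcongr
    have e1 : √T * T ^ (σ - 1 / 2) = T ^ σ := by
      rw [Real.sqrt_eq_rpow, ← Real.rpow_add hT]; congr 1; ring
    have e2 : T ^ (σ - 1) * (2 * T - T) = T ^ σ := by
      rw [Real.rpow_sub_one hT.ne']; field_simp; ring
    rw [e2]
    calc _ ≤ √T * (T ^ (σ - 1 / 2) * Real.log T) + T ^ σ := by gcongr
      _ = T ^ σ * Real.log T + T ^ σ * 1 := by rw [← mul_assoc, e1, mul_one]
      _ ≤ T ^ σ * Real.log T + T ^ σ * Real.log T := by gcongr; linarith
      _ = _ := by ring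
  have hsum2 : |∑ m ∈ range K, ∫ t in breakPt T b (m + 1)..breakPt T b K, p m t| ≤
      4 * (C' * 2) * (T ^ σ * Real.log T) := by
    calc _ ≤ ∑ m ∈ range K, 4 * ∑ n ∈ range m, ((n : ℝ) + lam) ^ (-(1 - σ)) *
          ((m : ℝ) + lam) ^ (-(1 - σ)) / Real.log (((m : ℝ) + lam) / (n + lam)) := by
          refine (abs_sum_le_sum_abs _ _).trans (sum_le_sum fun m _ => ?_)
          have hl : ∀ n < m, 0 < |Real.log (freq lam m) - Real.log (freq lam n)| := by
            intro n hn
            rw [log_freq_sub_log_freq h0]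
            exact abs_pos.mpr (log_add_div_add_pos h0 hn).ne'
          refine (abs_integral_offTerm_le (fun n => (Real.rpow_pos_of_pos (freq_pos h0 n) _).le)
            hl _ _).trans ?_
          gcongr with n hn
          · exact log_add_div_add_pos h0 (mem_range.mp hn)
          · exact (Real.rpow_pos_of_pos (freq_pos h0 m) _).le
          · exact freq_rpow_le h0 hσ.le n
          · exact freq_rpow_le h0 hσ.le m
          · rw [log_freq_sub_log_freq h0]; exact le_abs_self _
      _ ≤ 4 * (C' * (K : ℝ) ^ (2 - 2 * (1 - σ)) * (3 + Real.log (K + 1))) := by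
          rw [← mul_sum]; gcongr; exact hO K
      _ ≤ 4 * (C' * T ^ σ * (2 * Real.log T)) := by
          have e1 : (K : ℝ) ^ (2 - 2 * (1 - σ)) ≤ T ^ σ := by
            calc _ ≤ √T ^ (2 - 2 * (1 - σ)) := by gcongr; linarith
              _ = T ^ σ := by
                rw [Real.sqrt_eq_rpow, ← Real.rpow_mul hT.le]; congr 1; ring
          have e2 : Real.log ((K : ℝ) + 1) ≤ Real.log T :=
            Real.log_le_log (by positivity) (by nlinarith [H.sq_sqrt])
          have e3 : 0 ≤ Real.log ((K : ℝ) + 1) :=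
            Real.log_nonneg (by linarith [K.cast_nonneg (α := ℝ)])
          gcongr
          linarith
      _ = _ := by ring
  rw [hdec]
  refine (abs_add_le _ _).trans ?_
  rw [abs_mul, abs_of_pos (by positivity : 0 < 2 * Real.pi), add_mul, mul_assoc (2 * Real.pi)]
  gcongr

theorem sum_rpow_neg_two_le {b : ℝ} (hb : 2 ≤ b) (M : ℕ) :
    ∑ k ∈ range M, ((k : ℝ) + b) ^ (-2 : ℝ) ≤ 2 / b := by
  have key : ∑ k ∈ range M, ((k : ℝ) + b) ^ (-2 : ℝ) ≤ 1 / (b - 1) - 1 / (M + b - 1) := by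
    induction M with
    | zero => simp
    | succ M ih =>
      rw [sum_range_succ]
      have hM : (0 : ℝ) ≤ M := M.cast_nonneg
      have e : ((M : ℝ) + b) ^ (-2 : ℝ) = 1 / ((M + b) * (M + b)) := by
        rw [Real.rpow_neg (by linarith), one_div, Real.rpow_two, sq]
      have h : 1 / (((M : ℝ) + b) * (M + b)) ≤ 1 / (M + b - 1) - 1 / (M + b) := by
        rw [div_sub_div _ _ (by linarith) (by linarith)]
        have : (0 : ℝ) < M + b - 1 := by linarith
        have h2 : (0 : ℝ) < M + b := by linarith
        rw [div_le_div_iff₀ (by positivity) (by positivity)]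
        nlinarith [mul_pos this h2]
      push_cast
      rw [show (M : ℝ) + 1 + b - 1 = M + b by ring, e]
      linarith
  have h1 : 1 / (b - 1) ≤ 2 / b := by
    rw [div_le_div_iff₀ (by linarith) (by linarith)]; linarith
  have h2 : 0 ≤ 1 / ((M : ℝ) + b - 1) :=
    one_div_nonneg.mpr (by linarith [M.cast_nonneg (α := ℝ)])
  linarith

theorem cpow_neg_mul_cpow {x y : ℝ} (hx : 0 < x) (hy : 0 < y) (σ t : ℝ) :
    (y : ℂ) ^ (-(σ + t * I : ℂ)) * (x : ℂ) ^ (σ + t * I : ℂ) =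
      ((y ^ (-σ) * x ^ σ : ℝ) : ℂ) * cexp (I * (-Real.log (y / x) : ℝ) * t) := by
  have hx' : (x : ℂ) ≠ 0 := by exact_mod_cast hx.ne'
  have hy' : (y : ℂ) ≠ 0 := by exact_mod_cast hy.ne'
  rw [cpow_def_of_ne_zero hx', cpow_def_of_ne_zero hy', Real.rpow_def_of_pos hx,
    Real.rpow_def_of_pos hy, Real.log_div hy.ne' hx.ne', ← ofReal_log hx.le, ← ofReal_log hy.le]
  push_cast
  rw [← Complex.exp_add, ← Complex.exp_add, ← Complex.exp_add]
  congr 1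
  ring

theorem norm_integral_cexp_le {k : ℝ} (hk : k ≠ 0) (t₁ t₂ : ℝ) :
    ‖∫ t in t₁..t₂, cexp (I * k * t)‖ ≤ 2 / |k| := by
  have hk' : I * (k : ℂ) ≠ 0 := mul_ne_zero I_ne_zero (by exact_mod_cast hk)
  rw [integral_exp_mul_complex hk', norm_div, norm_mul, norm_I, one_mul, norm_real,
    Real.norm_eq_abs]
  gcongr
  refine (norm_sub_le _ _).trans ?_
  have h : ∀ t : ℝ, ‖cexp (I * k * t)‖ = 1 := fun t => by
    rw [mul_assoc, mul_comm I, ← ofReal_mul, norm_exp_ofReal_mul_I]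
  rw [h, h]; norm_num

theorem norm_integral_zetaL_two_mul_cpow_le {b lam x : ℝ} (h0 : 0 < lam) (h1 : lam < 1)
    (hb : 2 ≤ b) (hx : 0 < x) (hxb : x < b) (t₁ t₂ : ℝ) :
    ‖∫ t in t₁..t₂, zetaL b lam (2 + t * I) * (x : ℂ) ^ (2 + t * I : ℂ)‖ ≤
      4 * b * (x / b) ^ (2 : ℝ) / Real.log (b / x) := by
  have hb0 : 0 < b := by linarith
  have hL : 0 < Real.log (b / x) := Real.log_pos ((one_lt_div hx).mpr hxb)
  have hk : ∀ k : ℕ, 0 < (k : ℝ) + b := fun k => by positivity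
  set g : ℕ → ℝ → ℂ := fun k t => unitPt lam ^ k * (((((k : ℝ) + b) ^ (-2 : ℝ) * x ^ (2 : ℝ) : ℝ) : ℂ)
    * cexp (I * (-Real.log (((k : ℝ) + b) / x) : ℝ) * t)) with hg
  have hgc : ∀ k, Continuous (g k) := fun k => by fun_prop
  have hge : ∀ (k : ℕ) (t : ℝ), unitPt lam ^ k * ((k : ℂ) + b) ^ (-(2 + t * I : ℂ)) *
      (x : ℂ) ^ (2 + t * I : ℂ) = g k t := by
    intro k t
    have := cpow_neg_mul_cpow hx (hk k) 2 t
    push_cast at this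
    rw [hg, mul_assoc, this]
    push_cast
    rfl
  have hgn : ∀ (k : ℕ) (t : ℝ), ‖g k t‖ = ((k : ℝ) + b) ^ (-2 : ℝ) * x ^ (2 : ℝ) := by
    intro k t
    have := hk k
    rw [hg, norm_mul, norm_mul, norm_pow, norm_unitPt, one_pow, one_mul, norm_real, mul_assoc I,
      mul_comm I, ← ofReal_mul, norm_exp_ofReal_mul_I, mul_one, Real.norm_of_nonneg (by positivity)]
  have hlim : Tendsto (fun M : ℕ => ∫ t in t₁..t₂, ∑ k ∈ range M, g k t) atTop
      (nhds (∫ t in t₁..t₂, zetaL b lam (2 + t * I) * (x : ℂ) ^ (2 + t * I : ℂ))) := by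
    refine intervalIntegral.tendsto_integral_filter_of_dominated_convergence
      (fun _ => 2 / b * x ^ (2 : ℝ)) ?_ ?_ intervalIntegrable_const ?_
    · exact Eventually.of_forall fun M =>
        (continuous_finsetSum _ fun k _ => hgc k).aestronglyMeasurable
    · refine Eventually.of_forall fun M => ae_of_all _ fun t _ => (norm_sum_le _ _).trans ?_
      simp only [hgn]
      rw [← sum_mul]
      gcongr
      exact sum_rpow_neg_two_le hb M
    · refine ae_of_all _ fun t _ => ?_
      have := (tendsto_zetaL (s := 2 + t * I) hb0 h0 h1 (by simp)).mul_const
        ((x : ℂ) ^ (2 + t * I : ℂ))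
      simpa only [sum_mul, hge] using this
  refine le_of_tendsto hlim.norm (Eventually.of_forall fun M => ?_)
  rw [intervalIntegral.integral_finsetSum fun k _ => (hgc k).intervalIntegrable _ _]
  calc _ ≤ ∑ k ∈ range M, ((k : ℝ) + b) ^ (-2 : ℝ) * (x ^ (2 : ℝ) * (2 / Real.log (b / x))) := by
        refine norm_sum_le_of_le _ fun k _ => ?_
        have hk0 := hk k
        have hLk : Real.log (b / x) ≤ Real.log (((k : ℝ) + b) / x) := by
          refine Real.log_le_log (by positivity) ?_
          gcongr
          linarith [k.cast_nonneg (α := ℝ)]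
        simp only [hg]
        rw [intervalIntegral.integral_const_mul, intervalIntegral.integral_const_mul, norm_mul,
          norm_mul, norm_pow, norm_unitPt, one_pow, one_mul, norm_real,
          Real.norm_of_nonneg (by positivity), mul_assoc]
        gcongr
        refine (norm_integral_cexp_le (by linarith) _ _).trans ?_
        rw [abs_neg, abs_of_pos (hL.trans_le hLk)]
        gcongr
    _ ≤ 2 / b * (x ^ (2 : ℝ) * (2 / Real.log (b / x))) := by
        rw [← sum_mul]; gcongr; exact sum_rpow_neg_two_le hb M
    _ = _ := by
        rw [Real.rpow_two, Real.rpow_two]; field_simp; ring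

theorem integral_rpow_const_base_le {r : ℝ} (hr0 : 0 < r) (hr1 : r < 1) (u v : ℝ) :
    ∫ y in u..v, r ^ y ≤ r ^ u / Real.log (1 / r) := by
  have hL : Real.log r < 0 := Real.log_neg hr0 hr1
  have hd : ∀ y : ℝ, HasDerivAt (fun y : ℝ => r ^ y / Real.log r) (r ^ y) y := by
    intro y
    have := (Real.hasStrictDerivAt_const_rpow hr0 y).hasDerivAt.div_const (Real.log r)
    rwa [mul_div_cancel_right₀ _ hL.ne] at this
  rw [intervalIntegral.integral_eq_sub_of_hasDerivAt (fun y _ => hd y)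
    ((Real.continuous_const_rpow hr0.ne').intervalIntegrable _ _), Real.log_div one_ne_zero hr0.ne',
    Real.log_one, zero_sub, div_neg]
  have : r ^ v / Real.log r ≤ 0 := div_nonpos_of_nonneg_of_nonpos (by positivity) hL.le
  linarith

theorem exists_norm_integral_zetaL_mul_cpow_le {lam : ℝ} (h0 : 0 < lam) (h1 : lam < 1) {σ : ℝ}
    (hσ0 : 1 / 2 ≤ σ) (hσ : σ ≤ 2) :
    ∃ C : ℝ, 0 < C ∧ ∀ T b : ℝ, DyadicHyp T b → ∀ x : ℝ, 0 < x → x < b →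
      ∀ t₁ ∈ Set.Icc T (2 * T), ∀ t₂ ∈ Set.Icc T (2 * T),
      ‖∫ t in t₁..t₂, zetaL b lam (σ + t * I) * (x : ℂ) ^ (σ + t * I : ℂ)‖ ≤
        C * √T * ((x / b) ^ σ / Real.log (b / x)) := by
  obtain ⟨C, hC, hZ⟩ := exists_norm_zetaL_le h0 h1
  refine ⟨2 * C + 8, by positivity, fun T b H x hx hxb t₁ ht₁ t₂ ht₂ => ?_⟩
  have hb := H.b_pos
  have hS := H.twenty_le
  have hL : 0 < Real.log (b / x) := Real.log_pos ((one_lt_div hx).mpr hxb)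
  have hr1 : x / b < 1 := (div_lt_one hb).mpr hxb
  have hr0 : 0 < x / b := by positivity
  set f : ℂ → ℂ := fun s => zetaL b lam s * (x : ℂ) ^ s with hf
  have hdiff : DifferentiableOn ℂ f {s | 0 < s.re} :=
    (differentiableOn_zetaL hb h0 h1).mul
      (fun s _ => (differentiableAt_id.const_cpow
        (Or.inl (by exact_mod_cast hx.ne'))).differentiableWithinAt)
  have hrect := integral_boundary_rect_eq_zero_of_differentiableOn f (σ + t₁ * I) (2 + t₂ * I)
    (hdiff.mono fun s hs => by
      have := hs.1
      simp only [add_re, ofReal_re, mul_re, I_re, mul_zero, ofReal_im, I_im, mul_one, sub_self,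
        add_zero, re_ofNat, Set.mem_preimage, Set.uIcc_of_le hσ] at this
      exact lt_of_lt_of_le (by linarith) this.1)
  have hhor : ∀ t ∈ Set.Icc T (2 * T), ‖∫ y in σ..2, f (y + t * I)‖ ≤
      C * √T * ((x / b) ^ σ / Real.log (b / x)) := by
    intro t ht
    calc _ ≤ ∫ y in σ..2, C * √T * (x / b) ^ y := by
          refine intervalIntegral.norm_integral_le_of_norm_le hσ (ae_of_all _ fun y hy => ?_)
            (((Real.continuous_const_rpow hr0.ne').const_mul _).intervalIntegrable _ _)
          rw [hf, norm_mul, norm_cpow_eq_rpow_re_of_pos hx, Real.div_rpow hx.le hb.le]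
          have h := hZ T b H t ht y ⟨by linarith [hy.1], hy.2⟩
          rw [Real.rpow_neg hb.le] at h
          simp only [add_re, ofReal_re, mul_re, I_re, mul_zero, ofReal_im, I_im, mul_one, sub_self,
            add_zero]
          calc _ ≤ C * √T * (b ^ y)⁻¹ * x ^ y := by gcongr
            _ = _ := by ring
      _ ≤ _ := by
          rw [intervalIntegral.integral_const_mul]
          gcongr
          simpa using integral_rpow_const_base_le hr0 hr1 σ 2
  have hright : ‖∫ t in t₁..t₂, f (2 + t * I)‖ ≤
      8 * √T * ((x / b) ^ σ / Real.log (b / x)) := by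
    refine (norm_integral_zetaL_two_mul_cpow_le h0 h1 (by linarith [H.sqrt_le]) hx hxb _ _).trans ?_
    rw [mul_div_assoc]
    gcongr ?_ * (?_ / _)
    · linarith [H.le_sqrt]
    · exact Real.rpow_le_rpow_of_exponent_ge hr0 hr1.le hσ
  simp only [add_re, ofReal_re, mul_re, I_re, mul_zero, ofReal_im, I_im, mul_one, sub_self,
    add_zero, re_ofNat, add_im, mul_im, zero_add, im_ofNat, smul_eq_mul, ofReal_ofNat] at hrect
  have heq : I * ∫ t in t₁..t₂, f (σ + t * I) = (∫ y in σ..2, f (y + t₁ * I)) -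
      (∫ y in σ..2, f (y + t₂ * I)) + I * ∫ t in t₁..t₂, f (2 + t * I) := by
    linear_combination -hrect
  have hn : ‖∫ t in t₁..t₂, f (σ + t * I)‖ = ‖I * ∫ t in t₁..t₂, f (σ + t * I)‖ := by
    rw [norm_mul, norm_I, one_mul]
  have hn2 : ‖I * ∫ t in t₁..t₂, f (2 + t * I)‖ = ‖∫ t in t₁..t₂, f (2 + t * I)‖ := by
    rw [norm_mul, norm_I, one_mul]
  change ‖∫ t in t₁..t₂, f (σ + t * I)‖ ≤ _
  rw [hn, heq]
  refine (norm_add_le _ _).trans ?_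
  have := norm_sub_le (∫ y in σ..2, f (y + t₁ * I)) (∫ y in σ..2, f (y + t₂ * I))
  rw [hn2]
  linarith [hhor t₁ ht₁, hhor t₂ ht₂]

/-- The partial sum of length `N` of the Lerch series. -/
noncomputable def headSum (a lam : ℝ) (N : ℕ) (s : ℂ) : ℂ :=
  ∑ n ∈ range N, unitPt lam ^ n * ((n : ℂ) + a) ^ (-s)

theorem headTerm_eq {y : ℝ} (hy : 0 < y) (lam σ t : ℝ) (n : ℕ) :
    unitPt lam ^ n * (y : ℂ) ^ (-(σ + t * I : ℂ)) = ((y ^ (-σ) : ℝ) : ℂ) *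
      cexp (I * ((-Real.log y * t + 2 * Real.pi * n * lam : ℝ) : ℂ)) := by
  have hy' : (y : ℂ) ≠ 0 := by exact_mod_cast hy.ne'
  rw [unitPt, ← Complex.exp_nat_mul, cpow_def_of_ne_zero hy', Real.rpow_def_of_pos hy,
    ← ofReal_log hy.le, ofReal_exp, ← Complex.exp_add, ← Complex.exp_add]
  push_cast
  congr 1
  ring

theorem conj_headTerm {y : ℝ} (hy : 0 < y) (lam σ t : ℝ) (n : ℕ) :
    (starRingEnd ℂ) (unitPt lam ^ n * (y : ℂ) ^ (-(σ + t * I : ℂ))) =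
      (starRingEnd ℂ) (unitPt lam ^ n) * ((y ^ (-(2 * σ)) : ℝ) : ℂ) *
        (y : ℂ) ^ (σ + t * I : ℂ) := by
  have hy' : (y : ℂ) ≠ 0 := by exact_mod_cast hy.ne'
  rw [map_mul, mul_assoc]
  congr 1
  rw [cpow_def_of_ne_zero hy', cpow_def_of_ne_zero hy', Real.rpow_def_of_pos hy,
    ← ofReal_log hy.le, ofReal_exp, ← Complex.exp_add, ← exp_conj]
  simp only [map_mul, map_neg, map_add, conj_ofReal, conj_I]
  push_cast
  congr 1
  ring

theorem headSum_eq {a : ℝ} (ha : 0 < a) (lam σ t : ℝ) (N : ℕ) :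
    headSum a lam N (σ + t * I) = ∑ n ∈ range N, ((((n : ℝ) + a) ^ (-σ) : ℝ) : ℂ) *
      cexp (I * ((-Real.log ((n : ℝ) + a) * t + 2 * Real.pi * n * lam : ℝ) : ℂ)) := by
  refine sum_congr rfl fun n _ => ?_
  rw [← headTerm_eq (by positivity)]
  push_cast
  rfl

theorem continuous_headSum {a : ℝ} (ha : 0 < a) (lam σ : ℝ) (N : ℕ) :
    Continuous fun t : ℝ => headSum a lam N (σ + t * I) := by
  simp only [headSum_eq ha]
  fun_prop

theorem conj_headSum {a : ℝ} (ha : 0 < a) (lam σ t : ℝ) (N : ℕ) :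
    (starRingEnd ℂ) (headSum a lam N (σ + t * I)) =
      ∑ n ∈ range N, (starRingEnd ℂ) (unitPt lam ^ n) * ((((n : ℝ) + a) ^ (-(2 * σ)) : ℝ) : ℂ) *
        (((n : ℝ) + a : ℝ) : ℂ) ^ (σ + t * I : ℂ) := by
  rw [headSum, map_sum]
  refine sum_congr rfl fun n _ => ?_
  rw [← conj_headTerm (by positivity)]
  push_cast
  rfl

theorem norm_sq_headSum {a : ℝ} (ha : 0 < a) (lam σ t : ℝ) (N : ℕ) :
    ‖headSum a lam N (σ + t * I)‖ ^ 2 = ∑ n ∈ range N, ((n : ℝ) + a) ^ (-(2 * σ)) +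
      ∑ m ∈ range N, offTerm (fun n => ((n : ℝ) + a) ^ (-σ)) (fun n => -Real.log ((n : ℝ) + a))
        (fun n => 2 * Real.pi * n * lam) m t := by
  rw [headSum_eq ha, norm_sq_sum_cexp]
  congr 1
  refine sum_congr rfl fun n _ => ?_
  rw [← Real.rpow_natCast, ← Real.rpow_mul (by positivity)]
  congr 1
  push_cast
  ring

theorem norm_sq_zetaL_eq {a lam σ : ℝ} (ha : 0 < a) (h0 : 0 < lam) (h1 : lam < 1) (hσ : 0 < σ)
    (N : ℕ) (t : ℝ) :
    ‖zetaL a lam (σ + t * I)‖ ^ 2 = ‖zetaL (N + a) lam (σ + t * I)‖ ^ 2 +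
      ‖headSum a lam N (σ + t * I)‖ ^ 2 +
      2 * (unitPt lam ^ N * zetaL (N + a) lam (σ + t * I) *
        (starRingEnd ℂ) (headSum a lam N (σ + t * I))).re := by
  rw [zetaL_eq_sum_add ha h0 h1 (by simpa using hσ) N, ← headSum]
  have h : ‖zetaL (N + a) lam (σ + t * I)‖ ^ 2 =
      ‖unitPt lam ^ N * zetaL (N + a) lam (σ + t * I)‖ ^ 2 := by
    rw [norm_mul, norm_pow, norm_unitPt, one_pow, one_mul]
  rw [h]
  generalize unitPt lam ^ N * zetaL (N + a) lam (σ + t * I) = τ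
  generalize headSum a lam N (σ + t * I) = A
  simp only [Complex.sq_norm, normSq_apply, mul_re, conj_re, conj_im, add_re, add_im]
  ring

theorem DyadicHyp.log_le {T b : ℝ} (H : DyadicHyp T b) : Real.log (b + 1) ≤ Real.log T :=
  Real.log_le_log (by linarith [H.b_pos]) (by nlinarith [H.le_sqrt, H.sq_sqrt, H.twenty_le])

theorem exists_abs_integral_cross_le {a lam : ℝ} (ha : 0 < a) (h0 : 0 < lam) (h1 : lam < 1) {σ : ℝ}
    (hσ0 : 1 / 2 < σ) (hσ : σ < 1) :
    ∃ C : ℝ, 0 < C ∧ ∀ (T : ℝ) (N : ℕ), DyadicHyp T (N + a) → ∀ u ∈ Set.Icc T (2 * T),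
      |∫ t in T..u, (unitPt lam ^ N * zetaL (N + a) lam (σ + t * I) *
        (starRingEnd ℂ) (headSum a lam N (σ + t * I))).re| ≤ C * (T ^ (1 - σ) * Real.log T) := by
  obtain ⟨C, hC, hZ⟩ := exists_norm_integral_zetaL_mul_cpow_le h0 h1 hσ0.le (by linarith : σ ≤ 2)
  obtain ⟨C', hC', hS⟩ := sum_rpow_div_log_le (by linarith : 0 < σ) hσ ha
  refine ⟨C * (C' * 2), by positivity, fun T N H u hu => ?_⟩
  have hT := H.T_pos
  have hb := H.b_pos
  have h20 := H.twenty_le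
  have hl3 := H.three_le_log
  set b : ℝ := N + a with hbdef
  obtain ⟨hpos, hsum⟩ := hS N b (by linarith) (by linarith [H.sqrt_le])
  have hn0 : ∀ n : ℕ, 0 < (n : ℝ) + a := fun n => by positivity
  set g : ℕ → ℝ → ℂ := fun n t => zetaL b lam (σ + t * I) * (((n : ℝ) + a : ℝ) : ℂ) ^ (σ + t * I : ℂ)
    with hg
  have hgc : ∀ n, Continuous (g n) := fun n => by
    refine (continuous_zetaL hb h0 h1 (by linarith)).mul (Continuous.const_cpow (by fun_prop) ?_)
    exact Or.inl (by exact_mod_cast (hn0 n).ne')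
  set c : ℕ → ℂ := fun n => unitPt lam ^ N * (starRingEnd ℂ) (unitPt lam ^ n) *
    ((((n : ℝ) + a) ^ (-(2 * σ)) : ℝ) : ℂ) with hc
  have hcn : ∀ n, ‖c n‖ = ((n : ℝ) + a) ^ (-(2 * σ)) := fun n => by
    have := hn0 n
    rw [hc, norm_mul, norm_mul, RCLike.norm_conj, norm_pow, norm_pow, norm_unitPt, one_pow, one_pow,
      one_mul, one_mul, norm_real, Real.norm_of_nonneg (by positivity)]
  have heq : ∀ t : ℝ, unitPt lam ^ N * zetaL b lam (σ + t * I) *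
      (starRingEnd ℂ) (headSum a lam N (σ + t * I)) = ∑ n ∈ range N, c n * g n t := by
    intro t
    rw [conj_headSum ha, mul_sum]
    refine sum_congr rfl fun n _ => ?_
    rw [hc, hg]
    ring
  have hre : ∫ t in T..u, (∑ n ∈ range N, c n * g n t).re =
      (∫ t in T..u, ∑ n ∈ range N, c n * g n t).re :=
    reCLM.intervalIntegral_comp_comm
      ((continuous_finsetSum _ fun n _ => (hgc n).const_mul _).intervalIntegrable _ _)
  simp only [heq]
  rw [hre]
  refine (abs_re_le_norm _).trans ?_
  rw [intervalIntegral.integral_finsetSum fun n _ => ((hgc n).const_mul _).intervalIntegrable _ _]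
  have hterm : ∀ n ∈ range N, ‖∫ t in T..u, c n * g n t‖ ≤
      C * √T * b ^ (-σ) * (((n : ℝ) + a) ^ (-σ) / Real.log (b / (n + a))) := by
    intro n hn
    have hnb : (n : ℝ) + a < b := by
      have : (n : ℝ) < N := by exact_mod_cast mem_range.mp hn
      linarith
    have hn' := hn0 n
    rw [intervalIntegral.integral_const_mul, norm_mul, hcn]
    calc _ ≤ ((n : ℝ) + a) ^ (-(2 * σ)) * (C * √T * ((((n : ℝ) + a) / b) ^ σ /
          Real.log (b / (n + a)))) := by
          gcongr
          exact hZ T b H _ hn' hnb T ⟨le_rfl, by linarith⟩ u hu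
      _ = _ := by
          rw [Real.div_rpow hn'.le hb.le, Real.rpow_neg hb.le, show -(2 * σ) = -σ + -σ by ring,
            Real.rpow_add hn', Real.rpow_neg hn'.le]
          have : 0 < ((n : ℝ) + a) ^ σ := by positivity
          field_simp
  calc _ ≤ ∑ n ∈ range N, C * √T * b ^ (-σ) *
        (((n : ℝ) + a) ^ (-σ) / Real.log (b / (n + a))) := norm_sum_le_of_le _ hterm
    _ ≤ C * √T * b ^ (-σ) * (C' * b ^ (1 - σ) * (3 + Real.log b)) := by
        rw [← mul_sum]; gcongr
    _ = C * C' * (√T * b ^ (1 - 2 * σ)) * (3 + Real.log b) := by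
        rw [show 1 - 2 * σ = -σ + (1 - σ) by ring, Real.rpow_add hb]; ring
    _ ≤ C * C' * T ^ (1 - σ) * (2 * Real.log T) := by
        have e1 : √T * b ^ (1 - 2 * σ) ≤ T ^ (1 - σ) := by
          calc _ ≤ √T * √T ^ (1 - 2 * σ) := by
                gcongr √T * ?_
                exact Real.rpow_le_rpow_of_nonpos (by linarith) H.sqrt_le (by linarith)
            _ = T ^ (1 - σ) := by
                rw [Real.sqrt_eq_rpow, ← Real.rpow_mul hT.le, ← Real.rpow_add hT]
                congr 1; ring
        have e2 : Real.log b ≤ Real.log (b + 1) := Real.log_le_log hb (by linarith)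
        have e3 := H.log_le
        have e4 : 0 ≤ Real.log b := Real.log_nonneg (by linarith [H.sqrt_le])
        gcongr
        linarith
    _ = _ := by ring

theorem exists_abs_integral_offdiag_le {a : ℝ} (ha : 0 < a) (ha1 : a ≤ 1) (lam : ℝ) {σ : ℝ}
    (hσ0 : 1 / 2 < σ) (hσ : σ < 1) :
    ∃ C : ℝ, 0 < C ∧ ∀ (T : ℝ) (N : ℕ), DyadicHyp T (N + a) → ∀ u : ℝ,
      |∫ t in T..u, ∑ m ∈ range N, offTerm (fun n => ((n : ℝ) + a) ^ (-σ))
        (fun n => -Real.log ((n : ℝ) + a)) (fun n => 2 * Real.pi * n * lam) m t| ≤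
        C * (T ^ (1 - σ) * Real.log T) := by
  obtain ⟨C, hC, hO⟩ := sum_offdiag_le (by linarith : 0 < σ) hσ ha ha1
  refine ⟨4 * (C * 2 * 2), by positivity, fun T N H u => ?_⟩
  have hT := H.T_pos
  have h20 := H.twenty_le
  have hl3 := H.three_le_log
  have hlog : ∀ n m : ℕ, -Real.log ((m : ℝ) + a) - -Real.log ((n : ℝ) + a) =
      -Real.log (((m : ℝ) + a) / (n + a)) := by
    intro n m
    rw [Real.log_div (by positivity) (by positivity)]; ring
  rw [intervalIntegral.integral_finsetSum fun m _ =>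
    (continuous_offTerm _ _ _ m).intervalIntegrable _ _]
  calc _ ≤ ∑ m ∈ range N, 4 * ∑ n ∈ range m, ((n : ℝ) + a) ^ (-σ) *
        ((m : ℝ) + a) ^ (-σ) / Real.log (((m : ℝ) + a) / (n + a)) := by
        refine (abs_sum_le_sum_abs _ _).trans (sum_le_sum fun m _ => ?_)
        refine (abs_integral_offTerm_le (fun n => by positivity) (fun n hn => ?_) _ _).trans_eq ?_
        · rw [hlog, abs_neg]
          exact abs_pos.mpr (log_add_div_add_pos ha hn).ne'
        · congr 1
          refine sum_congr rfl fun n hn => ?_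
          rw [hlog, abs_neg, abs_of_pos (log_add_div_add_pos ha (mem_range.mp hn))]
    _ ≤ 4 * (C * (N : ℝ) ^ (2 - 2 * σ) * (3 + Real.log (N + 1))) := by
        rw [← mul_sum]; gcongr; exact hO N
    _ ≤ 4 * (C * (2 * T ^ (1 - σ)) * (2 * Real.log T)) := by
        have e1 : (N : ℝ) ^ (2 - 2 * σ) ≤ 2 * T ^ (1 - σ) := by
          calc _ ≤ (2 * √T) ^ (2 - 2 * σ) := by
                gcongr
                · linarith
                · linarith [H.le_sqrt]
            _ = 2 ^ (2 - 2 * σ) * T ^ (1 - σ) := by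
                rw [Real.mul_rpow (by norm_num) (by positivity), Real.sqrt_eq_rpow,
                  ← Real.rpow_mul hT.le]
                congr 2; ring
            _ ≤ 2 ^ (1 : ℝ) * T ^ (1 - σ) := by
                gcongr
                · norm_num
                · linarith
            _ = _ := by rw [Real.rpow_one]
        have e2 : Real.log ((N : ℝ) + 1) ≤ Real.log T :=
          (Real.log_le_log (by positivity) (by linarith)).trans H.log_le
        have e3 : 0 ≤ Real.log ((N : ℝ) + 1) :=
          Real.log_nonneg (by linarith [N.cast_nonneg (α := ℝ)])
        gcongr
        linarith
    _ = _ := by ring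

theorem exists_abs_integral_sub_tail_le {a lam : ℝ} (ha : 0 < a) (ha1 : a ≤ 1) (h0 : 0 < lam)
    (h1 : lam < 1) {σ : ℝ} (hσ0 : 1 / 2 < σ) (hσ : σ < 1) :
    ∃ C : ℝ, 0 < C ∧ ∀ (T : ℝ) (N : ℕ), DyadicHyp T (N + a) → ∀ u ∈ Set.Icc T (2 * T),
      |∫ t in T..u, (‖zetaL a lam (σ + t * I)‖ ^ 2 - ‖zetaL (N + a) lam (σ + t * I)‖ ^ 2 -
        ∑ n ∈ range N, ((n : ℝ) + a) ^ (-(2 * σ)))| ≤ C * (T ^ (1 - σ) * Real.log T) := by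
  obtain ⟨C, hC, hX⟩ := exists_abs_integral_cross_le ha h0 h1 hσ0 hσ
  obtain ⟨C', hC', hO⟩ := exists_abs_integral_offdiag_le ha ha1 lam hσ0 hσ
  refine ⟨C' + 2 * C, by positivity, fun T N H u hu => ?_⟩
  have hc1 := continuous_zetaL H.b_pos h0 h1 (by linarith : 0 < σ)
  have hc2 := continuous_headSum ha lam σ N
  have hc3 : Continuous fun t : ℝ => (unitPt lam ^ N * zetaL (N + a) lam (σ + t * I) *
      (starRingEnd ℂ) (headSum a lam N (σ + t * I))).re :=
    continuous_re.comp ((hc1.const_mul _).mul (continuous_conj.comp hc2))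
  have hc4 : Continuous fun t : ℝ => ∑ m ∈ range N, offTerm (fun n => ((n : ℝ) + a) ^ (-σ))
        (fun n => -Real.log ((n : ℝ) + a)) (fun n => 2 * Real.pi * n * lam) m t :=
    continuous_finsetSum _ fun m _ => continuous_offTerm _ _ _ m
  have heq : ∀ t : ℝ, ‖zetaL a lam (σ + t * I)‖ ^ 2 - ‖zetaL (N + a) lam (σ + t * I)‖ ^ 2 -
        ∑ n ∈ range N, ((n : ℝ) + a) ^ (-(2 * σ)) =
      ∑ m ∈ range N, offTerm (fun n => ((n : ℝ) + a) ^ (-σ))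
        (fun n => -Real.log ((n : ℝ) + a)) (fun n => 2 * Real.pi * n * lam) m t +
      2 * (unitPt lam ^ N * zetaL (N + a) lam (σ + t * I) *
        (starRingEnd ℂ) (headSum a lam N (σ + t * I))).re := by
    intro t
    rw [norm_sq_zetaL_eq ha h0 h1 (by linarith) N, norm_sq_headSum ha]
    ring
  simp only [heq]
  rw [intervalIntegral.integral_add (hc4.intervalIntegrable _ _)
    ((hc3.const_mul 2).intervalIntegrable _ _), intervalIntegral.integral_const_mul]
  refine (abs_add_le _ _).trans ?_
  rw [abs_mul, abs_of_pos (by norm_num : (0 : ℝ) < 2)]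
  linarith [hX T N H u hu, hO T N H u]

theorem abs_integral_rpow_mul_le {f : ℝ → ℝ} (hf : Continuous f) {T p E : ℝ} (hT : 0 < T)
    (hp : 0 < p) (hE : ∀ u ∈ Set.Icc T (2 * T), |∫ t in T..u, f t| ≤ E) :
    |∫ t in T..2 * T, t ^ p * f t| ≤ 2 * (2 * T) ^ p * E := by
  have hT2 : T ≤ 2 * T := by linarith
  have hpos : ∀ x ∈ Set.uIcc T (2 * T), 0 < x := fun x hx => by
    rw [Set.uIcc_of_le hT2] at hx; linarith [hx.1]
  have hd : ∀ x ∈ Set.uIcc T (2 * T), HasDerivAt (fun t : ℝ => t ^ p) (p * x ^ (p - 1)) x :=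
    fun x hx => Real.hasDerivAt_rpow_const (Or.inl (hpos x hx).ne')
  have hi : IntervalIntegrable (fun x : ℝ => p * x ^ (p - 1)) volume T (2 * T) :=
    ContinuousOn.intervalIntegrable
      (continuousOn_const.mul (continuousOn_id.rpow_const fun x hx => Or.inl (hpos x hx).ne'))
  have hE0 : 0 ≤ E := (abs_nonneg _).trans (hE (2 * T) ⟨hT2, le_rfl⟩)
  rw [intervalIntegral.integral_mul_deriv_eq_deriv_mul hd
    (fun x _ => intervalIntegral.integral_hasDerivAt_right (hf.intervalIntegrable T x)
      (hf.stronglyMeasurableAtFilter _ _) hf.continuousAt) hi (hf.intervalIntegrable _ _),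
    intervalIntegral.integral_same, mul_zero, sub_zero]
  have h1 : |(2 * T) ^ p * ∫ t in T..2 * T, f t| ≤ (2 * T) ^ p * E := by
    rw [abs_mul, abs_of_pos (by positivity)]
    gcongr
    exact hE _ ⟨hT2, le_rfl⟩
  have h2 : |∫ x in T..2 * T, p * x ^ (p - 1) * ∫ t in T..x, f t| ≤ (2 * T) ^ p * E := by
    calc _ ≤ ∫ x in T..2 * T, p * x ^ (p - 1) * E := by
          rw [← Real.norm_eq_abs]
          refine intervalIntegral.norm_integral_le_of_norm_le hT2 (ae_of_all _ fun x hx => ?_)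
            (hi.mul_const E)
          have hx0 : 0 < x := by linarith [hx.1]
          rw [norm_mul, Real.norm_of_nonneg (by positivity)]
          gcongr
          exact hE x ⟨hx.1.le, hx.2⟩
      _ = ((2 * T) ^ p - T ^ p) * E := by
          rw [intervalIntegral.integral_mul_const,
            intervalIntegral.integral_eq_sub_of_hasDerivAt hd hi]
      _ ≤ _ := by
          gcongr
          linarith [Real.rpow_pos_of_pos hT p]
  refine (abs_sub _ _).trans ?_
  linarith

theorem dyadicHyp_ceil {a T : ℝ} (ha : 0 < a) (ha1 : a ≤ 1) (hT : 400 ≤ T) :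
    DyadicHyp T ((⌈√T⌉₊ : ℕ) + a) where
  le_T := hT
  sqrt_le := by linarith [Nat.le_ceil √T]
  le_sqrt := by linarith [Nat.ceil_lt_add_one (Real.sqrt_nonneg T)]

theorem exists_abs_dyadic_integral_le {a lam : ℝ} (ha : 0 < a) (ha1 : a ≤ 1) (h0 : 0 < lam)
    (h1 : lam < 1) {σ : ℝ} (hσ0 : 1 / 2 < σ) (hσ : σ < 1) :
    ∃ Z₁ : ℝ, hzeta a ((2 * σ : ℝ) : ℂ) = Z₁ ∧ ∃ Z₂ : ℝ, hzeta lam ((2 - 2 * σ : ℝ) : ℂ) = Z₂ ∧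
    ∃ C : ℝ, 0 < C ∧ ∀ T : ℝ, 400 ≤ T →
      |∫ t in T..2 * T, (t ^ (2 * σ - 1) * ‖zetaL a lam (σ + t * I)‖ ^ 2 -
        (Z₁ * t ^ (2 * σ - 1) + (2 * Real.pi) ^ (2 * σ - 1) * Z₂))| ≤
        C * (T ^ σ * Real.log T) := by
  obtain ⟨Z₁, hZ₁, hA⟩ := hzeta_asymp ha ha1 (s := 2 * σ) (by linarith) (by intro h; linarith)
  obtain ⟨Z₂, hZ₂, C, hC, hB⟩ := exists_tail_le h0 h1 hσ0 hσ
  obtain ⟨C', hC', hD⟩ := exists_abs_integral_sub_tail_le ha ha1 h0 h1 hσ0 hσ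
  refine ⟨Z₁, hZ₁, Z₂, hZ₂, 4 * C' + C + 2, by positivity, fun T hT4 => ?_⟩
  set N : ℕ := ⌈√T⌉₊
  have H : DyadicHyp T (N + a) := dyadicHyp_ceil ha ha1 hT4
  have hT := H.T_pos
  have hb := H.b_pos
  have hl3 := H.three_le_log
  have h20 := H.twenty_le
  have hp : 0 < 2 * σ - 1 := by linarith
  have hB' := hB T (N + a) H
  have hD' := hD T N H
  have hA' := hA N
  set b : ℝ := N + a
  set S : ℝ := ∑ n ∈ range N, ((n : ℝ) + a) ^ (-(2 * σ))
  have cr : Continuous fun t : ℝ => t ^ (2 * σ - 1) := Real.continuous_rpow_const hp.le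
  have cz := continuous_zetaL ha h0 h1 (by linarith : 0 < σ)
  have cb := continuous_zetaL hb h0 h1 (by linarith : 0 < σ)
  have h2T : (2 * T) ^ (2 * σ - 1) ≤ 2 * T ^ (2 * σ - 1) := by
    rw [Real.mul_rpow (by norm_num) hT.le]
    gcongr
    calc (2 : ℝ) ^ (2 * σ - 1) ≤ 2 ^ (1 : ℝ) := by gcongr; exacts [by norm_num, by linarith]
      _ = 2 := Real.rpow_one 2
  have hW := abs_integral_rpow_mul_le (by fun_prop) hT hp hD'
  have hdec : ∫ t in T..2 * T, (t ^ (2 * σ - 1) * ‖zetaL a lam (σ + t * I)‖ ^ 2 -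
        (Z₁ * t ^ (2 * σ - 1) + (2 * Real.pi) ^ (2 * σ - 1) * Z₂)) =
      (∫ t in T..2 * T, t ^ (2 * σ - 1) * (‖zetaL a lam (σ + t * I)‖ ^ 2 -
        ‖zetaL b lam (σ + t * I)‖ ^ 2 - S)) +
      (∫ t in T..2 * T, (t ^ (2 * σ - 1) * ‖zetaL b lam (σ + t * I)‖ ^ 2 -
          ((2 * Real.pi) ^ (2 * σ - 1) * Z₂ + t ^ (2 * σ - 1) * b ^ (1 - 2 * σ) / (2 * σ - 1)))) +
      ∫ t in T..2 * T, t ^ (2 * σ - 1) * (S - Z₁ - b ^ (1 - 2 * σ) / (1 - 2 * σ)) := by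
    rw [← intervalIntegral.integral_add, ← intervalIntegral.integral_add]
    · refine intervalIntegral.integral_congr fun t _ => ?_
      rw [show 1 - 2 * σ = -(2 * σ - 1) by ring, div_neg]
      ring
    all_goals exact Continuous.intervalIntegrable (by fun_prop) _ _
  have hlast : |∫ t in T..2 * T, t ^ (2 * σ - 1) * (S - Z₁ - b ^ (1 - 2 * σ) / (1 - 2 * σ))| ≤
      2 * (T ^ σ * Real.log T) := by
    rw [← Real.norm_eq_abs]
    calc _ ≤ (2 * T ^ (2 * σ - 1)) * T ^ (-σ) * |2 * T - T| := by
          refine intervalIntegral.norm_integral_le_of_norm_le_const fun t ht => ?_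
          rw [Set.uIoc_of_le (by linarith)] at ht
          have ht0 : 0 < t := by linarith [ht.1]
          rw [norm_mul, Real.norm_of_nonneg (by positivity), Real.norm_eq_abs]
          gcongr
          · refine le_trans ?_ h2T
            gcongr
            exact ht.2
          · refine hA'.trans ?_
            calc b ^ (-(2 * σ)) ≤ √T ^ (-(2 * σ)) :=
                  Real.rpow_le_rpow_of_nonpos (by linarith) H.sqrt_le (by linarith)
              _ = T ^ (-σ) := by
                  rw [Real.sqrt_eq_rpow, ← Real.rpow_mul hT.le]; congr 1; ring
      _ = 2 * (T ^ σ * 1) := by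
          rw [show 2 * T - T = T by ring, abs_of_pos hT,
            show σ = (2 * σ - 1) + -σ + 1 by ring, Real.rpow_add hT, Real.rpow_add hT,
            Real.rpow_one]
          ring_nf
      _ ≤ _ := by gcongr; linarith
  have hfirst : 2 * (2 * T) ^ (2 * σ - 1) * (C' * (T ^ (1 - σ) * Real.log T)) ≤
      4 * C' * (T ^ σ * Real.log T) := by
    calc _ ≤ 2 * (2 * T ^ (2 * σ - 1)) * (C' * (T ^ (1 - σ) * Real.log T)) := by gcongr
      _ = 4 * C' * ((T ^ (2 * σ - 1) * T ^ (1 - σ)) * Real.log T) := by ring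
      _ = _ := by rw [← Real.rpow_add hT]; ring_nf
  rw [hdec]
  refine (abs_add_three _ _ _).trans ?_
  linarith

theorem one_le_rpow_mul_log {T σ : ℝ} (hσ : 0 ≤ σ) (hT : 400 ≤ T) : 1 ≤ T ^ σ * Real.log T := by
  have h1 : 1 ≤ T ^ σ := Real.one_le_rpow (by linarith) hσ
  have h2 : 1 ≤ Real.log T := by
    rw [Real.le_log_iff_exp_le (by linarith)]
    linarith [Real.exp_one_lt_d9]
  nlinarith

theorem exists_abs_integral_le_of_dyadic {h : ℝ → ℝ} (hh : Continuous h) {σ C : ℝ}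
    (hσ : 1 / 2 ≤ σ) (hC : 0 < C)
    (hd : ∀ T : ℝ, 400 ≤ T → |∫ t in T..2 * T, h t| ≤ C * (T ^ σ * Real.log T)) (c : ℝ) :
    ∃ C' : ℝ, ∀ T : ℝ, 400 ≤ T → |∫ t in c..T, h t| ≤ C' * (T ^ σ * Real.log T) := by
  have hcont : Continuous fun T : ℝ => ∫ t in c..T, h t :=
    intervalIntegral.continuous_primitive (fun _ _ => hh.intervalIntegrable _ _) c
  obtain ⟨B, hB⟩ := (isCompact_Icc (a := (400 : ℝ)) (b := 800)).exists_bound_of_continuousOn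
    hcont.continuousOn
  have hB0 : 0 ≤ B := (norm_nonneg _).trans (hB 400 (by norm_num))
  refine ⟨B + 3 * C, fun T hT => ?_⟩
  obtain ⟨n, hn⟩ := pow_unbounded_of_one_lt T (one_lt_two : (1 : ℝ) < 2)
  have key : ∀ n : ℕ, ∀ T : ℝ, 400 ≤ T → T ≤ 2 ^ n * 800 →
      |∫ t in c..T, h t| ≤ (B + 3 * C) * (T ^ σ * Real.log T) := by
    intro n
    induction n with
    | zero =>
      intro T hT hT'
      have h1 := one_le_rpow_mul_log (by linarith : 0 ≤ σ) hT
      have h2 := hB T ⟨hT, by linarith⟩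
      rw [Real.norm_eq_abs] at h2
      nlinarith
    | succ n ih =>
      intro T hT hT'
      rcases le_or_gt T 800 with h8 | h8
      · have h1 := one_le_rpow_mul_log (by linarith : 0 ≤ σ) hT
        have h2 := hB T ⟨hT, h8⟩
        rw [Real.norm_eq_abs] at h2
        nlinarith
      · have i1 := ih (T / 2) (by linarith) (by rw [pow_succ] at hT'; linarith)
        have i2 := hd (T / 2) (by linarith)
        rw [show 2 * (T / 2) = T by ring] at i2
        rw [← intervalIntegral.integral_add_adjacent_intervals (hh.intervalIntegrable c (T / 2))
          (hh.intervalIntegrable (T / 2) T)]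
        have h5 : (7 / 5 : ℝ) ≤ 2 ^ σ := by
          calc (7 / 5 : ℝ) ≤ √2 := Real.le_sqrt_of_sq_le (by norm_num)
            _ = 2 ^ (1 / 2 : ℝ) := Real.sqrt_eq_rpow 2
            _ ≤ 2 ^ σ := by gcongr; norm_num
        have h6 : 0 ≤ Real.log T := Real.log_nonneg (by linarith)
        have h7 : (T / 2) ^ σ * Real.log (T / 2) ≤ (5 / 7) * (T ^ σ * Real.log T) := by
          calc _ ≤ (T / 2) ^ σ * Real.log T := by gcongr; linarith
            _ = (2 ^ σ)⁻¹ * (T ^ σ * Real.log T) := by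
                rw [Real.div_rpow (by linarith) (by norm_num)]; ring
            _ ≤ _ := by
                gcongr
                rw [inv_le_comm₀ (by positivity) (by norm_num)]
                linarith
        have h9 : 0 ≤ T ^ σ * Real.log T := by positivity
        refine (abs_add_le _ _).trans ?_
        calc _ ≤ (B + 3 * C + C) * ((T / 2) ^ σ * Real.log (T / 2)) := by linarith
          _ ≤ (B + 3 * C + C) * ((5 / 7) * (T ^ σ * Real.log T)) := by gcongr
          _ = ((B + 3 * C + C) * (5 / 7)) * (T ^ σ * Real.log T) := by ring
          _ ≤ _ := by gcongr; linarith
  exact key n T hT (by linarith)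

theorem stmt19 (a lam : ℝ) (ha : 0 < a) (ha1 : a ≤ 1) (hl1 : 0 < lam) (hl2 : lam < 1)
    (σ : ℝ) (h1 : 1 / 2 < σ) (h2 : σ < 1) :
    (fun T : ℝ =>
        ((∫ t in (1 : ℝ)..T, t ^ (2 * σ - 1) * ‖zetaL a lam (σ + t * I)‖ ^ 2 : ℝ) : ℂ)
        - (1 / (2 * σ) : ℝ) * hzeta a ((2 * σ : ℝ) : ℂ) * (T : ℂ) ^ ((2 * σ : ℝ) : ℂ)
        - ((2 * Real.pi : ℝ) : ℂ) ^ ((2 * σ - 1 : ℝ) : ℂ) *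
            hzeta lam ((2 - 2 * σ : ℝ) : ℂ) * (T : ℂ))
      =O[atTop] fun T : ℝ => T ^ σ * Real.log T := by
  obtain ⟨Z₁, hZ₁, Z₂, hZ₂, C, hC, hd⟩ := exists_abs_dyadic_integral_le ha ha1 hl1 hl2 h1 h2
  have cr : Continuous fun t : ℝ => t ^ (2 * σ - 1) := Real.continuous_rpow_const (by linarith)
  have cz := continuous_zetaL ha hl1 hl2 (by linarith : 0 < σ)
  obtain ⟨C', hC'⟩ := exists_abs_integral_le_of_dyadic (by fun_prop) h1.le hC hd 1
  set W : ℝ := (2 * Real.pi) ^ (2 * σ - 1) with hW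
  refine Asymptotics.IsBigO.of_bound (C' + |Z₁ / (2 * σ) + W * Z₂|) ?_
  filter_upwards [eventually_ge_atTop (400 : ℝ)] with T hT
  have hT0 : 0 < T := by linarith
  have hi : ∫ t in (1 : ℝ)..T, (t ^ (2 * σ - 1) * ‖zetaL a lam (σ + t * I)‖ ^ 2 -
      (Z₁ * t ^ (2 * σ - 1) + W * Z₂)) =
      (∫ t in (1 : ℝ)..T, t ^ (2 * σ - 1) * ‖zetaL a lam (σ + t * I)‖ ^ 2) -
      (Z₁ * ((T ^ (2 * σ) - 1) / (2 * σ)) + W * Z₂ * (T - 1)) := by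
    rw [intervalIntegral.integral_sub, intervalIntegral.integral_add,
      intervalIntegral.integral_const_mul, integral_rpow (Or.inl (by linarith)),
      intervalIntegral.integral_const, Real.one_rpow, sub_add_cancel, smul_eq_mul,
      mul_comm (T - 1)]
    all_goals exact Continuous.intervalIntegrable (by fun_prop) _ _
  have hone := one_le_rpow_mul_log (by linarith : 0 ≤ σ) hT
  have hreal : ((∫ t in (1 : ℝ)..T, t ^ (2 * σ - 1) * ‖zetaL a lam (σ + t * I)‖ ^ 2 : ℝ) : ℂ)
        - (1 / (2 * σ) : ℝ) * hzeta a ((2 * σ : ℝ) : ℂ) * (T : ℂ) ^ ((2 * σ : ℝ) : ℂ)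
        - ((2 * Real.pi : ℝ) : ℂ) ^ ((2 * σ - 1 : ℝ) : ℂ) *
            hzeta lam ((2 - 2 * σ : ℝ) : ℂ) * (T : ℂ) =
      (((∫ t in (1 : ℝ)..T, (t ^ (2 * σ - 1) * ‖zetaL a lam (σ + t * I)‖ ^ 2 -
        (Z₁ * t ^ (2 * σ - 1) + W * Z₂))) - (Z₁ / (2 * σ) + W * Z₂) : ℝ) : ℂ) := by
    rw [hi, hZ₁, hZ₂, ← ofReal_cpow hT0.le, ← ofReal_cpow (by positivity), ← hW]
    norm_cast
    ring
  rw [hreal, norm_real, Real.norm_eq_abs, Real.norm_of_nonneg (by linarith), add_mul]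
  refine (abs_sub _ _).trans (add_le_add (hC' T hT) ?_)
  exact le_mul_of_one_le_right (abs_nonneg _) hone
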